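/- Assume K := (n + 2 − max{dim V₁*, dim V₂*})/2^{d₁+d₂−2} > 7(d₁+d₂−1). Then the singular integral J = ∫_ℝ I(β) dβ is absolutely convergent, and for all sufficiently large φ one has |J − J(φ)| ≪ φ^{−1}, the implied constant depending only on F, n, m and r. -/

import Mathlib

open MvPolynomial MeasureTheory
open scoped BigOperators ENNReal Classical

noncomputable section

namespace PaperTM

/-- Index type for the `n + 2` variables `(x₀,…,x_r, y_{r+1},…,y_m, z_{m+1},…,z_{n+1})`. -/
abbrev Idx (n m r : ℕ) := Fin (r + 1) ⊕ (Fin (m - r) ⊕ Fin (n - m + 1))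

/-- `e(t) = exp(2 π i t)`. -/
def eexp (t : ℝ) : ℂ := Complex.exp (2 * Real.pi * Complex.I * t)

variable {n m r : ℕ}

/-- Evaluation of `F` at a triple of vectors with entries in a commutative ring. -/
def evalF {R : Type} [CommRing R] (F : MvPolynomial (Idx n m r) ℤ)
    (x : Fin (r + 1) → R) (y : Fin (m - r) → R) (z : Fin (n - m + 1) → R) : R :=
  MvPolynomial.aeval (Sum.elim x (Sum.elim y z)) F

/-- `F` is bihomogeneous of bidegree `(d₁, d₂)`:
`F(a𝐱, ab𝐲, b𝐳) = a^{d₁} b^{d₂} F(𝐱,𝐲,𝐳)` for all scalars `a, b`. -/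
def Bihomogeneous (F : MvPolynomial (Idx n m r) ℤ) (d₁ d₂ : ℕ) : Prop :=
  ∀ (R : Type) [CommRing R], ∀ (a b : R) (x : Fin (r + 1) → R) (y : Fin (m - r) → R)
    (z : Fin (n - m + 1) → R),
    evalF F (fun i => a * x i) (fun j => a * b * y j) (fun k => b * z k) =
      a ^ d₁ * b ^ d₂ * evalF F x y z

/-- The partial derivative `∂F/∂t_i`, viewed as a polynomial with complex coefficients. -/
def pderivC (F : MvPolynomial (Idx n m r) ℤ) (i : Idx n m r) :
    MvPolynomial (Idx n m r) ℂ :=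
  MvPolynomial.map (Int.castRingHom ℂ) (MvPolynomial.pderiv i F)

/-- The ideal of `V₁* = {∂F/∂x_i = 0 (0 ≤ i ≤ r), ∂F/∂y_j = 0 (r+1 ≤ j ≤ m)}`. -/
def idealV1 (F : MvPolynomial (Idx n m r) ℤ) : Ideal (MvPolynomial (Idx n m r) ℂ) :=
  Ideal.span ((Set.range fun i : Fin (r + 1) => pderivC F (Sum.inl i)) ∪
    (Set.range fun j : Fin (m - r) => pderivC F (Sum.inr (Sum.inl j))))

/-- The ideal of `V₂* = {∂F/∂y_j = 0 (r+1 ≤ j ≤ m), ∂F/∂z_k = 0 (m+1 ≤ k ≤ n+1)}`. -/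
def idealV2 (F : MvPolynomial (Idx n m r) ℤ) : Ideal (MvPolynomial (Idx n m r) ℂ) :=
  Ideal.span ((Set.range fun j : Fin (m - r) => pderivC F (Sum.inr (Sum.inl j))) ∪
    (Set.range fun k : Fin (n - m + 1) => pderivC F (Sum.inr (Sum.inr k))))

/-- The dimension of the affine variety `V₁* ⊆ ℂ^{n+2}`. -/
def dimV1 (F : MvPolynomial (Idx n m r) ℤ) : WithBot ℕ∞ :=
  ringKrullDim (MvPolynomial (Idx n m r) ℂ ⧸ idealV1 F)

/-- The dimension of the affine variety `V₂* ⊆ ℂ^{n+2}`. -/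
def dimV2 (F : MvPolynomial (Idx n m r) ℤ) : WithBot ℕ∞ :=
  ringKrullDim (MvPolynomial (Idx n m r) ℂ ⧸ idealV2 F)

/-- The polynomial `F(𝐱, 𝐘, 𝐙)` with complex coefficients obtained from `F` by specializing
the variables `𝐱` to a fixed point of `ℂ^{r+1}`. -/
def subsX (x : Fin (r + 1) → ℂ) (p : MvPolynomial (Idx n m r) ℤ) :
    MvPolynomial (Fin (m - r) ⊕ Fin (n - m + 1)) ℂ :=
  MvPolynomial.aeval (Sum.elim (fun i => MvPolynomial.C (x i))
    (Sum.elim (fun j => MvPolynomial.X (Sum.inl j)) (fun k => MvPolynomial.X (Sum.inr k)))) p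

/-- Specialization of the variables `𝐳` to a fixed point of `ℂ^{n-m+1}`. -/
def subsZ (z : Fin (n - m + 1) → ℂ) (p : MvPolynomial (Idx n m r) ℤ) :
    MvPolynomial (Fin (r + 1) ⊕ Fin (m - r)) ℂ :=
  MvPolynomial.aeval (Sum.elim (fun i => MvPolynomial.X (Sum.inl i))
    (Sum.elim (fun j => MvPolynomial.X (Sum.inr j)) (fun k => MvPolynomial.C (z k)))) p

/-- Dimension of `V₂,𝐱* = {(𝐲,𝐳) : ∂F/∂y_j(𝐱,𝐲,𝐳) = 0, ∂F/∂z_k(𝐱,𝐲,𝐳) = 0}`. -/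
def dimV2x (F : MvPolynomial (Idx n m r) ℤ) (x : Fin (r + 1) → ℂ) : WithBot ℕ∞ :=
  ringKrullDim (MvPolynomial (Fin (m - r) ⊕ Fin (n - m + 1)) ℂ ⧸
    Ideal.span
      ((Set.range fun j : Fin (m - r) => subsX x (MvPolynomial.pderiv (Sum.inr (Sum.inl j)) F)) ∪
       (Set.range fun k : Fin (n - m + 1) => subsX x (MvPolynomial.pderiv (Sum.inr (Sum.inr k)) F))))

/-- Dimension of `V₁,𝐳* = {(𝐱,𝐲) : ∂F/∂x_i(𝐱,𝐲,𝐳) = 0, ∂F/∂y_j(𝐱,𝐲,𝐳) = 0}`. -/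
def dimV1z (F : MvPolynomial (Idx n m r) ℤ) (z : Fin (n - m + 1) → ℂ) : WithBot ℕ∞ :=
  ringKrullDim (MvPolynomial (Fin (r + 1) ⊕ Fin (m - r)) ℂ ⧸
    Ideal.span
      ((Set.range fun i : Fin (r + 1) => subsZ z (MvPolynomial.pderiv (Sum.inl i) F)) ∪
       (Set.range fun j : Fin (m - r) => subsZ z (MvPolynomial.pderiv (Sum.inr (Sum.inl j)) F))))

/-- The set `A₂^λ = {𝐱 ∈ ℂ^{r+1} : dim V₂,𝐱* < dim V₂* − (r+1) + λ}`, where `D₂ = dim V₂*`;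
the inequality is stated equivalently as `dim V₂,𝐱* + (r+1) < D₂ + λ`. -/
def A2set (F : MvPolynomial (Idx n m r) ℤ) (lam D₂ : ℕ) : Set (Fin (r + 1) → ℂ) :=
  {x | dimV2x F x + (((r + 1 : ℕ) : ℕ∞) : WithBot ℕ∞) < (((D₂ + lam : ℕ) : ℕ∞) : WithBot ℕ∞)}

/-- The set `A₁^μ = {𝐳 ∈ ℂ^{n-m+1} : dim V₁,𝐳* < dim V₁* − (n−m+1) + μ}`, where `D₁ = dim V₁*`. -/
def A1set (F : MvPolynomial (Idx n m r) ℤ) (mu D₁ : ℕ) : Set (Fin (n - m + 1) → ℂ) :=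
  {z | dimV1z F z + (((n - m + 1 : ℕ) : ℕ∞) : WithBot ℕ∞) < (((D₁ + mu : ℕ) : ℕ∞) : WithBot ℕ∞)}

/-- The exponential sum `S_d(α)`. -/
def Sd (F : MvPolynomial (Idx n m r) ℤ) (d : ℕ) (P₁ P₂ α : ℝ) : ℂ :=
  ∑' q : (Fin (r + 1) → ℤ) × (Fin (m - r) → ℤ) × (Fin (n - m + 1) → ℤ),
    if ‖q.1‖ ≤ P₁ ∧ ‖q.2.1‖ ≤ d * ‖q.1‖ * P₂ ∧ ‖q.2.2‖ ≤ P₂ then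
      eexp (α * (evalF F (fun i => (d : ℤ) * q.1 i) q.2.1 q.2.2 : ℤ))
    else 0

/-- The complete exponential sum `S_{a,q,d}`. -/
def Saqd (F : MvPolynomial (Idx n m r) ℤ) (d a q : ℕ) : ℂ :=
  ∑' b : (Fin (r + 1) → ZMod q) × (Fin (m - r) → ZMod q) × (Fin (n - m + 1) → ZMod q),
    eexp ((a : ℝ) / (q : ℝ) *
      ((evalF F (fun i => (d : ZMod q) * b.1 i) b.2.1 b.2.2).val : ℝ))

/-- The term `A_d(q) = q^{-(n+2)} ∑_{0 ≤ a < q, (a,q)=1} S_{a,q,d}` of the singular series. -/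
def Aq (F : MvPolynomial (Idx n m r) ℤ) (d q : ℕ) : ℂ :=
  (q : ℂ) ^ (-((n : ℤ) + 2)) *
    ∑ a ∈ (Finset.range q).filter fun a => Nat.gcd a q = 1, Saqd F d a q

/-- The singular series `𝔖_d`. -/
def singSeries (F : MvPolynomial (Idx n m r) ℤ) (d : ℕ) : ℂ := ∑' q : ℕ, Aq F d q

/-- The partial singular series `𝔖_d(Q)`. -/
def singSeriesPartial (F : MvPolynomial (Idx n m r) ℤ) (d Q : ℕ) : ℂ :=
  ∑ q ∈ Finset.Icc 1 Q, Aq F d q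

/-- The integral `I(β)` over the region `|𝐮| ≤ 1`, `|𝐯| ≤ |𝐮|`, `|𝐰| ≤ 1`. -/
def Ibeta (F : MvPolynomial (Idx n m r) ℤ) (β : ℝ) : ℂ :=
  ∫ p : (Fin (r + 1) → ℝ) × (Fin (m - r) → ℝ) × (Fin (n - m + 1) → ℝ),
    if ‖p.1‖ ≤ 1 ∧ ‖p.2.1‖ ≤ ‖p.1‖ ∧ ‖p.2.2‖ ≤ 1 then
      eexp (β * evalF F p.1 p.2.1 p.2.2)
    else 0

/-- The truncated singular integral `J(φ) = ∫_{|β| ≤ φ} I(β) dβ`. -/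
def Jphi (F : MvPolynomial (Idx n m r) ℤ) (φ : ℝ) : ℂ :=
  ∫ β in Set.Icc (-φ) φ, Ibeta F β

/-- The singular integral `J = ∫_ℝ I(β) dβ`. -/
def Jint (F : MvPolynomial (Idx n m r) ℤ) : ℂ := ∫ β : ℝ, Ibeta F β

/-- The constant `σ_d = d^{m-r-d₁} 𝔖_d J`. -/
def sigmaD (F : MvPolynomial (Idx n m r) ℤ) (d₁ d : ℕ) : ℂ :=
  (d : ℂ) ^ ((m : ℤ) - r - d₁) * singSeries F d * Jint F

/-- `S_{a,q,d}(𝐱)`, the complete exponential sum with `𝐱` fixed. -/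
def SaqdX (F : MvPolynomial (Idx n m r) ℤ) (d : ℕ) (x : Fin (r + 1) → ℤ) (a q : ℕ) : ℂ :=
  ∑' b : (Fin (m - r) → ZMod q) × (Fin (n - m + 1) → ZMod q),
    eexp ((a : ℝ) / (q : ℝ) *
      ((evalF F (fun i => ((d * x i : ℤ) : ZMod q)) b.1 b.2).val : ℝ))

/-- The singular series `𝔖_{d,𝐱} = ∑_q q^{-(n-r+1)} ∑_{(a,q)=1} S_{a,q,d}(𝐱)`. -/
def singSeriesX (F : MvPolynomial (Idx n m r) ℤ) (d : ℕ) (x : Fin (r + 1) → ℤ) : ℂ :=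
  ∑' q : ℕ, (q : ℂ) ^ (-((n : ℤ) - r + 1)) *
    ∑ a ∈ (Finset.range q).filter fun a => Nat.gcd a q = 1, SaqdX F d x a q

/-- `I_𝐱(β) = ∫_{[-1,1]^{m-r} × [-1,1]^{n-m+1}} e(β F(𝐱, k𝐯, 𝐰)) d𝐯 d𝐰` with `k = |𝐱|`. -/
def IbetaX (F : MvPolynomial (Idx n m r) ℤ) (x : Fin (r + 1) → ℤ) (β : ℝ) : ℂ :=
  ∫ p : (Fin (m - r) → ℝ) × (Fin (n - m + 1) → ℝ),
    if ‖p.1‖ ≤ 1 ∧ ‖p.2‖ ≤ 1 then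
      eexp (β * evalF F (fun i => (x i : ℝ)) (fun j => ‖x‖ * p.1 j) p.2)
    else 0

/-- `J_{d,𝐱} = ∫_ℝ I_𝐱(d^{d₁} β) dβ`. -/
def JdX (F : MvPolynomial (Idx n m r) ℤ) (d₁ d : ℕ) (x : Fin (r + 1) → ℤ) : ℂ :=
  ∫ β : ℝ, IbetaX F x ((d : ℝ) ^ d₁ * β)

/-- `S_{a,q,d}(𝐳)`, the complete exponential sum with `𝐳` fixed. -/
def SaqdZ (F : MvPolynomial (Idx n m r) ℤ) (d : ℕ) (z : Fin (n - m + 1) → ℤ) (a q : ℕ) : ℂ :=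
  ∑' b : (Fin (r + 1) → ZMod q) × (Fin (m - r) → ZMod q),
    eexp ((a : ℝ) / (q : ℝ) *
      ((evalF F (fun i => (d : ZMod q) * b.1 i) b.2 (fun k => ((z k : ℤ) : ZMod q))).val : ℝ))

/-- The singular series `𝔖_{d,𝐳} = ∑_q q^{-(m+1)} ∑_{(a,q)=1} S_{a,q,d}(𝐳)`. -/
def singSeriesZ (F : MvPolynomial (Idx n m r) ℤ) (d : ℕ) (z : Fin (n - m + 1) → ℤ) : ℂ :=
  ∑' q : ℕ, (q : ℂ) ^ (-((m : ℤ) + 1)) *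
    ∑ a ∈ (Finset.range q).filter fun a => Nat.gcd a q = 1, SaqdZ F d z a q

/-- `I_𝐳(β) = ∫_{(𝐮,𝐯) ∈ [-1,1]^{r+1} × [-1,1]^{m-r}, |𝐯| < |𝐮|} e(β F(𝐮, l𝐯, 𝐳)) d𝐮 d𝐯`
with `l = |𝐳|`. -/
def IbetaZ (F : MvPolynomial (Idx n m r) ℤ) (z : Fin (n - m + 1) → ℤ) (β : ℝ) : ℂ :=
  ∫ p : (Fin (r + 1) → ℝ) × (Fin (m - r) → ℝ),
    if ‖p.1‖ ≤ 1 ∧ ‖p.2‖ ≤ 1 ∧ ‖p.2‖ < ‖p.1‖ then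
      eexp (β * evalF F p.1 (fun j => ‖z‖ * p.2 j) (fun k => (z k : ℝ)))
    else 0

/-- `J_𝐳 = ∫_ℝ I_𝐳(β) dβ`. -/
def JZ (F : MvPolynomial (Idx n m r) ℤ) (z : Fin (n - m + 1) → ℤ) : ℂ :=
  ∫ β : ℝ, IbetaZ F z β

/-- The major arcs `𝔐^{(1)}(θ)` (with `dt = d̃ = d₁ + d₂ - 2`). -/
def majorArc1 (d d₁ dt : ℕ) (P θ : ℝ) : Set ℝ :=
  {α | α ∈ Set.Icc (0 : ℝ) 1 ∧ ∃ q a : ℕ, 0 < q ∧ d ∣ q ∧ a < q ∧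
    (q : ℝ) ≤ d * P ^ (((dt : ℝ) + 1) * θ) ∧
    |α * q - a| ≤ ((d : ℝ) ^ (d₁ - 1))⁻¹ * P ^ (-1 + ((dt : ℝ) + 1) * θ)}

/-- The major arcs `𝔐^{(2)}(θ)`. -/
def majorArc2 (d d₁ dt : ℕ) (P θ : ℝ) : Set ℝ :=
  {α | α ∈ Set.Icc (0 : ℝ) 1 ∧ ∃ q a : ℕ, 0 < q ∧ a < q ∧ Nat.gcd a q = 1 ∧
    (q : ℝ) ≤ P ^ (((dt : ℝ) + 1) * θ) ∧
    |α * q - a| ≤ ((d : ℝ) ^ d₁)⁻¹ * P ^ (-1 + ((dt : ℝ) + 1) * θ)}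

/-- The minor arcs `𝔪(θ) = [0,1) \ (𝔐^{(1)}(θ) ∪ 𝔐^{(2)}(θ))`. -/
def minorArcs (d d₁ dt : ℕ) (P θ : ℝ) : Set ℝ :=
  Set.Ico (0 : ℝ) 1 \ (majorArc1 d d₁ dt P θ ∪ majorArc2 d d₁ dt P θ)

/-! ### Krull dimension of integral extensions -/

theorem exists_ltSeries_over {R S : Type*} [CommRing R] [CommRing S] [Algebra R S]
    [Algebra.IsIntegral R S] [FaithfulSMul R S] (k : ℕ) :
    ∀ p : LTSeries (PrimeSpectrum R), p.length = k →
      ∃ q : LTSeries (PrimeSpectrum S), q.length = k ∧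
        q.last.asIdeal.comap (algebraMap R S) = p.last.asIdeal := by
  induction k with
  | zero =>
    intro p hp
    have hinj : Function.Injective (algebraMap R S) := FaithfulSMul.algebraMap_injective R S
    obtain ⟨Q, -, hQ, hQ'⟩ := Ideal.exists_ideal_over_prime_of_isIntegral (S := S)
      p.last.asIdeal ⊥ (by
        rw [← RingHom.ker_eq_comap_bot, (RingHom.injective_iff_ker_eq_bot _).1 hinj]
        exact bot_le)
    exact ⟨RelSeries.singleton _ ⟨Q, hQ⟩, rfl, by simpa using hQ'⟩
  | succ k ih =>
    intro p hp
    obtain ⟨q, hq, hq'⟩ := ih p.eraseLast (by simp [hp])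
    have hlt : p.eraseLast.last < p.last := p.eraseLast_last_rel_last (by omega)
    obtain ⟨Q, hle, hQ, hQ'⟩ := Ideal.exists_ideal_over_prime_of_isIntegral (S := S)
      p.last.asIdeal q.last.asIdeal (by rw [hq']; exact le_of_lt hlt)
    have hlt' : q.last < (⟨Q, hQ⟩ : PrimeSpectrum S) := by
      refine lt_of_le_of_ne hle fun h => ?_
      rw [h] at hq'
      have : p.eraseLast.last.asIdeal = p.last.asIdeal := by
        rw [← hq', ← hQ']
      exact hlt.ne (PrimeSpectrum.ext this)
    exact ⟨q.snoc ⟨Q, hQ⟩ hlt', by simp [hq], by simpa using hQ'⟩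

theorem ringKrullDim_le_of_isIntegral (R S : Type*) [CommRing R] [CommRing S] [Algebra R S]
    [Algebra.IsIntegral R S] [FaithfulSMul R S] : ringKrullDim R ≤ ringKrullDim S := by
  unfold ringKrullDim Order.krullDim
  refine iSup_le fun p => ?_
  obtain ⟨q, hq, -⟩ := exists_ltSeries_over (S := S) p.length p rfl
  rw [← hq]
  exact le_iSup (fun q : LTSeries (PrimeSpectrum S) => ((q.length : ℕ) : WithBot ℕ∞)) q

theorem exists_finite_mvPolynomial {A : Type*} [CommRing A] [Algebra ℂ A]
    [Algebra.FiniteType ℂ A] (D : ℕ) (hD : ringKrullDim A = ((D : ℕ∞) : WithBot ℕ∞)) :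
    ∃ s ≤ D, ∃ g : MvPolynomial (Fin s) ℂ →ₐ[ℂ] A, g.Finite := by
  have hnt : Nontrivial A := by
    by_contra h
    rw [not_nontrivial_iff_subsingleton] at h
    rw [ringKrullDim_eq_bot_of_subsingleton] at hD
    exact absurd hD (by exact WithBot.bot_ne_coe)
  obtain ⟨s, g, hg, hfin⟩ := exists_finite_inj_algHom_of_fg ℂ A
  refine ⟨s, ?_, g, hfin⟩
  let _ := g.toRingHom.toAlgebra
  have hf : Module.Finite (MvPolynomial (Fin s) ℂ) A := hfin
  have : FaithfulSMul (MvPolynomial (Fin s) ℂ) A :=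
    (faithfulSMul_iff_algebraMap_injective _ _).2 hg
  have := ringKrullDim_le_of_isIntegral (MvPolynomial (Fin s) ℂ) A
  rw [MvPolynomial.ringKrullDim_of_isNoetherianRing, hD, ringKrullDim_eq_zero_of_field] at this
  simp only [Nat.card_eq_fintype_card, Fintype.card_fin, zero_add] at this
  exact_mod_cast this

/-! ### Hilbert functions of algebras that are finite over a polynomial ring -/

theorem finrank_map_restrictTotalDegree_le {ι κ B : Type*} [Fintype ι] [Fintype κ] [CommRing B]
    [Algebra ℂ B] (φ : MvPolynomial ι ℂ →ₐ[ℂ] B) (ψ : MvPolynomial κ ℂ →ₐ[ℂ] B)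
    (hψ : ψ.Finite) :
    ∃ C : ℕ, ∀ t : ℕ, Module.Finite ℂ ((restrictTotalDegree ι ℂ t).map φ.toLinearMap) ∧
      Module.finrank ℂ ((restrictTotalDegree ι ℂ t).map φ.toLinearMap) ≤
      C * (t + 1) ^ Fintype.card κ := by
  let _ := ψ.toRingHom.toAlgebra
  have hf : Module.Finite (MvPolynomial κ ℂ) B := hψ
  obtain ⟨q, w, hw⟩ := Module.Finite.exists_fin (R := MvPolynomial κ ℂ) (M := B)
  have hexp : ∀ b : B, ∃ u : Fin q → MvPolynomial κ ℂ, b = ∑ k, ψ (u k) * w k := by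
    intro b
    have hb : b ∈ Submodule.span (MvPolynomial κ ℂ) (Set.range w) := by rw [hw]; trivial
    obtain ⟨u, hu⟩ := (Submodule.mem_span_range_iff_exists_fun _).1 hb
    exact ⟨u, by rw [← hu]; rfl⟩
  choose u hu using hexp
  set e : ℕ := ∑ k, (u 1 k).totalDegree + ∑ i, ∑ j, ∑ k, (u (φ (X i) * w j) k).totalDegree with he
  have he1 : ∀ k, (u 1 k).totalDegree ≤ e := fun k =>
    (Finset.single_le_sum (f := fun k => (u 1 k).totalDegree) (fun _ _ => Nat.zero_le _)
      (Finset.mem_univ k)).trans (Nat.le_add_right _ _)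
  have he2 : ∀ i j k, (u (φ (X i) * w j) k).totalDegree ≤ e := by
    intro i j k
    calc _ ≤ ∑ k, (u (φ (X i) * w j) k).totalDegree :=
          Finset.single_le_sum (f := fun k => (u (φ (X i) * w j) k).totalDegree)
            (fun _ _ => Nat.zero_le _) (Finset.mem_univ k)
      _ ≤ ∑ j, ∑ k, (u (φ (X i) * w j) k).totalDegree :=
          Finset.single_le_sum (f := fun j => ∑ k, (u (φ (X i) * w j) k).totalDegree)
            (fun _ _ => Nat.zero_le _) (Finset.mem_univ j)
      _ ≤ ∑ i, ∑ j, ∑ k, (u (φ (X i) * w j) k).totalDegree :=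
          Finset.single_le_sum (f := fun i => ∑ j, ∑ k, (u (φ (X i) * w j) k).totalDegree)
            (fun _ _ => Nat.zero_le _) (Finset.mem_univ i)
      _ ≤ e := Nat.le_add_left _ _
  let gen : (t : ℕ) → ((κ → Fin (e * (t + 1) + 1)) × Fin q) → B := fun t a =>
    ψ (monomial (Finsupp.equivFunOnFinite.symm fun i => ((a.1 i : Fin _) : ℕ)) 1) * w a.2
  let W : ℕ → Submodule ℂ B := fun t => Submodule.span ℂ (Set.range (gen t))
  have hW : ∀ t (p : MvPolynomial κ ℂ) (k : Fin q), p.totalDegree ≤ e * (t + 1) →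
      ψ p * w k ∈ W t := by
    intro t p k hp
    rw [p.as_sum, map_sum, Finset.sum_mul]
    refine Submodule.sum_mem _ fun s hs => ?_
    have hsd : ∀ i, s i < e * (t + 1) + 1 := by
      intro i
      have h1 := le_totalDegree hs
      have h2 : s i ≤ s.sum fun _ e => e := by
        have := Finsupp.le_degree i s
        rwa [Finsupp.degree_apply] at this
      omega
    have : ψ (monomial s (coeff s p)) * w k =
        coeff s p • gen t (fun i => ⟨s i, hsd i⟩, k) := by
      simp only [gen]
      rw [← smul_mul_assoc, ← map_smul, smul_monomial, smul_eq_mul, mul_one,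
        show (Finsupp.equivFunOnFinite.symm fun i => s i) = s from Finsupp.ext fun _ => rfl]
    rw [this]
    exact Submodule.smul_mem _ _ (Submodule.subset_span ⟨_, rfl⟩)
  have hM : ∀ t (s : ι →₀ ℕ), s.degree ≤ t → ∃ v : Fin q → MvPolynomial κ ℂ,
      (∀ k, (v k).totalDegree ≤ e * (t + 1)) ∧ φ (monomial s 1) = ∑ k, ψ (v k) * w k := by
    intro t
    induction t with
    | zero =>
      intro s hs
      have : s = 0 := (Finsupp.degree_eq_zero_iff s).1 (by simpa using hs)
      subst this
      refine ⟨u 1, fun k => by simpa using he1 k, ?_⟩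
      rw [← hu]; simp
    | succ t ih =>
      intro s hs
      by_cases h0 : s = 0
      · subst h0
        refine ⟨u 1, fun k => (he1 k).trans (by nlinarith), ?_⟩
        rw [← hu]; simp
      · obtain ⟨i, hi⟩ := Finsupp.ne_iff.1 h0
        have hi' : Finsupp.single i 1 ≤ s := by
          rw [Finsupp.single_le_iff]; exact Nat.one_le_iff_ne_zero.2 hi
        have hadd : s = Finsupp.single i 1 + (s - Finsupp.single i 1) :=
          (add_tsub_cancel_of_le hi').symm
        have hdeg : (s - Finsupp.single i 1).degree ≤ t := by
          rw [hadd, map_add] at hs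
          simp only [Finsupp.degree_single] at hs
          omega
        obtain ⟨v, hv, hv'⟩ := ih _ hdeg
        refine ⟨fun l => ∑ k, v k * u (φ (X i) * w k) l, fun l => ?_, ?_⟩
        · refine (totalDegree_finsetSum_le fun k _ => ?_)
          refine (totalDegree_mul _ _).trans ?_
          have := hv k
          have := he2 i k l
          nlinarith
        · have hmon : monomial s (1 : ℂ) = X i * monomial (s - Finsupp.single i 1) 1 := by
            conv_lhs => rw [hadd]
            rw [X, monomial_mul, mul_one]
          rw [hmon, map_mul, hv', Finset.mul_sum]
          have : ∀ k, φ (X i) * (ψ (v k) * w k) =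
              ∑ l, ψ (v k) * (ψ (u (φ (X i) * w k) l) * w l) := by
            intro k
            rw [← Finset.mul_sum, ← hu]; ring
          simp_rw [this]
          rw [Finset.sum_comm]
          refine Finset.sum_congr rfl fun l _ => ?_
          rw [map_sum, Finset.sum_mul]
          refine Finset.sum_congr rfl fun k _ => ?_
          rw [map_mul]; ring
  have hle : ∀ t, (restrictTotalDegree ι ℂ t).map φ.toLinearMap ≤ W t := by
    intro t
    rintro _ ⟨p, hp, rfl⟩
    have hp : p ∈ restrictTotalDegree ι ℂ t := hp
    rw [mem_restrictTotalDegree] at hp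
    change φ p ∈ _
    rw [p.as_sum, map_sum]
    refine Submodule.sum_mem _ fun s hs => ?_
    have hsd : s.degree ≤ t := by
      have h1 := le_totalDegree hs
      have : s.degree = s.sum fun _ e => e := Finsupp.degree_apply s
      omega
    obtain ⟨v, hv, hv'⟩ := hM t s hsd
    have : monomial s (coeff s p) = coeff s p • monomial s (1 : ℂ) := by simp [smul_monomial]
    rw [this, map_smul, hv']
    exact Submodule.smul_mem _ _ (Submodule.sum_mem _ fun k _ => hW t _ k (hv k))
  refine ⟨q * (e + 1) ^ Fintype.card κ, fun t => ?_⟩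
  have hfin : Module.Finite ℂ (W t) := Module.Finite.span_of_finite ℂ (Set.finite_range _)
  refine ⟨Submodule.finiteDimensional_of_le (hle t), (Submodule.finrank_mono (hle t)).trans ?_⟩
  refine (finrank_range_le_card (R := ℂ) (gen t)).trans ?_
  rw [Fintype.card_prod, Fintype.card_fun, Fintype.card_fin, Fintype.card_fin, mul_comm,
    mul_assoc, ← mul_pow]
  gcongr
  nlinarith

/-- Polynomials of total degree less than `t`. -/
def lowDeg (ι R : Type*) [CommSemiring R] (t : ℕ) : Submodule R (MvPolynomial ι R) :=
  restrictSupport R {s | s.degree < t}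

theorem mem_lowDeg {ι R : Type*} [CommSemiring R] {t : ℕ} {p : MvPolynomial ι R} :
    p ∈ lowDeg ι R t ↔ ∀ s ∈ p.support, s.degree < t := by
  rw [lowDeg, mem_restrictSupport_iff]; rfl

theorem lowDeg_mono {ι R : Type*} [CommSemiring R] {a b : ℕ} (h : a ≤ b) :
    lowDeg ι R a ≤ lowDeg ι R b :=
  restrictSupport_mono _ fun _ hs => lt_of_lt_of_le hs h

theorem mul_mem_lowDeg {ι R : Type*} [CommSemiring R] {a b : ℕ} {p q : MvPolynomial ι R}
    (hp : p ∈ lowDeg ι R a) (hq : q ∈ lowDeg ι R (b + 1)) : p * q ∈ lowDeg ι R (a + b) := by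
  rw [mem_lowDeg] at *
  intro s hs
  obtain ⟨u, hu, v, hv, rfl⟩ := Finset.mem_add.1 (support_mul p q hs)
  rw [map_add]
  have := hp u hu
  have := hq v hv
  omega

theorem _root_.MvPolynomial.IsHomogeneous.mem_lowDeg {ι R : Type*} [CommSemiring R] {a : ℕ}
    {p : MvPolynomial ι R} (hp : p.IsHomogeneous a) : p ∈ lowDeg ι R (a + 1) := by
  rw [PaperTM.mem_lowDeg]
  intro s hs
  have h := hp (mem_support_iff.1 hs)
  rw [Finsupp.degree_eq_weight_one]
  exact Nat.lt_succ_of_le (le_of_eq h)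

theorem lowDeg_succ_le {ι R : Type*} [CommSemiring R] (t : ℕ) :
    lowDeg ι R (t + 1) ≤ lowDeg ι R t ⊔ homogeneousSubmodule ι R t := by
  intro p hp
  rw [mem_lowDeg] at hp
  rw [p.as_sum]
  refine Submodule.sum_mem _ fun s hs => ?_
  rcases (Nat.lt_succ_iff.1 (hp s hs)).lt_or_eq with h | h
  · refine Submodule.mem_sup_left (mem_lowDeg.2 fun u hu => ?_)
    have := support_monomial_subset hu
    rw [Finset.mem_singleton] at this
    rwa [this]
  · exact Submodule.mem_sup_right (isHomogeneous_monomial _ h)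

theorem lowDeg_succ_eq_restrictTotalDegree {ι R : Type*} [CommSemiring R] (t : ℕ) :
    lowDeg ι R (t + 1) = restrictTotalDegree ι R t := by
  ext p
  rw [mem_lowDeg, mem_restrictTotalDegree, totalDegree, Finset.sup_le_iff]
  simp only [Nat.lt_succ_iff]
  rfl

theorem homogeneousComponent_mul_of_isHomogeneous {ι R : Type*} [CommRing R] {a t : ℕ}
    (q : MvPolynomial ι R) {f : MvPolynomial ι R} (hf : f.IsHomogeneous a) :
    homogeneousComponent t (q * f) = if a ≤ t then homogeneousComponent (t - a) q * f else 0 := by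
  let _ : GradedAlgebra (homogeneousSubmodule ι R) := gradedAlgebra
  have := DirectSum.coe_decompose_mul_of_right_mem (homogeneousSubmodule ι R) (a := q) t
    ((mem_homogeneousSubmodule a f).2 hf)
  rw [← decomposition.decompose'_apply, ← decomposition.decompose'_apply]
  exact this

theorem map_mem_lowDeg_of_mem_span {ι κ E : Type*} [Fintype κ] [CommRing E] [Algebra ℂ E]
    (ε : MvPolynomial ι ℂ →ₐ[ℂ] E) {f g : κ → MvPolynomial ι ℂ} {d : κ → ℕ} {c : κ → ℂ}
    (hf : ∀ j, (f j).IsHomogeneous (d j)) (hc : ∀ j, c j ≠ 0)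
    (hg : ∀ j, g j - c j • f j ∈ lowDeg ι ℂ (d j)) (hε : ∀ j, ε (g j) = 0)
    {t : ℕ} {p : MvPolynomial ι ℂ} (hp : p.IsHomogeneous t) (hpI : p ∈ Ideal.span (Set.range f)) :
    ε p ∈ (lowDeg ι ℂ t).map ε.toLinearMap := by
  obtain ⟨q, rfl⟩ := (Ideal.mem_span_range_iff_exists_fun).1 hpI
  rw [← homogeneousComponent_eq_self hp, map_sum, map_sum]
  refine Submodule.sum_mem _ fun j _ => ?_
  rw [homogeneousComponent_mul_of_isHomogeneous _ (hf j)]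
  split_ifs with h
  · set r := homogeneousComponent (t - d j) (q j)
    have hr : r.IsHomogeneous (t - d j) := homogeneousComponent_isHomogeneous _ _
    refine ⟨-(c j)⁻¹ • (r * (g j - c j • f j)), ?_, ?_⟩
    · refine Submodule.smul_mem _ _ ?_
      have := mul_mem_lowDeg (hg j) hr.mem_lowDeg
      rw [mul_comm]
      rwa [show d j + (t - d j) = t by omega] at this
    · change ε _ = _
      rw [map_smul, map_mul, map_sub, hε, map_smul, zero_sub, map_mul, mul_neg, neg_smul, smul_neg,
        neg_neg, mul_smul_comm, smul_smul, inv_mul_cancel₀ (hc j), one_smul]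
  · simp

theorem finrank_map_lowDeg_le {ι κ E B : Type*} [Finite ι] [Fintype κ] [CommRing E] [Algebra ℂ E]
    [CommRing B] [Algebra ℂ B]
    (ε : MvPolynomial ι ℂ →ₐ[ℂ] E) (φ : MvPolynomial ι ℂ →ₐ[ℂ] B)
    {f g : κ → MvPolynomial ι ℂ} {d : κ → ℕ} {c : κ → ℂ}
    (hf : ∀ j, (f j).IsHomogeneous (d j)) (hc : ∀ j, c j ≠ 0)
    (hg : ∀ j, g j - c j • f j ∈ lowDeg ι ℂ (d j)) (hε : ∀ j, ε (g j) = 0)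
    (hφ : ∀ p, φ p = 0 ↔ p ∈ Ideal.span (Set.range f)) (t : ℕ) :
    Module.Finite ℂ ((lowDeg ι ℂ t).map ε.toLinearMap) ∧
    Module.Finite ℂ ((lowDeg ι ℂ t).map φ.toLinearMap) ∧
    Module.finrank ℂ ((lowDeg ι ℂ t).map ε.toLinearMap) ≤
      Module.finrank ℂ ((lowDeg ι ℂ t).map φ.toLinearMap) := by
  induction t with
  | zero =>
    have : lowDeg ι ℂ 0 = ⊥ := by
      rw [eq_bot_iff]
      intro p hp
      rw [mem_lowDeg] at hp
      by_contra h
      obtain ⟨s, hs⟩ := support_nonempty.2 h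
      exact absurd (hp s hs) (by simp)
    rw [this, Submodule.map_bot, Submodule.map_bot]
    exact ⟨inferInstance, inferInstance, by simp⟩
  | succ t ih =>
    obtain ⟨ih1, ih2, ih3⟩ := ih
    have heq : lowDeg ι ℂ (t + 1) = lowDeg ι ℂ t ⊔ homogeneousSubmodule ι ℂ t := by
      refine le_antisymm (lowDeg_succ_le t) (sup_le (lowDeg_mono (by omega)) fun p hp => ?_)
      exact IsHomogeneous.mem_lowDeg hp
    set H := homogeneousSubmodule ι ℂ t with hH
    have hHf : Module.Finite ℂ H := Module.Finite.iff_fg.2 (homogeneousSubmodule_fg ι ℂ t)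
    have hφH : Module.Finite ℂ (H.map φ.toLinearMap) := inferInstance
    have hεH : Module.Finite ℂ (H.map ε.toLinearMap) := inferInstance
    rw [heq, Submodule.map_sup, Submodule.map_sup]
    refine ⟨inferInstance, inferInstance, ?_⟩
    have hdisj : Disjoint ((lowDeg ι ℂ t).map φ.toLinearMap) (H.map φ.toLinearMap) := by
      rw [Submodule.disjoint_def]
      rintro _ ⟨p, hp, rfl⟩ ⟨q, hq, hpq⟩
      have hp : p ∈ lowDeg ι ℂ t := hp
      have hq : q.IsHomogeneous t := hq
      change φ q = φ p at hpq
      change φ p = 0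
      rw [← hpq, hφ]
      have h1 : q - p ∈ Ideal.span (Set.range f) := by rw [← hφ, map_sub, hpq, sub_self]
      let _ : GradedAlgebra (homogeneousSubmodule ι ℂ) := gradedAlgebra
      have h2 := homogeneousComponent_mem_of_mem (Ideal.homogeneous_span
        (homogeneousSubmodule ι ℂ) (Set.range f) (by
          rintro _ ⟨j, rfl⟩; exact ⟨d j, hf j⟩)) h1 (n := t)
      rw [map_sub, homogeneousComponent_eq_self hq, homogeneousComponent_eq_zero' t p, sub_zero]
        at h2
      · exact h2
      · intro s hs
        exact (mem_lowDeg.1 hp s hs).ne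
    have hdim := Submodule.finrank_sup_add_finrank_inf_eq
      ((lowDeg ι ℂ t).map φ.toLinearMap) (H.map φ.toLinearMap)
    rw [hdisj.eq_bot, finrank_bot, add_zero] at hdim
    rw [hdim]
    set n := Module.finrank ℂ (H.map φ.toLinearMap)
    let b := Module.finBasis ℂ (H.map φ.toLinearMap)
    have hb : ∀ i, ∃ p ∈ H, φ p = b i := fun i => (b i).2
    choose p hpH hpb using hb
    have hsub : (lowDeg ι ℂ t).map ε.toLinearMap ⊔ H.map ε.toLinearMap ≤
        (lowDeg ι ℂ t).map ε.toLinearMap ⊔ Submodule.span ℂ (Set.range fun i => ε (p i)) := by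
      refine sup_le le_sup_left ?_
      rintro _ ⟨q, hq, rfl⟩
      have hq : q ∈ H := hq
      have hmem : φ q ∈ H.map φ.toLinearMap := ⟨q, hq, rfl⟩
      have hrep := b.sum_repr ⟨φ q, hmem⟩
      set a := fun i => b.repr ⟨φ q, hmem⟩ i
      have hrep' : ∑ i, a i • φ (p i) = φ q := by
        have := congrArg Subtype.val hrep
        simp only [Submodule.coe_sum, Submodule.coe_smul] at this
        rw [← this]
        exact Finset.sum_congr rfl fun i _ => by rw [hpb]
      have hr : q - ∑ i, a i • p i ∈ H :=
        H.sub_mem hq (H.sum_mem fun i _ => H.smul_mem _ (hpH i))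
      have hrI : q - ∑ i, a i • p i ∈ Ideal.span (Set.range f) := by
        rw [← hφ, map_sub, map_sum, ← hrep', sub_eq_zero]
        simp [map_smul]
      have := map_mem_lowDeg_of_mem_span ε hf hc hg hε hr hrI
      change ε q ∈ _
      rw [← sub_add_cancel q (∑ i, a i • p i), map_add]
      refine Submodule.add_mem _ (Submodule.mem_sup_left this) (Submodule.mem_sup_right ?_)
      rw [map_sum]
      refine Submodule.sum_mem _ fun i _ => ?_
      rw [map_smul]
      exact Submodule.smul_mem _ _ (Submodule.subset_span ⟨i, rfl⟩)
    have hsf : Module.Finite ℂ (Submodule.span ℂ (Set.range fun i => ε (p i))) :=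
      Module.Finite.span_of_finite ℂ (Set.finite_range _)
    calc _ ≤ _ := Submodule.finrank_mono hsub
      _ ≤ _ := Submodule.finrank_add_le_finrank_add_finrank _ _
      _ ≤ _ := add_le_add ih3 ((finrank_range_le_card (R := ℂ) fun i => ε (p i)).trans
        (by simp [n]))

theorem card_zeros_le {ι κ B : Type*} [Fintype ι] [Fintype κ] 
    [CommRing B] [Algebra ℂ B] (φ : MvPolynomial ι ℂ →ₐ[ℂ] B)
    {f g : κ → MvPolynomial ι ℂ} {d : κ → ℕ} {c : κ → ℂ}
    (hf : ∀ j, (f j).IsHomogeneous (d j)) (hc : ∀ j, c j ≠ 0)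
    (hg : ∀ j, g j - c j • f j ∈ lowDeg ι ℂ (d j))
    (hφ : ∀ p, φ p = 0 ↔ p ∈ Ideal.span (Set.range f)) (M : ℕ)
    (Z : Finset (ι → ℤ)) (hM : ∀ z ∈ Z, ∀ i, |z i| ≤ M)
    (hZ : ∀ z ∈ Z, ∀ j, aeval (fun i => (z i : ℂ)) (g j) = 0) :
    Z.card ≤ Module.finrank ℂ
      ((restrictTotalDegree ι ℂ (2 * M * Fintype.card ι)).map φ.toLinearMap) := by
  let ε : MvPolynomial ι ℂ →ₐ[ℂ] (Z → ℂ) := AlgHom.pi fun z => aeval fun i => ((z.1 i : ℤ) : ℂ)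
  have hε : ∀ j, ε (g j) = 0 := fun j => funext fun z => hZ z.1 z.2 j
  obtain ⟨-, -, h3⟩ := finrank_map_lowDeg_le ε φ hf hc hg hε hφ (2 * M * Fintype.card ι + 1)
  rw [lowDeg_succ_eq_restrictTotalDegree] at h3
  refine le_trans (le_of_eq ?_) h3
  have htop : (restrictTotalDegree ι ℂ (2 * M * Fintype.card ι)).map ε.toLinearMap = ⊤ := by
    rw [eq_top_iff]
    let P : Z → MvPolynomial ι ℂ := fun w => ∏ i, ∏ k ∈ (Finset.Icc (-(M : ℤ)) M).erase (w.1 i),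
      (X i - C (k : ℂ))
    have hPdeg : ∀ w, P w ∈ restrictTotalDegree ι ℂ (2 * M * Fintype.card ι) := by
      intro w
      rw [mem_restrictTotalDegree]
      refine (totalDegree_finsetProd _ _).trans ?_
      rw [mul_comm, ← smul_eq_mul, ← Finset.card_univ]
      refine Finset.sum_le_card_nsmul _ _ _ fun i _ => ?_
      refine (totalDegree_finsetProd _ _).trans ?_
      have hcard : ((Finset.Icc (-(M : ℤ)) M).erase (w.1 i)).card = 2 * M := by
        rw [Finset.card_erase_of_mem (Finset.mem_Icc.2 (abs_le.1 (hM _ w.2 i))), Int.card_Icc]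
        omega
      refine (Finset.sum_le_card_nsmul _ _ 1 fun k _ => ?_).trans (by rw [hcard]; simp)
      refine (totalDegree_sub _ _).trans ?_
      rw [totalDegree_X, totalDegree_C]; rfl
    have hPval : ∀ w z, ε (P w) z ≠ 0 ↔ z = w := by
      intro w z
      have : ε (P w) z = ∏ i, ∏ k ∈ (Finset.Icc (-(M : ℤ)) M).erase (w.1 i),
          (((z.1 i : ℤ) : ℂ) - (k : ℂ)) := by
        simp [ε, P, AlgHom.pi, map_prod]
      rw [this, Finset.prod_ne_zero_iff]
      constructor
      · intro h
        ext i
        by_contra hne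
        have := h i (Finset.mem_univ i)
        rw [Finset.prod_ne_zero_iff] at this
        refine this (z.1 i) (Finset.mem_erase.2 ⟨hne, ?_⟩) (sub_self _)
        exact Finset.mem_Icc.2 (abs_le.1 (hM _ z.2 i))
      · rintro rfl i -
        rw [Finset.prod_ne_zero_iff]
        intro k hk h
        rw [sub_eq_zero] at h
        exact (Finset.mem_erase.1 hk).1 (by exact_mod_cast h.symm)
    intro v _
    have : v = ∑ w, (v w / ε (P w) w) • ε (P w) := by
      ext z
      rw [Finset.sum_apply, Finset.sum_eq_single z]
      · simp [div_mul_cancel₀ _ ((hPval z z).2 rfl)]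
      · intro w _ hne
        have : ε (P w) z = 0 := by
          by_contra h
          exact hne ((hPval w z).1 h).symm
        simp [this]
      · simp
    rw [this]
    exact Submodule.sum_mem _ fun w _ => Submodule.smul_mem _ _ ⟨P w, hPdeg w, rfl⟩
  rw [htop, finrank_top, Module.finrank_fintype_fun_eq_card]
  simp

/-- The variables `(x, a)` of the first block, where `y = a b`. -/
abbrev IdxX (m r : ℕ) := Fin (r + 1) ⊕ Fin (m - r)

/-- The variables `(b, z)` of the second block, where `y = a b`. -/
abbrev IdxT (n m r : ℕ) := Fin (m - r) ⊕ Fin (n - m + 1)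

/-- The variables `(x, a, b, z)`. -/
abbrev IdxL (n m r : ℕ) := IdxX m r ⊕ IdxT n m r

/-- The point `(x, y, z)` with `y = a b`. -/
def liftPt {R : Type*} [CommRing R] (v : IdxL n m r → R) : Idx n m r → R :=
  Sum.elim (fun i => v (.inl (.inl i)))
    (Sum.elim (fun l => v (.inl (.inr l)) * v (.inr (.inl l))) fun k => v (.inr (.inr k)))

theorem idealV2_eq (F : MvPolynomial (Idx n m r) ℤ) :
    idealV2 F = Ideal.span (Set.range fun j : IdxT n m r => pderivC F (.inr j)) := by
  rw [idealV2]
  congr 1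
  rw [← Set.Sum.elim_range]
  congr 1
  ext j
  rcases j with j | j <;> rfl

theorem isIntegralElem_left_of_add_of_mul {R B : Type*} [CommRing R] [CommRing B] [Algebra ℂ B]
    [Algebra R B] {a b : B} (hC : ∀ c : ℂ, IsIntegral R (algebraMap ℂ B c))
    (h1 : IsIntegral R (a + b)) (h2 : IsIntegral R (a * b)) : IsIntegral R a := by
  have h3 : IsIntegral R ((a - b) ^ 2) := by
    rw [show (a - b) ^ 2 = (a + b) ^ 2 - algebraMap ℂ B 4 * (a * b) by
      rw [map_ofNat]; ring]
    exact (h1.pow 2).sub ((hC 4).mul h2)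
  have h4 := IsIntegral.of_pow two_pos h3
  have h5 : a = algebraMap ℂ B (1 / 2) * ((a + b) + (a - b)) := by
    have : algebraMap ℂ B (1 / 2) * 2 = 1 := by
      rw [← map_ofNat (algebraMap ℂ B) 2, ← map_mul]; norm_num
    linear_combination (-a) * this
  rw [h5]
  exact (hC _).mul (h1.add h4)

/-- The lift of an ideal of polynomials in `(x, y, z)` to the variables `(x, a, b, z)`. -/
theorem finrank_map_lift_le {κ : Type*} (f : κ → MvPolynomial (Idx n m r) ℂ) (D : ℕ)
    (hD : ringKrullDim (MvPolynomial (Idx n m r) ℂ ⧸ Ideal.span (Set.range f)) =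
      ((D : ℕ∞) : WithBot ℕ∞)) :
    ∃ C : ℕ, ∀ t, Module.finrank ℂ ((restrictTotalDegree (IdxL n m r) ℂ t).map
      (Ideal.Quotient.mkₐ ℂ (Ideal.span (Set.range fun j =>
        aeval (R := ℂ) (liftPt (X : IdxL n m r → MvPolynomial (IdxL n m r) ℂ)) (f j)))).toLinearMap)
      ≤ C * (t + 1) ^ (D + (m - r)) := by
  set Λ : MvPolynomial (Idx n m r) ℂ →ₐ[ℂ] MvPolynomial (IdxL n m r) ℂ := aeval (liftPt X) with hΛ
  set I := Ideal.span (Set.range fun j => Λ (f j)) with hI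
  set mk := Ideal.Quotient.mkₐ ℂ I with hmk
  obtain ⟨s, hs, g, hg⟩ := exists_finite_mvPolynomial D hD
  let L : (MvPolynomial (Idx n m r) ℂ ⧸ Ideal.span (Set.range f)) →ₐ[ℂ] _ :=
    Ideal.Quotient.liftₐ (Ideal.span (Set.range f)) (mk.comp Λ) (by
      intro p hp
      have : Ideal.span (Set.range f) ≤ RingHom.ker (mk.comp Λ) := by
        rw [Ideal.span_le]
        rintro _ ⟨j, rfl⟩
        refine Ideal.Quotient.eq_zero_iff_mem.2 (Ideal.subset_span ⟨j, rfl⟩)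
      exact this hp)
  have hL : ∀ p, L (Ideal.Quotient.mk _ p) = mk (Λ p) := fun p => rfl
  let ψ : MvPolynomial (Fin s ⊕ Fin (m - r)) ℂ →ₐ[ℂ] (MvPolynomial (IdxL n m r) ℂ ⧸ I) :=
    aeval (Sum.elim (fun i => L (g (X i)))
      fun l => mk (X (.inl (.inr l))) + mk (X (.inr (.inl l))))
  have hψ : ψ.Finite := by
    have hint : ψ.toRingHom.IsIntegral := by
      let _ : Algebra (MvPolynomial (Fin s ⊕ Fin (m - r)) ℂ) (MvPolynomial (IdxL n m r) ℂ ⧸ I) :=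
        ψ.toRingHom.toAlgebra
      have halg : ∀ p, algebraMap (MvPolynomial (Fin s ⊕ Fin (m - r)) ℂ)
        (MvPolynomial (IdxL n m r) ℂ ⧸ I) p = ψ p := fun _ => rfl
      have hC : ∀ c : ℂ, IsIntegral (MvPolynomial (Fin s ⊕ Fin (m - r)) ℂ)
          (algebraMap ℂ (MvPolynomial (IdxL n m r) ℂ ⧸ I) c) := by
        intro c
        have : algebraMap ℂ (MvPolynomial (IdxL n m r) ℂ ⧸ I) c =
          algebraMap (MvPolynomial (Fin s ⊕ Fin (m - r)) ℂ) _ (C c) := by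
          rw [halg]; exact (ψ.commutes c).symm
        rw [this]
        exact isIntegral_algebraMap
      have hLint : ∀ p, IsIntegral (MvPolynomial (Fin s ⊕ Fin (m - r)) ℂ) (L p) := by
        intro p
        obtain ⟨q, hq, hqp⟩ := hg.to_isIntegral p
        refine ⟨q.map (rename Sum.inl).toRingHom, hq.map _, ?_⟩
        have hcomp : (algebraMap (MvPolynomial (Fin s ⊕ Fin (m - r)) ℂ)
            (MvPolynomial (IdxL n m r) ℂ ⧸ I)).comp
            (rename (R := ℂ) (Sum.inl : Fin s → Fin s ⊕ Fin (m - r))).toRingHom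
            = L.toRingHom.comp g.toRingHom := by
          have : ψ.comp (rename (R := ℂ) (Sum.inl : Fin s → Fin s ⊕ Fin (m - r))) = L.comp g := by
            ext i
            simp [ψ]
          exact congrArg AlgHom.toRingHom this
        rw [Polynomial.eval₂_map, hcomp]
        have := Polynomial.hom_eval₂ q g.toRingHom L.toRingHom p
        rw [hqp, map_zero] at this
        exact this.symm
      have hab : ∀ l, IsIntegral (MvPolynomial (Fin s ⊕ Fin (m - r)) ℂ)
          (mk (X (.inl (.inr l))) + mk (X (.inr (.inl l)))) := by
        intro l
        have : mk (X (.inl (.inr l))) + mk (X (.inr (.inl l))) =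
          algebraMap (MvPolynomial (Fin s ⊕ Fin (m - r)) ℂ) _ (X (.inr l)) := by
          rw [halg]; simp [ψ]
        rw [this]
        exact isIntegral_algebraMap
      have hmul : ∀ l, IsIntegral (MvPolynomial (Fin s ⊕ Fin (m - r)) ℂ)
          (mk (X (.inl (.inr l))) * mk (X (.inr (.inl l)))) := by
        intro l
        have := hLint (Ideal.Quotient.mk _ (X (.inr (.inl l))))
        rw [hL] at this
        simpa [hΛ, liftPt] using this
      have hX : ∀ i, IsIntegral (MvPolynomial (Fin s ⊕ Fin (m - r)) ℂ) (mk (X i)) := by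
        rintro ((i | l) | (l | k))
        · have := hLint (Ideal.Quotient.mk _ (X (.inl i)))
          rw [hL] at this
          simpa [hΛ, liftPt] using this
        · exact isIntegralElem_left_of_add_of_mul hC (hab l) (hmul l)
        · refine isIntegralElem_left_of_add_of_mul hC (b := mk (X (.inl (.inr l)))) ?_ ?_
          · rw [add_comm]; exact hab l
          · rw [mul_comm]; exact hmul l
        · have := hLint (Ideal.Quotient.mk _ (X (.inr (.inr k))))
          rw [hL] at this
          simpa [hΛ, liftPt] using this
      intro b
      obtain ⟨p, rfl⟩ := Ideal.Quotient.mkₐ_surjective ℂ I b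
      change IsIntegral _ (mk p)
      induction p using MvPolynomial.induction_on with
      | C c => exact hC c
      | add p q hp hq => rw [map_add]; exact hp.add hq
      | mul_X p i hp => rw [map_mul]; exact hp.mul (hX i)
    refine RingHom.IsIntegral.to_finite hint ?_
    have : (algebraMap ℂ (MvPolynomial (IdxL n m r) ℂ ⧸ I)).FiniteType :=
      RingHom.finiteType_algebraMap.2 inferInstance
    rw [← ψ.comp_algebraMap] at this
    exact RingHom.FiniteType.of_comp_finiteType this
  obtain ⟨C, hC⟩ := finrank_map_restrictTotalDegree_le mk ψ hψ
  refine ⟨C, fun t => (hC t).2.trans ?_⟩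
  refine Nat.mul_le_mul le_rfl (Nat.pow_le_pow_right (by omega) ?_)
  simp only [Fintype.card_sum, Fintype.card_fin]
  omega

theorem coeff_aeval_X_pow_mul {σ R : Type*} [CommRing R] (w : σ → ℕ) (p : MvPolynomial σ R)
    (s : σ →₀ ℕ) (e : ℕ) :
    coeff s ((aeval (R := R) (fun i => (Polynomial.X : Polynomial (MvPolynomial σ R)) ^ w i *
      Polynomial.C (X i)) p).coeff e) = if Finsupp.weight w s = e then coeff s p else 0 := by
  induction p using MvPolynomial.induction_on' with
  | monomial u c =>
    have h : aeval (R := R) (fun i => (Polynomial.X : Polynomial (MvPolynomial σ R)) ^ w i *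
      Polynomial.C (X i)) (monomial u c) =
        Polynomial.C (monomial u c) * Polynomial.X ^ Finsupp.weight w u := by
      rw [aeval_monomial, Finsupp.prod]
      simp_rw [mul_pow, ← pow_mul]
      rw [Finset.prod_mul_distrib, Finset.prod_pow_eq_pow_sum, Finsupp.weight_apply, Finsupp.sum]
      rw [monomial_eq, Finsupp.prod, map_mul, map_prod]
      simp_rw [smul_eq_mul, mul_comm (w _), map_pow]
      have : algebraMap R (Polynomial (MvPolynomial σ R)) c = Polynomial.C (C c) := rfl
      rw [this]
      ring
    rw [h, Polynomial.coeff_C_mul_X_pow]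
    by_cases hs : s = u
    · subst hs
      simp only [eq_comm, coeff_monomial, if_true]
      split_ifs <;> simp
    · have h2 : coeff s (monomial u c) = 0 := by rw [coeff_monomial, if_neg (Ne.symm hs)]
      rw [h2]
      split_ifs <;> simp [h2]
  | add p q hp hq =>
    rw [map_add, Polynomial.coeff_add, coeff_add, hp, hq, coeff_add]
    split_ifs <;> simp

theorem isWeightedHomogeneous_of_aeval {σ R : Type*} [CommRing R] (w : σ → ℕ)
    {p : MvPolynomial σ R} {d : ℕ}
    (h : aeval (R := R) (fun i => (Polynomial.X : Polynomial (MvPolynomial σ R)) ^ w i *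
      Polynomial.C (X i)) p = Polynomial.X ^ d * Polynomial.C p) :
    IsWeightedHomogeneous w p d := by
  intro s hs
  by_contra hne
  have := coeff_aeval_X_pow_mul w p s (Finsupp.weight w s)
  rw [h, if_pos rfl, mul_comm, Polynomial.coeff_C_mul_X_pow, if_neg hne] at this
  exact hs (by simpa using this.symm)

theorem _root_.MvPolynomial.IsWeightedHomogeneous.aeval {σ τ R : Type*} [CommRing R] {w : σ → ℕ}
    {w' : τ → ℕ} {p : MvPolynomial σ R} {d : ℕ} (hp : IsWeightedHomogeneous w p d)
    {f : σ → MvPolynomial τ R} (hf : ∀ i, IsWeightedHomogeneous w' (f i) (w i)) :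
    IsWeightedHomogeneous w' (aeval f p) d := by
  rw [p.as_sum, map_sum]
  refine IsWeightedHomogeneous.sum _ _ _ fun s hs => ?_
  rw [aeval_monomial, ← hp (mem_support_iff.1 hs), Finsupp.prod, algebraMap_eq]
  refine IsWeightedHomogeneous.C_mul ?_ _
  rw [Finsupp.weight_apply, Finsupp.sum]
  exact IsWeightedHomogeneous.prod _ _ _ fun i _ => (hf i).pow _

theorem _root_.MvPolynomial.IsWeightedHomogeneous.add_weight {σ R : Type*} [CommRing R]
    {w w' : σ → ℕ} {p : MvPolynomial σ R} {d d' : ℕ} (hp : IsWeightedHomogeneous w p d)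
    (hp' : IsWeightedHomogeneous w' p d') : IsWeightedHomogeneous (w + w') p (d + d') := by
  intro s hs
  rw [← hp hs, ← hp' hs]
  simp only [Finsupp.weight_apply, Finsupp.sum, Pi.add_apply, smul_add, Finset.sum_add_distrib]

/-- Evaluation of a polynomial with integer coefficients in a commutative ring. -/
def evalZ {σ R : Type*} [CommRing R] (p : MvPolynomial σ ℤ) (v : σ → R) : R :=
  eval₂ (Int.castRingHom R) v p

theorem aeval_eq_evalZ {σ R : Type*} [CommRing R] [Algebra ℤ R] (p : MvPolynomial σ ℤ)
    (v : σ → R) : aeval v p = evalZ p v := by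
  rw [aeval_def, evalZ, Subsingleton.elim (algebraMap ℤ R) (Int.castRingHom R)]

theorem map_evalZ {σ R S : Type*} [CommRing R] [CommRing S] (φ : R →+* S) (p : MvPolynomial σ ℤ)
    (v : σ → R) : φ (evalZ p v) = evalZ p fun i => φ (v i) := by
  rw [evalZ, eval₂_comp_left, evalZ, Subsingleton.elim (φ.comp (Int.castRingHom R))
    (Int.castRingHom S)]
  rfl

theorem evalZ_X {σ : Type*} (p : MvPolynomial σ ℤ) : evalZ p X = p := by
  rw [← aeval_eq_evalZ, aeval_X_left_apply]

theorem evalZ_bind {σ τ R : Type*} [CommRing R] (p : MvPolynomial σ ℤ) (f : σ → MvPolynomial τ ℤ)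
    (v : τ → R) : evalZ (aeval f p) v = evalZ p fun i => evalZ (f i) v := by
  rw [aeval_eq_evalZ]
  exact map_evalZ (eval₂Hom (Int.castRingHom R) v) p f

theorem Bihomogeneous.isWeightedHomogeneous_left {F : MvPolynomial (Idx n m r) ℤ} {d₁ d₂ : ℕ}
    (hF : Bihomogeneous F d₁ d₂) : IsWeightedHomogeneous (Sum.elim 1 (Sum.elim 1 0)) F d₁ := by
  refine isWeightedHomogeneous_of_aeval _ ?_
  have h := hF (Polynomial (MvPolynomial (Idx n m r) ℤ)) Polynomial.X 1
    (fun i => Polynomial.C (X (.inl i))) (fun i => Polynomial.C (X (.inr (.inl i))))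
    (fun i => Polynomial.C (X (.inr (.inr i))))
  rw [evalF, evalF, aeval_eq_evalZ, aeval_eq_evalZ] at h
  rw [aeval_eq_evalZ]
  have h2 := map_evalZ Polynomial.C F (X : Idx n m r → MvPolynomial (Idx n m r) ℤ)
  rw [evalZ_X] at h2
  rw [h2]
  refine Eq.trans (congrArg (evalZ F) ?_) (h.trans ?_)
  · ext1 (i | i | i) <;> simp
  · rw [one_pow, mul_one]
    congr 2
    ext1 (i | i | i) <;> simp

theorem Bihomogeneous.isWeightedHomogeneous_right {F : MvPolynomial (Idx n m r) ℤ} {d₁ d₂ : ℕ}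
    (hF : Bihomogeneous F d₁ d₂) : IsWeightedHomogeneous (Sum.elim 0 (Sum.elim 1 1)) F d₂ := by
  refine isWeightedHomogeneous_of_aeval _ ?_
  have h := hF (Polynomial (MvPolynomial (Idx n m r) ℤ)) 1 Polynomial.X
    (fun i => Polynomial.C (X (.inl i))) (fun i => Polynomial.C (X (.inr (.inl i))))
    (fun i => Polynomial.C (X (.inr (.inr i))))
  rw [evalF, evalF, aeval_eq_evalZ, aeval_eq_evalZ] at h
  rw [aeval_eq_evalZ]
  have h2 := map_evalZ Polynomial.C F (X : Idx n m r → MvPolynomial (Idx n m r) ℤ)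
  rw [evalZ_X] at h2
  rw [h2]
  refine Eq.trans (congrArg (evalZ F) ?_) (h.trans ?_)
  · ext1 (i | i | i) <;> simp
  · rw [one_pow, one_mul]
    congr 2
    ext1 (i | i | i) <;> simp

/-- The partial derivative of `F` in the direction `j`, in the variables `(x, a, b, z)`. -/
def liftDeriv (F : MvPolynomial (Idx n m r) ℤ) (j : IdxT n m r) : MvPolynomial (IdxL n m r) ℤ :=
  aeval (liftPt X) (pderiv (.inr j) F)

theorem evalZ_liftDeriv {R : Type*} [CommRing R] (F : MvPolynomial (Idx n m r) ℤ) (j : IdxT n m r)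
    (v : IdxL n m r → R) : evalZ (liftDeriv F j) v = evalZ (pderiv (.inr j) F) (liftPt v) := by
  rw [liftDeriv, evalZ_bind]
  congr 1
  ext1 (i | i | i) <;> simp [liftPt, evalZ]

theorem Bihomogeneous.liftDeriv_left {F : MvPolynomial (Idx n m r) ℤ} {d₁ d₂ : ℕ}
    (hF : Bihomogeneous F (d₁ + 1) d₂) (j : IdxT n m r) :
    IsWeightedHomogeneous (Sum.elim 1 0) (liftDeriv F j) (Sum.elim (fun _ => d₁)
      (fun _ => d₁ + 1) j) := by
  refine IsWeightedHomogeneous.aeval (w := Sum.elim 1 (Sum.elim 1 0))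
    (hF.isWeightedHomogeneous_left.pderiv (by rcases j with j | j <;> rfl)) ?_
  rintro (i | i | i)
  · exact isWeightedHomogeneous_X _ _ _
  · exact (isWeightedHomogeneous_X _ _ _).mul (isWeightedHomogeneous_X _ _ _)
  · exact isWeightedHomogeneous_X _ _ _

theorem Bihomogeneous.liftDeriv_right {F : MvPolynomial (Idx n m r) ℤ} {d₁ d₂ : ℕ}
    (hF : Bihomogeneous F d₁ (d₂ + 1)) (j : IdxT n m r) :
    IsWeightedHomogeneous (Sum.elim 0 1) (liftDeriv F j) d₂ := by
  refine IsWeightedHomogeneous.aeval (w := Sum.elim 0 (Sum.elim 1 1))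
    (hF.isWeightedHomogeneous_right.pderiv (by rcases j with j | j <;> rfl)) ?_
  rintro (i | i | i)
  · exact isWeightedHomogeneous_X _ _ _
  · exact (isWeightedHomogeneous_X _ _ _).mul (isWeightedHomogeneous_X _ _ _)
  · exact isWeightedHomogeneous_X _ _ _

/-- The iterated difference of `f` with increments `h 0, …, h (k - 1)`. -/
def pol {A B : Type*} [AddCommGroup A] [AddCommGroup B] :
    (k : ℕ) → (A → B) → (Fin k → A) → A → B
  | 0, f, _ => f
  | k + 1, f, h => pol k (fun x => f (x + h 0) - f x) (Fin.tail h)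

section pol

variable {A A' B B' : Type*} [AddCommGroup A] [AddCommGroup A'] [AddCommGroup B] [AddCommGroup B']

theorem pol_comp (f : A → B) (φ L : A' → A) (hφ : ∀ x h, φ (x + h) = φ x + L h) (k : ℕ)
    (h : Fin k → A') (x : A') :
    pol k (fun x => f (φ x)) h x = pol k f (fun i => L (h i)) (φ x) := by
  induction k generalizing f with
  | zero => rfl
  | succ k ih =>
    simp only [pol, hφ]
    exact ih (fun x => f (x + L (h 0)) - f x) (Fin.tail h)

theorem map_pol (ψ : B →+ B') (f : A → B) (k : ℕ) (h : Fin k → A) (x : A) :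
    pol k (fun x => ψ (f x)) h x = ψ (pol k f h x) := by
  induction k generalizing f with
  | zero => rfl
  | succ k ih =>
    simp only [pol, ← map_sub]
    exact ih (fun x => f (x + h 0) - f x) (Fin.tail h)

theorem pol_add (f g : A → B) (k : ℕ) (h : Fin k → A) (x : A) :
    pol k (fun x => f x + g x) h x = pol k f h x + pol k g h x := by
  induction k generalizing f g with
  | zero => rfl
  | succ k ih =>
    simp only [pol]
    rw [← ih]
    congr 1
    ext x
    abel

theorem pol_zero (k : ℕ) (h : Fin k → A) (x : A) : pol k (fun _ => (0 : B)) h x = 0 := by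
  have := map_pol (0 : B →+ B) (fun _ => (0 : B)) k h x
  simpa using this

/-- `f` has degree less than `N` along the directions in `U`. -/
def DegLT (U : AddSubgroup A) : ℕ → (A → B) → Prop
  | 0, f => ∀ x, f x = 0
  | N + 1, f => ∀ h ∈ U, DegLT U N fun x => f (x + h) - f x

variable {U : AddSubgroup A}

theorem DegLT.congr {N : ℕ} {f g : A → B} (hf : DegLT U N f) (h : ∀ x, f x = g x) :
    DegLT U N g := (funext h : f = g) ▸ hf

theorem degLT_zero_fun (N : ℕ) : DegLT U N fun _ => (0 : B) := by
  induction N with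
  | zero => intro x; rfl
  | succ N ih => intro h _; simpa using ih

theorem DegLT.add {N : ℕ} {f g : A → B} (hf : DegLT U N f) (hg : DegLT U N g) :
    DegLT U N fun x => f x + g x := by
  induction N generalizing f g with
  | zero => intro x; simp [hf x, hg x]
  | succ N ih =>
    intro h hh
    exact (ih (hf h hh) (hg h hh)).congr fun x => by simp only; abel

theorem DegLT.map {N : ℕ} {f : A → B} (hf : DegLT U N f) (ψ : B →+ B') :
    DegLT U N fun x => ψ (f x) := by
  induction N generalizing f with
  | zero => intro x; simp [hf x]
  | succ N ih =>
    intro h hh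
    exact (ih (hf h hh)).congr fun x => by rw [map_sub]

theorem DegLT.comp {V : AddSubgroup A'} {N : ℕ} {f : A → B} (hf : DegLT U N f) (φ L : A' → A)
    (hφ : ∀ x h, φ (x + h) = φ x + L h) (hL : ∀ h ∈ V, L h ∈ U) :
    DegLT V N fun x => f (φ x) := by
  induction N generalizing f with
  | zero => intro x; exact hf _
  | succ N ih =>
    intro h hh
    exact (ih (hf (L h) (hL h hh))).congr fun x => by simp only [hφ]

theorem DegLT.shift {N : ℕ} {f : A → B} (hf : DegLT U N f) (u : A) :
    DegLT U N fun x => f (x + u) :=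
  hf.comp (fun x => x + u) id (fun x h => by simp only [id]; abel) fun _ h => h

theorem DegLT.succ {N : ℕ} {f : A → B} (hf : DegLT U N f) : DegLT U (N + 1) f := by
  induction N generalizing f with
  | zero => intro h _ x; simp [hf x, hf (x + h)]
  | succ N ih => intro h hh; exact ih (hf h hh)

theorem DegLT.sum {N : ℕ} {κ : Type*} (s : Finset κ) {f : κ → A → B}
    (hf : ∀ i ∈ s, DegLT U N (f i)) : DegLT U N fun x => ∑ i ∈ s, f i x := by
  induction s using Finset.induction_on with
  | empty => simpa using degLT_zero_fun N
  | insert i s hi ih =>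
    simp only [Finset.sum_insert hi]
    exact (hf i (by simp)).add (ih fun j hj => hf j (by simp [hj]))

theorem DegLT.mul {R : Type*} [CommRing R] {a b : ℕ} {f g : A → R} (hf : DegLT U (a + 1) f)
    (hg : DegLT U (b + 1) g) : DegLT U (a + b + 1) fun x => f x * g x := by
  induction hab : a + b generalizing a b f g with
  | zero =>
    obtain ⟨rfl, rfl⟩ : a = 0 ∧ b = 0 := by omega
    intro h hh x
    have h1 := hf h hh x
    have h2 := hg h hh x
    rw [sub_eq_zero] at h1 h2 ⊢
    simp only [h1, h2]
  | succ c ih =>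
    intro h hh
    have h1 : DegLT U (c + 1) fun x => (f (x + h) - f x) * g (x + h) := by
      rcases a with _ | a
      · exact (degLT_zero_fun _).congr fun x => by
          have : f (x + h) - f x = 0 := hf h hh x
          rw [this, zero_mul]
      · exact ih (hf h hh) (hg.shift h) (by omega)
    have h2 : DegLT U (c + 1) fun x => f x * (g (x + h) - g x) := by
      rcases b with _ | b
      · exact (degLT_zero_fun _).congr fun x => by
          have : g (x + h) - g x = 0 := hg h hh x
          rw [this, mul_zero]
      · exact ih hf (hg h hh) (by omega)
    exact (h1.add h2).congr fun x => by ring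

theorem DegLT.pow {R : Type*} [CommRing R] {a : ℕ} {f : A → R} (hf : DegLT U (a + 1) f) (s : ℕ) :
    DegLT U (s * a + 1) fun x => f x ^ s := by
  induction s with
  | zero => intro h _; simpa using degLT_zero_fun _
  | succ s ih =>
    simp only [pow_succ]
    rw [Nat.succ_mul]
    exact ih.mul hf

theorem DegLT.prod {R κ : Type*} [CommRing R] (s : Finset κ) {a : κ → ℕ} {f : κ → A → R}
    (hf : ∀ i ∈ s, DegLT U (a i + 1) (f i)) :
    DegLT U (∑ i ∈ s, a i + 1) fun x => ∏ i ∈ s, f i x := by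
  induction s using Finset.induction_on with
  | empty => intro h _; simpa using degLT_zero_fun _
  | insert i s hi ih =>
    simp only [Finset.prod_insert hi, Finset.sum_insert hi]
    exact (hf i (by simp)).mul (ih fun j hj => hf j (by simp [hj]))

theorem DegLT.evalZ {σ R : Type*} [CommRing R] {w : σ → ℕ} {p : MvPolynomial σ ℤ} {d : ℕ}
    (hp : IsWeightedHomogeneous w p d) {f : σ → A → R} (hf : ∀ i, DegLT U (w i + 1) (f i)) :
    DegLT U (d + 1) fun x => evalZ p fun i => f i x := by
  simp only [PaperTM.evalZ, eval₂_eq]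
  refine DegLT.sum _ fun s hs => ?_
  have h1 := DegLT.prod s.support (fun i _ => (hf i).pow (s i))
  have h2 : ∑ i ∈ s.support, s i * w i = d := by
    rw [← hp (mem_support_iff.1 hs), Finsupp.weight_apply]; rfl
  rw [h2] at h1
  exact h1.map (AddMonoidHom.mulLeft (Int.castRingHom R (coeff s p)))

theorem DegLT.pol {N k : ℕ} {f : A → B} (hf : DegLT U (k + N) f) {h : Fin k → A}
    (hh : ∀ i, h i ∈ U) : DegLT U N (pol k f h) := by
  induction k generalizing f with
  | zero => rwa [Nat.zero_add] at hf
  | succ k ih =>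
    rw [Nat.succ_add_eq_add_succ, Nat.add_succ] at hf
    exact ih (hf _ (hh 0)) fun i => hh _

theorem DegLT.pol_of_comm {V : AddSubgroup A} {N k : ℕ} {f : A → B} (hf : DegLT V N f)
    (h : Fin k → A) : DegLT V N (PaperTM.pol k f h) := by
  induction k generalizing f with
  | zero => exact hf
  | succ k ih =>
    refine ih ?_ _
    exact ((hf.shift (h 0)).add (hf.map (-AddMonoidHom.id B))).congr fun x => by
      simp [sub_eq_add_neg]

theorem pol_eq_zero {k : ℕ} {f : A → B} (hf : DegLT U k f) {h : Fin k → A}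
    (hh : ∀ i, h i ∈ U) (x : A) : pol k f h x = 0 :=
  DegLT.pol (N := 0) (by simpa using hf) hh x

theorem pol_add_right {k : ℕ} {f : A → B} (hf : DegLT U (k + 1) f) {h : Fin k → A}
    (hh : ∀ i, h i ∈ U) {u : A} (hu : u ∈ U) (x : A) : pol k f h (x + u) = pol k f h x :=
  sub_eq_zero.1 (DegLT.pol hf hh u hu x)

/-- The iterated difference of a function of degree `k` is additive in the first increment. -/
theorem pol_cons_add {k : ℕ} {f : A → B} (hf : DegLT U (k + 2) f) {h : Fin k → A}
    (hh : ∀ i, h i ∈ U) {u v : A} (hu : u ∈ U) (hv : v ∈ U) (x : A) :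
    pol (k + 1) f (Fin.cons (u + v) h : Fin (k + 1) → A) x =
      pol (k + 1) f (Fin.cons u h : Fin (k + 1) → A) x +
        pol (k + 1) f (Fin.cons v h : Fin (k + 1) → A) x := by
  simp only [pol, Fin.cons_zero, Fin.tail_cons]
  have h1 : pol k (fun y => f (y + (u + v)) - f y) h x =
      pol k (fun y => (f (y + u) - f y) + (f (y + v) - f y)) h x +
      pol k (fun y => (f (y + v + u) - f (y + v)) - (f (y + u) - f y)) h x := by
    rw [← pol_add]
    congr 1
    ext y
    rw [show y + (u + v) = y + v + u by abel]
    abel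
  rw [h1, pol_eq_zero (f := fun y => (f (y + v + u) - f (y + v)) - (f (y + u) - f y))
    (hf u hu v hv) hh, add_zero, pol_add]

end pol

section Gam

variable {σ τ : Type*}

/-- Projection to the first block of coordinates. -/
def projX {R : Type*} [Zero R] (v : σ ⊕ τ → R) : σ ⊕ τ → R := Sum.elim (fun i => v (.inl i)) 0

/-- Projection to the second block of coordinates. -/
def projT {R : Type*} [Zero R] (v : σ ⊕ τ → R) : σ ⊕ τ → R := Sum.elim 0 fun i => v (.inr i)

theorem projX_add {R : Type*} [AddCommGroup R] (u v : σ ⊕ τ → R) :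
    projX (u + v) = projX u + projX v := by
  ext (i | i) <;> simp [projX]

theorem projT_add {R : Type*} [AddCommGroup R] (u v : σ ⊕ τ → R) :
    projT (u + v) = projT u + projT v := by
  ext (i | i) <;> simp [projT]

/-- The vectors supported on the first block of coordinates. -/
def dirX (σ τ R : Type*) [AddCommGroup R] : AddSubgroup (σ ⊕ τ → R) where
  carrier := {v | ∀ i, v (.inr i) = 0}
  add_mem' h1 h2 i := by simp [h1 i, h2 i]
  zero_mem' _ := rfl
  neg_mem' h i := by simp [h i]

/-- The vectors supported on the second block of coordinates. -/
def dirT (σ τ R : Type*) [AddCommGroup R] : AddSubgroup (σ ⊕ τ → R) where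
  carrier := {v | ∀ i, v (.inl i) = 0}
  add_mem' h1 h2 i := by simp [h1 i, h2 i]
  zero_mem' _ := rfl
  neg_mem' h i := by simp [h i]

theorem projX_mem {R : Type*} [AddCommGroup R] (v : σ ⊕ τ → R) : projX v ∈ dirX σ τ R :=
  fun _ => rfl

theorem projT_mem {R : Type*} [AddCommGroup R] (v : σ ⊕ τ → R) : projT v ∈ dirT σ τ R :=
  fun _ => rfl

theorem degLT_evalZ_X {R : Type*} [CommRing R] {g : MvPolynomial (σ ⊕ τ) ℤ} {e : ℕ}
    (hg : IsWeightedHomogeneous (Sum.elim 1 0) g e) : DegLT (dirX σ τ R) (e + 1) (evalZ g) := by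
  suffices h : ∀ i : σ ⊕ τ, DegLT (dirX σ τ R) ((Sum.elim 1 0 : σ ⊕ τ → ℕ) i + 1)
      fun v : σ ⊕ τ → R => v i from
    DegLT.evalZ (A := σ ⊕ τ → R) (R := R) hg (f := fun i v => v i) h
  rintro (i | i)
  · intro h _ h' _ x
    simp
  · intro h hh x
    simp [hh i]

theorem degLT_evalZ_T {R : Type*} [CommRing R] {g : MvPolynomial (σ ⊕ τ) ℤ} {k : ℕ}
    (hg : IsWeightedHomogeneous (Sum.elim 0 1) g k) : DegLT (dirT σ τ R) (k + 1) (evalZ g) := by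
  suffices h : ∀ i : σ ⊕ τ, DegLT (dirT σ τ R) ((Sum.elim 0 1 : σ ⊕ τ → ℕ) i + 1)
      fun v : σ ⊕ τ → R => v i from
    DegLT.evalZ (A := σ ⊕ τ → R) (R := R) hg (f := fun i v => v i) h
  rintro (i | i)
  · intro h hh x
    simp [hh i]
  · intro h _ h' _ x
    simp

/-- The polarization of a bihomogeneous polynomial. -/
def Gam (k e : ℕ) (g : MvPolynomial (σ ⊕ τ) ℤ) {R : Type*} [CommRing R]
    (h : Fin k → σ ⊕ τ → R) (H : Fin e → σ ⊕ τ → R) : R :=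
  pol e (pol k (evalZ g) fun i => projT (h i)) (fun i => projX (H i)) 0

theorem Gam_map {R S : Type*} [CommRing R] [CommRing S] (φ : R →+* S) (k e : ℕ)
    (g : MvPolynomial (σ ⊕ τ) ℤ) (h : Fin k → σ ⊕ τ → R) (H : Fin e → σ ⊕ τ → R) :
    Gam k e g (fun i j => φ (h i j)) (fun i j => φ (H i j)) = φ (Gam k e g h H) := by
  set Φ : (σ ⊕ τ → R) → (σ ⊕ τ → S) := fun v j => φ (v j) with hΦ
  have hΦadd : ∀ x y, Φ (x + y) = Φ x + Φ y := fun x y => by ext; simp [hΦ]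
  have hX : ∀ v, projX (Φ v) = Φ (projX v) := fun v => by ext (i | i) <;> simp [hΦ, projX]
  have hT : ∀ v, projT (Φ v) = Φ (projT v) := fun v => by ext (i | i) <;> simp [hΦ, projT]
  have h0 : Φ 0 = 0 := by ext; simp [hΦ]
  change pol e (pol k (evalZ g) fun i => projT (Φ (h i))) (fun i => projX (Φ (H i))) 0 = _
  simp only [hX, hT]
  rw [← h0, ← pol_comp _ Φ Φ hΦadd]
  have : (fun x => pol k (evalZ g) (fun i => Φ (projT (h i))) (Φ x)) =
      fun x => φ (pol k (evalZ g) (fun i => projT (h i)) x) := by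
    ext x
    rw [← pol_comp _ Φ Φ hΦadd]
    have : (fun x => evalZ g (Φ x)) = fun x => (φ : R →+ S) (evalZ g x) := by
      ext x
      exact (map_evalZ φ g x).symm
    rw [this, map_pol]
    rfl
  rw [this]
  exact map_pol (φ : R →+ S) _ _ _ _

theorem evalZ_smul {σ R : Type*} [CommRing R] {p : MvPolynomial σ ℤ} {t : ℕ}
    (hp : p.IsHomogeneous t) (c : R) (v : σ → R) : evalZ p (c • v) = c ^ t * evalZ p v := by
  simp only [evalZ, eval₂_eq, Finset.mul_sum]
  refine Finset.sum_congr rfl fun s hs => ?_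
  have : ∑ i ∈ s.support, s i = t := by
    have := hp (mem_support_iff.1 hs)
    rw [Finsupp.weight_apply, Finsupp.sum] at this
    simpa using this
  simp only [Pi.smul_apply, smul_eq_mul, mul_pow, Finset.prod_mul_distrib,
    Finset.prod_pow_eq_pow_sum, this]
  ring

theorem Gam_smul {R : Type*} [CommRing R] {k e t : ℕ} {g : MvPolynomial (σ ⊕ τ) ℤ}
    (hg : g.IsHomogeneous t) (c : R) (h : Fin k → σ ⊕ τ → R) (H : Fin e → σ ⊕ τ → R) :
    Gam k e g (fun i => c • h i) (fun i => c • H i) = c ^ t * Gam k e g h H := by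
  set Φ : (σ ⊕ τ → R) → (σ ⊕ τ → R) := fun v => c • v with hΦ
  have hΦadd : ∀ x y, Φ (x + y) = Φ x + Φ y := fun x y => smul_add c x y
  have hX : ∀ v, projX (Φ v) = Φ (projX v) := fun v => by ext (i | i) <;> simp [hΦ, projX]
  have hT : ∀ v, projT (Φ v) = Φ (projT v) := fun v => by ext (i | i) <;> simp [hΦ, projT]
  have h0 : Φ 0 = 0 := by simp [hΦ]
  change pol e (pol k (evalZ g) fun i => projT (Φ (h i))) (fun i => projX (Φ (H i))) 0 = _
  simp only [hX, hT]
  rw [← h0, ← pol_comp _ Φ Φ hΦadd]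
  have : (fun x => pol k (evalZ g) (fun i => Φ (projT (h i))) (Φ x)) =
      fun x => AddMonoidHom.mulLeft (c ^ t) (pol k (evalZ g) (fun i => projT (h i)) x) := by
    ext x
    rw [← pol_comp _ Φ Φ hΦadd]
    have : (fun x => evalZ g (Φ x)) = fun x => AddMonoidHom.mulLeft (c ^ t) (evalZ g x) := by
      ext x
      exact evalZ_smul hg c x
    rw [this, map_pol]
  rw [this]
  exact map_pol _ _ _ _ _

theorem Gam_add_left {R : Type*} [CommRing R] {k e : ℕ} {g : MvPolynomial (σ ⊕ τ) ℤ}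
    (hg : IsWeightedHomogeneous (Sum.elim 0 1) g (k + 1)) (u v : σ ⊕ τ → R)
    (h : Fin k → σ ⊕ τ → R) (H : Fin e → σ ⊕ τ → R) :
    Gam (k + 1) e g (Fin.cons (u + v) h : Fin (k + 1) → σ ⊕ τ → R) H =
      Gam (k + 1) e g (Fin.cons u h : Fin (k + 1) → σ ⊕ τ → R) H +
      Gam (k + 1) e g (Fin.cons v h : Fin (k + 1) → σ ⊕ τ → R) H := by
  have hc : ∀ w, (fun i => projT ((Fin.cons w h : Fin (k + 1) → σ ⊕ τ → R) i)) =
      (Fin.cons (projT w) (fun i => projT (h i)) : Fin (k + 1) → σ ⊕ τ → R) := by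
    intro w
    ext1 i
    refine Fin.cases ?_ (fun i => ?_) i <;> simp
  simp only [Gam, hc, projT_add]
  rw [← pol_add]
  congr 1
  ext x
  exact pol_cons_add (degLT_evalZ_T hg) (fun i => projT_mem _) (projT_mem _) (projT_mem _) x

theorem Gam_add_right {R : Type*} [CommRing R] {k e : ℕ} {g : MvPolynomial (σ ⊕ τ) ℤ}
    (hg : IsWeightedHomogeneous (Sum.elim 1 0) g (e + 1)) (u v : σ ⊕ τ → R)
    (h : Fin k → σ ⊕ τ → R) (H : Fin e → σ ⊕ τ → R) :
    Gam k (e + 1) g h (Fin.cons (u + v) H : Fin (e + 1) → σ ⊕ τ → R) =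
      Gam k (e + 1) g h (Fin.cons u H : Fin (e + 1) → σ ⊕ τ → R) +
      Gam k (e + 1) g h (Fin.cons v H : Fin (e + 1) → σ ⊕ τ → R) := by
  have hc : ∀ w, (fun i => projX ((Fin.cons w H : Fin (e + 1) → σ ⊕ τ → R) i)) =
      (Fin.cons (projX w) (fun i => projX (H i)) : Fin (e + 1) → σ ⊕ τ → R) := by
    intro w
    ext1 i
    refine Fin.cases ?_ (fun i => ?_) i <;> simp
  simp only [Gam, hc, projX_add]
  exact pol_cons_add ((degLT_evalZ_X hg).pol_of_comm _) (fun i => projX_mem _) (projX_mem _)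
    (projX_mem _) 0

theorem norm_pol_le {A B : Type*} [NormedAddCommGroup A] [NormedAddCommGroup B] {k : ℕ} {ρ M : ℝ}
    {f : A → B} (hf : ∀ x, ‖x‖ ≤ ρ + k → ‖f x‖ ≤ M) {h : Fin k → A} (hh : ∀ i, ‖h i‖ ≤ 1) {x : A}
    (hx : ‖x‖ ≤ ρ) : ‖pol k f h x‖ ≤ 2 ^ k * M := by
  induction k generalizing f M with
  | zero => simpa [pol] using hf x (by simpa using hx)
  | succ k ih =>
    rw [pow_succ, mul_assoc]
    refine ih (fun y hy => ?_) fun i => hh _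
    push_cast at hf
    refine (norm_sub_le _ _).trans ?_
    have h1 := hf (y + h 0) ((norm_add_le _ _).trans (by linarith [hh 0]))
    have h2 := hf y (by linarith)
    linarith

theorem continuous_evalZ {σ : Type*} (p : MvPolynomial σ ℤ) :
    Continuous fun v : σ → ℝ => evalZ p v := by
  simp only [evalZ, eval₂_eq]
  fun_prop

theorem exists_abs_Gam_le [Fintype σ] [Fintype τ] (k e : ℕ) (g : MvPolynomial (σ ⊕ τ) ℤ) :
    ∃ M : ℝ, 0 ≤ M ∧ ∀ (h : Fin k → σ ⊕ τ → ℝ) (H : Fin e → σ ⊕ τ → ℝ), (∀ i, ‖h i‖ ≤ 1) →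
      (∀ i, ‖H i‖ ≤ 1) → |Gam k e g h H| ≤ M := by
  obtain ⟨M, hM⟩ := (isCompact_closedBall (0 : σ ⊕ τ → ℝ) (e + k)).exists_bound_of_continuousOn
    (continuous_evalZ g).continuousOn
  have hP : ∀ v : σ ⊕ τ → ℝ, ‖v‖ ≤ 1 → ‖projX v‖ ≤ 1 ∧ ‖projT v‖ ≤ 1 := by
    intro v hv
    rw [pi_norm_le_iff_of_nonneg zero_le_one] at hv
    constructor <;>
    · rw [pi_norm_le_iff_of_nonneg zero_le_one]
      rintro (i | i) <;> simp [projX, projT, hv, -Real.norm_eq_abs]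
  refine ⟨2 ^ e * (2 ^ k * M), ?_, fun h H hh hH => ?_⟩
  · have := (norm_nonneg _).trans (hM 0 (by simp; positivity))
    positivity
  rw [← Real.norm_eq_abs]
  refine norm_pol_le (ρ := 0) (fun x hx => ?_) (fun i => (hP _ (hH i)).1) (by simp)
  refine norm_pol_le (ρ := e) (fun x hx => hM x (by simpa using hx))
    (fun i => (hP _ (hh i)).2) (by simpa using hx)

end Gam

section leading

variable {σ τ : Type*}

theorem prod_sub_prod_mem_lowDeg {ι R κ : Type*} [CommRing R] (s : Finset κ)
    {p q : κ → MvPolynomial ι R} {d : κ → ℕ} (hq : ∀ i ∈ s, q i ∈ lowDeg ι R (d i + 1))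
    (hpq : ∀ i ∈ s, p i - q i ∈ lowDeg ι R (d i)) :
    ∏ i ∈ s, p i - ∏ i ∈ s, q i ∈ lowDeg ι R (∑ i ∈ s, d i) ∧
      ∏ i ∈ s, q i ∈ lowDeg ι R (∑ i ∈ s, d i + 1) := by
  induction s using Finset.induction_on with
  | empty => simpa using IsHomogeneous.mem_lowDeg (isHomogeneous_one ι R)
  | insert i s hi ih =>
    obtain ⟨h1, h2⟩ := ih (fun j hj => hq j (by simp [hj])) fun j hj => hpq j (by simp [hj])
    have h3 := hpq i (by simp)
    have h4 := hq i (by simp)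
    simp only [Finset.prod_insert hi, Finset.sum_insert hi]
    have h5 : p i ∈ lowDeg ι R (d i + 1) := by
      rw [← sub_add_cancel (p i) (q i)]
      exact Submodule.add_mem _ (lowDeg_mono (Nat.le_succ _) h3) h4
    constructor
    · rw [show p i * ∏ x ∈ s, p x - q i * ∏ x ∈ s, q x =
        (∏ x ∈ s, p x - ∏ x ∈ s, q x) * p i + (p i - q i) * ∏ x ∈ s, q x by ring]
      refine Submodule.add_mem _ ?_ (mul_mem_lowDeg h3 h2)
      rw [add_comm]
      exact mul_mem_lowDeg h1 h5
    · have := mul_mem_lowDeg (a := d i + 1) h4 h2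
      rwa [Nat.add_right_comm] at this

/-- `φ` behaves to leading order like `c • f` on the points `(a X + u, b X + v)`. -/
def Lead (t : ℕ) (f : MvPolynomial (σ ⊕ τ) ℂ)
    (φ : (σ ⊕ τ → MvPolynomial (σ ⊕ τ) ℂ) → MvPolynomial (σ ⊕ τ) ℂ) (c : ℂ → ℂ → ℂ) : Prop :=
  ∀ (a b : ℂ) (u : σ ⊕ τ → ℂ), φ (fun i => (Sum.elim (fun _ => a) (fun _ => b) i : ℂ) • X i +
    C (u i)) - c a b • f ∈ lowDeg (σ ⊕ τ) ℂ t

theorem lead_evalZ {k e : ℕ} {g : MvPolynomial (σ ⊕ τ) ℤ}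
    (hX : IsWeightedHomogeneous (Sum.elim 1 0) g e)
    (hT : IsWeightedHomogeneous (Sum.elim 0 1) g k) :
    Lead (e + k) (map (Int.castRingHom ℂ) g) (evalZ g) fun a b => a ^ e * b ^ k := by
  intro a b u
  set α : σ ⊕ τ → ℂ := Sum.elim (fun _ => a) (fun _ => b) with hα
  have hmap : map (Int.castRingHom ℂ) g = evalZ g X := by
    have := map_evalZ (map (Int.castRingHom ℂ)) g (X : σ ⊕ τ → MvPolynomial (σ ⊕ τ) ℤ)
    rw [evalZ_X] at this
    simpa using this
  rw [hmap, evalZ, evalZ, eval₂_eq, eval₂_eq, Finset.smul_sum, ← Finset.sum_sub_distrib]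
  refine Submodule.sum_mem _ fun s hs => ?_
  have h1 : ∏ i ∈ s.support, (α i • X i : MvPolynomial (σ ⊕ τ) ℂ) ^ s i =
      (a ^ e * b ^ k) • ∏ i ∈ s.support, X i ^ s i := by
    simp only [smul_pow, Finset.prod_smul]
    congr 1
    have e1 := hX (mem_support_iff.1 hs)
    have e2 := hT (mem_support_iff.1 hs)
    rw [Finsupp.weight_apply, Finsupp.sum] at e1 e2
    rw [← e1, ← e2, ← Finset.prod_pow_eq_pow_sum, ← Finset.prod_pow_eq_pow_sum,
      ← Finset.prod_mul_distrib]
    refine Finset.prod_congr rfl fun i _ => ?_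
    rcases i with i | i <;> simp [hα]
  have hdeg : ∑ i ∈ s.support, s i = e + k := by
    have := (hX.add_weight hT) (mem_support_iff.1 hs)
    rw [Finsupp.weight_apply, Finsupp.sum] at this
    rw [← this]
    refine Finset.sum_congr rfl fun i _ => ?_
    rcases i with i | i <;> simp
  have hhom : ∀ i, (α i • X i : MvPolynomial (σ ⊕ τ) ℂ) ∈ lowDeg (σ ⊕ τ) ℂ 2 := fun i =>
    Submodule.smul_mem _ _ (IsHomogeneous.mem_lowDeg (isHomogeneous_X ℂ i))
  have h2 : ∀ i, (α i • X i + C (u i)) ^ s i - (α i • X i : MvPolynomial (σ ⊕ τ) ℂ) ^ s i ∈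
      lowDeg (σ ⊕ τ) ℂ (s i) ∧
      (α i • X i : MvPolynomial (σ ⊕ τ) ℂ) ^ s i ∈ lowDeg (σ ⊕ τ) ℂ (s i + 1) := by
    intro i
    have := prod_sub_prod_mem_lowDeg (Finset.range (s i)) (d := fun _ => 1)
      (p := fun _ => α i • X i + C (u i)) (q := fun _ => (α i • X i : MvPolynomial (σ ⊕ τ) ℂ))
      (fun _ _ => hhom i) (fun _ _ => by
        rw [add_sub_cancel_left]; exact IsHomogeneous.mem_lowDeg (isHomogeneous_C _ (u i)))
    simpa using this
  have h3 := (prod_sub_prod_mem_lowDeg s.support (fun i _ => (h2 i).2) fun i _ => (h2 i).1).1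
  rw [hdeg, h1] at h3
  have h4 := Submodule.smul_mem _ ((coeff s g : ℤ) : ℂ) h3
  convert h4 using 1
  rw [smul_sub, smul_comm]
  simp [smul_eq_C_mul]

theorem Lead.pol_T {t k : ℕ} {f : MvPolynomial (σ ⊕ τ) ℂ}
    {φ : (σ ⊕ τ → MvPolynomial (σ ⊕ τ) ℂ) → MvPolynomial (σ ⊕ τ) ℂ} {c : ℂ → ℂ → ℂ}
    (hφ : Lead t f φ c) (s : Fin k → σ ⊕ τ → ℂ) :
    Lead t f (pol k φ fun i => projT fun j => X j + C (s i j))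
      fun a b => (fwdDiff 1)^[k] (c a) b := by
  induction k generalizing φ c with
  | zero => exact hφ
  | succ k ih =>
    refine ih (c := fun a => fwdDiff 1 (c a)) ?_ (Fin.tail s)
    intro a b u
    have h1 := hφ a (b + 1) (u + projT (s 0))
    have h2 := hφ a b u
    have := Submodule.sub_mem _ h1 h2
    have hv : (fun i => (Sum.elim (fun _ => a) (fun _ => b + 1) i : ℂ) • (X i :
        MvPolynomial (σ ⊕ τ) ℂ) + C ((u + projT (s 0)) i)) =
        (fun i => (Sum.elim (fun _ => a) (fun _ => b) i : ℂ) • (X i :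
        MvPolynomial (σ ⊕ τ) ℂ) + C (u i)) + projT fun j => X j + C (s 0 j) := by
      ext1 (i | i)
      · simp [projT]
      · simp [projT, add_smul]; ring
    rw [hv] at this
    convert this using 1
    simp only [fwdDiff, sub_smul]
    ring

theorem Lead.pol_X {t k : ℕ} {f : MvPolynomial (σ ⊕ τ) ℂ}
    {φ : (σ ⊕ τ → MvPolynomial (σ ⊕ τ) ℂ) → MvPolynomial (σ ⊕ τ) ℂ} {c : ℂ → ℂ → ℂ}
    (hφ : Lead t f φ c) (s : Fin k → σ ⊕ τ → ℂ) :
    Lead t f (pol k φ fun i => projX fun j => X j + C (s i j))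
      fun a b => (fwdDiff 1)^[k] (fun a => c a b) a := by
  induction k generalizing φ c with
  | zero => exact hφ
  | succ k ih =>
    refine ih (c := fun a b => fwdDiff 1 (fun a => c a b) a) ?_ (Fin.tail s)
    intro a b u
    have h1 := hφ (a + 1) b (u + projX (s 0))
    have h2 := hφ a b u
    have := Submodule.sub_mem _ h1 h2
    have hv : (fun i => (Sum.elim (fun _ => a + 1) (fun _ => b) i : ℂ) • (X i :
        MvPolynomial (σ ⊕ τ) ℂ) + C ((u + projX (s 0)) i)) =
        (fun i => (Sum.elim (fun _ => a) (fun _ => b) i : ℂ) • (X i :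
        MvPolynomial (σ ⊕ τ) ℂ) + C (u i)) + projX fun j => X j + C (s 0 j) := by
      ext1 (i | i)
      · simp [projX, add_smul]; ring
      · simp [projX]
    rw [hv] at this
    convert this using 1
    simp only [fwdDiff, sub_smul]
    ring

theorem Gam_leading {k e : ℕ} {g : MvPolynomial (σ ⊕ τ) ℤ}
    (hX : IsWeightedHomogeneous (Sum.elim 1 0) g e)
    (hT : IsWeightedHomogeneous (Sum.elim 0 1) g k) (s : Fin k → σ ⊕ τ → ℂ)
    (S : Fin e → σ ⊕ τ → ℂ) :
    Gam k e g (fun i j => X j + C (s i j)) (fun i j => X j + C (S i j)) -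
      ((e.factorial * k.factorial : ℕ) : ℂ) • map (Int.castRingHom ℂ) g ∈
        lowDeg (σ ⊕ τ) ℂ (e + k) := by
  have := ((lead_evalZ hX hT).pol_T s).pol_X S 0 0 0
  have h1 : ∀ a : ℂ, (fwdDiff 1)^[k] (fun b : ℂ => a ^ e * b ^ k) 0 = k.factorial * a ^ e := by
    intro a
    have h2 := fwdDiff_iter_const_smul (1 : ℂ) (a ^ e) (fun b : ℂ => b ^ k) k
    have h3 : (fun b : ℂ => a ^ e * b ^ k) = (a ^ e) • fun b : ℂ => b ^ k := rfl
    rw [h3, h2, fwdDiff_iter_eq_factorial]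
    simp [mul_comm]
  have h4 : (fwdDiff 1)^[e] (fun a : ℂ => (fwdDiff 1)^[k] (fun b : ℂ => a ^ e * b ^ k) 0) 0 =
      ((e.factorial * k.factorial : ℕ) : ℂ) := by
    simp only [h1]
    have h2 := fwdDiff_iter_const_smul (1 : ℂ) (k.factorial : ℂ) (fun b : ℂ => b ^ e) e
    have h3 : (fun b : ℂ => (k.factorial : ℂ) * b ^ e) = (k.factorial : ℂ) • fun b : ℂ => b ^ e :=
      rfl
    rw [h3, h2, fwdDiff_iter_eq_factorial]
    simp [mul_comm]
  beta_reduce at this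
  rw [h4] at this
  convert this using 2
  rw [Gam]
  congr 1
  ext1 (i | i) <;> simp

end leading

section counting

/-- The integer points of the box `[-P, P]^ι`. -/
def zbox (ι : Type*) [Fintype ι] (P : ℕ) : Finset (ι → ℤ) :=
  Fintype.piFinset fun _ => Finset.Icc (-(P : ℤ)) P

theorem mem_zbox {ι : Type*} [Fintype ι] {P : ℕ} {v : ι → ℤ} :
    v ∈ zbox ι P ↔ ∀ i, |v i| ≤ P := by
  simp [zbox, abs_le]

theorem card_zbox (ι : Type*) [Fintype ι] (P : ℕ) :
    (zbox ι P).card = (2 * P + 1) ^ Fintype.card ι := by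
  simp only [zbox, Fintype.card_piFinset, Int.card_Icc, Finset.prod_const, Finset.card_univ]
  congr 1
  omega

/-- Families of integer points of the box `[-P, P]^ι`. -/
def zboxes (κ ι : Type*) [Fintype κ] [Fintype ι] (P : ℕ) : Finset (κ → ι → ℤ) :=
  Fintype.piFinset fun _ => zbox ι P

theorem mem_zboxes {κ ι : Type*} [Fintype κ] [Fintype ι] {P : ℕ} {v : κ → ι → ℤ} :
    v ∈ zboxes κ ι P ↔ ∀ j i, |v j i| ≤ P := by
  simp [zboxes, mem_zbox]

theorem card_zboxes (κ ι : Type*) [Fintype κ] [Fintype ι] (P : ℕ) :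
    (zboxes κ ι P).card = ((2 * P + 1) ^ Fintype.card ι) ^ Fintype.card κ := by
  simp [zboxes, card_zbox]

theorem card_le_of_sub {X B : Type*} (S Z : Finset X) (sub : X → X → X) (rest : X → B)
    (h : ∀ x ∈ S, ∀ y ∈ S, rest x = rest y → sub x y ∈ Z)
    (hrest : ∀ x y, rest (sub x y) = rest x)
    (hinj : ∀ x x' y, rest x = rest x' → sub x y = sub x' y → x = x') : S.card ≤ Z.card := by
  by_cases hS : S = ∅
  · simp [hS]
  obtain ⟨x₀, -⟩ := Finset.nonempty_iff_ne_empty.2 hS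
  let b : B → X := fun ρ => if h : ∃ y ∈ S, rest y = ρ then h.choose else x₀
  have hb : ∀ x ∈ S, b (rest x) ∈ S ∧ rest (b (rest x)) = rest x := by
    intro x hx
    have hex : ∃ y ∈ S, rest y = rest x := ⟨x, hx, rfl⟩
    simp only [b, dif_pos hex]
    exact hex.choose_spec
  refine Finset.card_le_card_of_injOn (fun x => sub x (b (rest x))) (fun x hx => ?_) ?_
  · exact h x hx _ (hb x hx).1 (hb x hx).2.symm
  · intro x hx x' hx' hxx
    have hr : rest x = rest x' := by
      rw [← hrest x (b (rest x)), ← hrest x' (b (rest x'))]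
      exact congrArg rest hxx
    dsimp only at hxx
    rw [hr] at hxx
    exact hinj x x' _ hr hxx

variable {σ τ κ : Type*}

/-- The polarizations of a family of bihomogeneous polynomials of degrees at most `E` in the
first block, as functions of the same number of points. -/
def GamF {k E : ℕ} {e : κ → ℕ} (he : ∀ j, e j ≤ E) (g : κ → MvPolynomial (σ ⊕ τ) ℤ) {R : Type*}
    [CommRing R] (p : (Fin k → σ ⊕ τ → R) × (Fin E → σ ⊕ τ → R)) (j : κ) : R :=
  Gam k (e j) (g j) p.1 fun i => p.2 (Fin.castLE (he j) i)

variable {k E : ℕ} {e : κ → ℕ} {g : κ → MvPolynomial (σ ⊕ τ) ℤ}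

theorem GamF_map {R S : Type*} [CommRing R] [CommRing S] (φ : R →+* S) (he : ∀ j, e j ≤ E)
    (p : (Fin k → σ ⊕ τ → R) × (Fin E → σ ⊕ τ → R)) (j : κ) :
    GamF he g (fun i l => φ (p.1 i l), fun i l => φ (p.2 i l)) j = φ (GamF he g p j) :=
  Gam_map φ k (e j) (g j) p.1 fun i => p.2 (Fin.castLE (he j) i)

variable [Fintype σ] [Fintype τ] [Fintype κ]

theorem card_GamF_zeros_le (he : ∀ j, e j ≤ E)
    (hX : ∀ j, IsWeightedHomogeneous (Sum.elim 1 0) (g j) (e j))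
    (hT : ∀ j, IsWeightedHomogeneous (Sum.elim 0 1) (g j) k) {Dh Cf : ℕ}
    (hfin : ∀ t, Module.finrank ℂ ((restrictTotalDegree (σ ⊕ τ) ℂ t).map
      (Ideal.Quotient.mkₐ ℂ (Ideal.span (Set.range fun j => map (Int.castRingHom ℂ) (g j)))
        ).toLinearMap) ≤ Cf * (t + 1) ^ Dh) :
    ∃ C : ℕ, ∀ P : ℕ, 1 ≤ P → ∀ (s : Fin k → σ ⊕ τ → ℤ) (S : Fin E → σ ⊕ τ → ℤ)
      (Z : Finset (σ ⊕ τ → ℤ)), (∀ z ∈ Z, ∀ i, |z i| ≤ P) →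
      (∀ z ∈ Z, ∀ j, GamF he g (fun i => z + s i, fun i => z + S i) j = 0) →
      Z.card ≤ C * P ^ Dh := by
  refine ⟨Cf * (2 * Fintype.card (σ ⊕ τ) + 1) ^ Dh, fun P hP s S Z hM hZ => ?_⟩
  have := card_zeros_le (Ideal.Quotient.mkₐ ℂ
      (Ideal.span (Set.range fun j => map (Int.castRingHom ℂ) (g j))))
    (f := fun j => map (Int.castRingHom ℂ) (g j))
    (g := fun j => GamF he g (fun i l => X l + C (s i l : ℂ), fun i l => X l + C (S i l : ℂ)) j)
    (d := fun j => e j + k) (c := fun j => (((e j).factorial * k.factorial : ℕ) : ℂ))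
    (fun j => ?_) (fun j => ?_) (fun j => ?_) (fun p => ?_) P Z hM (fun z hz j => ?_)
  · refine this.trans ((hfin _).trans ?_)
    rw [mul_assoc Cf, ← mul_pow]
    refine Nat.mul_le_mul_left _ (Nat.pow_le_pow_left ?_ _)
    nlinarith
  · have h := (hX j).add_weight (hT j)
    have h1 : (Sum.elim 1 0 : σ ⊕ τ → ℕ) + (Sum.elim 0 1 : σ ⊕ τ → ℕ) = 1 := by
      ext1 (i | i) <;> simp
    rw [h1] at h
    exact IsHomogeneous.map h _
  · exact_mod_cast (Nat.mul_pos (Nat.factorial_pos _) (Nat.factorial_pos _)).ne'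
  · exact Gam_leading (hX j) (hT j) _ _
  · exact Ideal.Quotient.eq_zero_iff_mem
  · have h1 := GamF_map (aeval (fun i => ((z i : ℤ) : ℂ)) : MvPolynomial (σ ⊕ τ) ℂ →ₐ[ℂ] ℂ).toRingHom
      he (g := g) (fun i l => X l + C (s i l : ℂ), fun i l => X l + C (S i l : ℂ)) j
    have h2 := GamF_map (Int.castRingHom ℂ) he (g := g) (fun i => z + s i, fun i => z + S i) j
    rw [hZ z hz j, map_zero] at h2
    rw [← h2]
    refine h1.symm.trans ?_
    simp

/-- The pairs of families in the box at which all the polarizations vanish. -/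
def GamZeros (k : ℕ) (he : ∀ j, e j ≤ E) (g : κ → MvPolynomial (σ ⊕ τ) ℤ) (P : ℕ) :
    Finset ((Fin k → σ ⊕ τ → ℤ) × (Fin E → σ ⊕ τ → ℤ)) :=
  (zboxes (Fin k) (σ ⊕ τ) P ×ˢ zboxes (Fin E) (σ ⊕ τ) P).filter fun p => ∀ j, GamF he g p j = 0

theorem card_GamZeros_le {he : ∀ j, e j ≤ E + 1} {Dh C : ℕ}
    (hC : ∀ P : ℕ, 1 ≤ P → ∀ (s : Fin k → σ ⊕ τ → ℤ) (S : Fin (E + 1) → σ ⊕ τ → ℤ)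
      (Z : Finset (σ ⊕ τ → ℤ)), (∀ z ∈ Z, ∀ i, |z i| ≤ P) →
      (∀ z ∈ Z, ∀ j, GamF he g (fun i => z + s i, fun i => z + S i) j = 0) →
      Z.card ≤ C * P ^ Dh) {P : ℕ} (hP : 1 ≤ P) :
    (GamZeros k he g P).card ≤ C * P ^ Dh * (5 * P) ^ (Fintype.card (σ ⊕ τ) * (k + E)) := by
  let f : (Fin k → σ ⊕ τ → ℤ) × (Fin (E + 1) → σ ⊕ τ → ℤ) →
    (Fin k → σ ⊕ τ → ℤ) × (Fin E → σ ⊕ τ → ℤ) := fun p =>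
      (fun i => p.1 i - p.2 0, fun i => p.2 i.succ - p.2 0)
  refine (Finset.card_le_mul_card_image (f := f) _ (C * P ^ Dh) ?_).trans
    (Nat.mul_le_mul_left _ ?_)
  · intro q hq
    have hmem : ∀ p ∈ (GamZeros k he g P).filter fun p => f p = q, 
        (fun i => p.2 0 + q.1 i, fun i => p.2 0 + (Fin.cons 0 q.2 : Fin (E + 1) → σ ⊕ τ → ℤ) i) = p := by
      intro p hp
      obtain rfl := (Finset.mem_filter.1 hp).2
      refine Prod.ext ?_ ?_
      · ext1 i; simp [f]
      · ext1 i
        refine Fin.cases ?_ (fun i => ?_) i <;> simp [f]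
    have hinj : Set.InjOn (fun p : (Fin k → σ ⊕ τ → ℤ) × (Fin (E + 1) → σ ⊕ τ → ℤ) => p.2 0)
        ((GamZeros k he g P).filter fun p => f p = q : Finset _) := by
      intro p hp p' hp' hpp
      dsimp only at hpp
      rw [← hmem p hp, ← hmem p' hp', hpp]
    rw [← Finset.card_image_of_injOn hinj]
    refine hC P hP q.1 (Fin.cons 0 q.2) _ (fun z hz i => ?_) (fun z hz j => ?_)
    · obtain ⟨p, hp, rfl⟩ := Finset.mem_image.1 hz
      have h1 := (Finset.mem_filter.1 (Finset.mem_filter.1 hp).1).1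
      exact mem_zboxes.1 (Finset.mem_product.1 h1).2 0 i
    · obtain ⟨p, hp, rfl⟩ := Finset.mem_image.1 hz
      rw [hmem p hp]
      exact (Finset.mem_filter.1 (Finset.mem_filter.1 hp).1).2 j
  · have hsub : (GamZeros k he g P).image f ⊆
        zboxes (Fin k) (σ ⊕ τ) (2 * P) ×ˢ zboxes (Fin E) (σ ⊕ τ) (2 * P) := by
      intro q hq
      obtain ⟨p, hp, rfl⟩ := Finset.mem_image.1 hq
      have h1 := (Finset.mem_filter.1 hp).1
      have h2 := mem_zboxes.1 (Finset.mem_product.1 h1).1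
      have h3 := mem_zboxes.1 (Finset.mem_product.1 h1).2
      refine Finset.mem_product.2 ⟨mem_zboxes.2 fun i l => ?_, mem_zboxes.2 fun i l => ?_⟩
      · have := h2 i l; have := h3 0 l
        simp only [f, Pi.sub_apply, abs_le] at *
        push_cast; constructor <;> linarith
      · have := h3 i.succ l; have := h3 0 l
        simp only [f, Pi.sub_apply, abs_le] at *
        push_cast; constructor <;> linarith
    refine (Finset.card_le_card hsub).trans ?_
    rw [Finset.card_product, card_zboxes, card_zboxes, Fintype.card_fin, Fintype.card_fin,
      ← pow_mul, ← pow_mul, ← pow_add, ← mul_add]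
    exact Nat.pow_le_pow_left (by omega) _

theorem card_cell_le {he : ∀ j, e j ≤ E + 1} 
    (hX : ∀ j, IsWeightedHomogeneous (Sum.elim 1 0) (g j) (e j))
    (hT : ∀ j, IsWeightedHomogeneous (Sum.elim 0 1) (g j) k)
    (h0 : k = 0 → ∀ j, e j = 0 → g j = 0) (θ : κ → ℝ) (hθ : ∀ j, 1 ≤ |θ j|) (P : ℕ)
    (R : κ → ℤ) :
    ((zboxes (Fin k) (σ ⊕ τ) P ×ˢ zboxes (Fin (E + 1)) (σ ⊕ τ) P).filter fun p =>
      ∀ j, ⌊θ j * (GamF he g p j : ℤ)⌋ = R j).card ≤ (GamZeros k he g (2 * P)).card := by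
  have key : ∀ (j : κ) (a b c : ℤ), c = a - b → ⌊θ j * (a : ℤ)⌋ = R j → ⌊θ j * (b : ℤ)⌋ = R j →
      c = 0 := by
    rintro j a b _ rfl ha hb
    rw [Int.floor_eq_iff] at ha hb
    have h1 : |θ j * (a - b : ℝ)| < 1 := by
      rw [abs_lt]; constructor <;> linarith [ha.1, ha.2, hb.1, hb.2]
    rw [abs_mul] at h1
    have h2 : |((a - b : ℤ) : ℝ)| < 1 := by
      push_cast
      nlinarith [hθ j, abs_nonneg ((a : ℝ) - b)]
    exact Int.abs_lt_one_iff.1 (by exact_mod_cast h2)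
  have hbd : ∀ x y : ℤ, |x| ≤ P → |y| ≤ P → |x - y| ≤ ((2 * P : ℕ) : ℤ) := by
    intro x y hx hy
    rw [abs_le] at *
    push_cast; constructor <;> linarith
  have hbd' : ∀ x : ℤ, |x| ≤ P → |x| ≤ ((2 * P : ℕ) : ℤ) := by
    intro x hx
    push_cast; linarith [abs_nonneg x]
  have hP : ∀ p ∈ (zboxes (Fin k) (σ ⊕ τ) P ×ˢ zboxes (Fin (E + 1)) (σ ⊕ τ) P).filter (fun p =>
      ∀ j, ⌊θ j * (GamF he g p j : ℤ)⌋ = R j), (∀ i l, |p.1 i l| ≤ P) ∧ (∀ i l, |p.2 i l| ≤ P) ∧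
        ∀ j, ⌊θ j * (GamF he g p j : ℤ)⌋ = R j := by
    intro p hp
    obtain ⟨h1, h2⟩ := Finset.mem_filter.1 hp
    exact ⟨mem_zboxes.1 (Finset.mem_product.1 h1).1, mem_zboxes.1 (Finset.mem_product.1 h1).2, h2⟩
  cases k with
  | succ k =>
    refine card_le_of_sub _ _ (fun p q => (Fin.cons (p.1 0 - q.1 0) (Fin.tail p.1), p.2))
      (fun p => (Fin.tail p.1, p.2)) ?_ (fun p q => by simp) ?_
    · intro p hp q hq hpq
      obtain ⟨p1, p2, p3⟩ := hP p hp
      obtain ⟨q1, q2, q3⟩ := hP q hq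
      simp only [Prod.mk.injEq] at hpq
      refine Finset.mem_filter.2 ⟨Finset.mem_product.2 ⟨mem_zboxes.2 fun i l => ?_,
        mem_zboxes.2 fun i l => hbd' _ (p2 i l)⟩, fun j => key j _ _ _ ?_ (p3 j) (q3 j)⟩
      · refine Fin.cases ?_ (fun i => ?_) i
        · exact hbd _ _ (p1 0 l) (q1 0 l)
        · exact hbd' _ (p1 i.succ l)
      · have h1 := Gam_add_left (hT j) (p.1 0 - q.1 0) (q.1 0) (Fin.tail p.1)
          fun i => p.2 (Fin.castLE (he j) i)
        have h2 : GamF he g q j = Gam (k + 1) (e j) (g j)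
            (Fin.cons (q.1 0) (Fin.tail p.1) : Fin (k + 1) → σ ⊕ τ → ℤ)
            fun i => p.2 (Fin.castLE (he j) i) := by
          rw [hpq.1, hpq.2, Fin.cons_self_tail]; rfl
        rw [sub_add_cancel, Fin.cons_self_tail] at h1
        rw [h2]
        exact eq_sub_of_add_eq h1.symm
    · intro p p' q h1 h2
      simp only [Prod.mk.injEq, Fin.cons_inj] at h1 h2
      refine Prod.ext ?_ h2.2
      rw [← Fin.cons_self_tail p.1, ← Fin.cons_self_tail p'.1, sub_left_injective h2.1.1, h1.1]
  | zero =>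
    refine card_le_of_sub _ _ (fun p q => (p.1, Fin.cons (p.2 0 - q.2 0) (Fin.tail p.2)))
      (fun p => Fin.tail p.2) ?_ (fun p q => by simp) ?_
    · intro p hp q hq hpq
      obtain ⟨p1, p2, p3⟩ := hP p hp
      obtain ⟨q1, q2, q3⟩ := hP q hq
      refine Finset.mem_filter.2 ⟨Finset.mem_product.2 ⟨mem_zboxes.2 fun i => i.elim0,
        mem_zboxes.2 fun i l => ?_⟩, fun j => ?_⟩
      · refine Fin.cases ?_ (fun i => ?_) i
        · exact hbd _ _ (p2 0 l) (q2 0 l)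
        · exact hbd' _ (p2 i.succ l)
      · rcases Nat.eq_zero_or_pos (e j) with hej | hej
        · have hg := h0 rfl j hej
          have hz : evalZ (g j) = fun _ : σ ⊕ τ → ℤ => (0 : ℤ) := by ext; simp [hg, evalZ]
          simp only [GamF, Gam, hz]
          exact pol_zero _ _ _
        refine key j _ _ _ ?_ (p3 j) (q3 j)
        obtain ⟨ε, hε⟩ : ∃ ε, e j = ε + 1 := ⟨e j - 1, by omega⟩
        have hj := he j
        have hcast : ∀ w : Fin (E + 1) → σ ⊕ τ → ℤ, ∀ p1 : Fin 0 → σ ⊕ τ → ℤ,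
            GamF he g (p1, w) j = Gam 0 (ε + 1) (g j) p1
              (Fin.cons (w 0) fun i : Fin ε => (Fin.tail w) (Fin.castLE (by omega) i)) := by
          intro w p1
          have : ∀ (e' : ℕ) (h : e' ≤ E + 1), e' = ε + 1 → 
              Gam 0 e' (g j) p1 (fun i => w (Fin.castLE h i)) = Gam 0 (ε + 1) (g j) p1
              (Fin.cons (w 0) fun i : Fin ε => (Fin.tail w) (Fin.castLE (by omega) i)) := by
            rintro _ h rfl
            congr 1
            ext1 i
            refine Fin.cases ?_ (fun i => ?_) i
            · rfl
            · rfl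
          exact this _ _ hε
        have h1 := Gam_add_right (hε ▸ hX j) (p.2 0 - q.2 0) (q.2 0) p.1
          fun i : Fin ε => (Fin.tail p.2) (Fin.castLE (by omega) i)
        have h2 := hcast p.2 p.1
        have h3 := hcast q.2 q.1
        rw [hcast, Fin.cons_zero, Fin.tail_cons]
        rw [sub_add_cancel, ← h2] at h1
        have h4 : q.1 = p.1 := Subsingleton.elim _ _
        have h5 : Fin.tail p.2 = Fin.tail q.2 := hpq
        rw [h5] at h1 ⊢
        rw [h4] at h3
        rw [← h3, ← h4] at h1
        rw [eq_sub_iff_add_eq, ← h4]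
        exact h1.symm
    · intro p p' q h1 h2
      simp only [Prod.mk.injEq, Fin.cons_inj] at h1 h2
      refine Prod.ext h2.1 ?_
      rw [← Fin.cons_self_tail p.2, ← Fin.cons_self_tail p'.2, sub_left_injective h2.2.1, h1]

end counting

section weights

/-- The decaying weight `1 / (1 + |t|)`. -/
def wt (t : ℝ) : ℝ := 1 / (1 + |t|)

theorem wt_pos (t : ℝ) : 0 < wt t := by unfold wt; positivity

theorem wt_le_one (t : ℝ) : wt t ≤ 1 := by
  rw [wt, div_le_one (by positivity)]; linarith [abs_nonneg t]

theorem wt_le_floor (t : ℝ) : wt t ≤ 2 / (1 + |(⌊t⌋ : ℝ)|) := by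
  rw [wt, div_le_div_iff₀ (by positivity) (by positivity)]
  have h : |(⌊t⌋ : ℝ)| ≤ |t| + 1 := by
    have h1 := Int.floor_le t
    have h2 := Int.lt_floor_add_one t
    rw [abs_le]
    constructor
    · linarith [neg_abs_le t]
    · linarith [le_abs_self t]
  linarith [abs_nonneg t]

theorem sum_weights_le (N : ℕ) :
    ∑ R ∈ Finset.Icc (-(N : ℤ)) N, (2 : ℝ) / (1 + |(R : ℝ)|) ≤ 4 * (1 + Real.log (N + 1)) := by
  let A : Finset ℤ := (Finset.range (N + 1)).image fun i : ℕ => (i : ℤ)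
  let B : Finset ℤ := (Finset.range (N + 1)).image fun i : ℕ => -(i : ℤ)
  have hsub : Finset.Icc (-(N : ℤ)) N ⊆ A ∪ B := by
    intro R hR
    rw [Finset.mem_Icc] at hR
    rcases le_total 0 R with h | h
    · exact Finset.mem_union_left _ (Finset.mem_image.2 ⟨R.natAbs, by simp; omega, by omega⟩)
    · exact Finset.mem_union_right _ (Finset.mem_image.2 ⟨R.natAbs, by simp; omega, by omega⟩)
  have hpos : ∀ R : ℤ, 0 ≤ (2 : ℝ) / (1 + |(R : ℝ)|) := fun R => by positivity
  have h1 := Finset.sum_union_inter (s₁ := A) (s₂ := B) (f := fun R : ℤ => (2 : ℝ) / (1 + |(R : ℝ)|))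
  have h2 : 0 ≤ ∑ R ∈ A ∩ B, (2 : ℝ) / (1 + |(R : ℝ)|) := Finset.sum_nonneg fun R _ => hpos R
  have hA : ∑ R ∈ A, (2 : ℝ) / (1 + |(R : ℝ)|) = ∑ i ∈ Finset.range (N + 1), (2 : ℝ) * (i + 1 : ℝ)⁻¹ := by
    rw [Finset.sum_image (by intro a _ b _ h; simpa using h)]
    refine Finset.sum_congr rfl fun i _ => ?_
    rw [div_eq_mul_inv]; congr 2
    simp [add_comm]
  have hB : ∑ R ∈ B, (2 : ℝ) / (1 + |(R : ℝ)|) = ∑ i ∈ Finset.range (N + 1), (2 : ℝ) * (i + 1 : ℝ)⁻¹ := by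
    rw [Finset.sum_image (by intro a _ b _ h; simpa using h)]
    refine Finset.sum_congr rfl fun i _ => ?_
    rw [div_eq_mul_inv]; congr 2
    simp [add_comm]
  have h3 := harmonic_le_one_add_log (N + 1)
  have h4 : ((harmonic (N + 1) : ℚ) : ℝ) = ∑ i ∈ Finset.range (N + 1), (i + 1 : ℝ)⁻¹ := by
    simp [harmonic]
  rw [h4] at h3
  push_cast at h3
  refine (Finset.sum_le_sum_of_subset_of_nonneg hsub fun R _ _ => hpos R).trans ?_
  rw [← Finset.mul_sum] at hA hB
  linarith

variable {σ τ κ : Type*} [Fintype σ] [Fintype τ] [Fintype κ]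
variable {k E : ℕ} {e : κ → ℕ} {g : κ → MvPolynomial (σ ⊕ τ) ℤ}

theorem sum_wt_GamF_le {he : ∀ j, e j ≤ E + 1} 
    (hX : ∀ j, IsWeightedHomogeneous (Sum.elim 1 0) (g j) (e j))
    (hT : ∀ j, IsWeightedHomogeneous (Sum.elim 0 1) (g j) k)
    (h0 : k = 0 → ∀ j, e j = 0 → g j = 0) {θ : κ → ℝ} (hθ : ∀ j, 1 ≤ |θ j|) {P : ℕ} {M : ℕ}
    (hM : ∀ p ∈ zboxes (Fin k) (σ ⊕ τ) P ×ˢ zboxes (Fin (E + 1)) (σ ⊕ τ) P,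
      ∀ j, |θ j * (GamF he g p j : ℤ)| ≤ M) :
    ∑ p ∈ zboxes (Fin k) (σ ⊕ τ) P ×ˢ zboxes (Fin (E + 1)) (σ ⊕ τ) P,
      ∏ j, wt (θ j * (GamF he g p j : ℤ)) ≤
      (GamZeros k he g (2 * P)).card *
        (4 * (1 + Real.log (M + 2))) ^ Fintype.card κ := by
  set Ω := zboxes (Fin k) (σ ⊕ τ) P ×ˢ zboxes (Fin (E + 1)) (σ ⊕ τ) P
  let fl : (Fin k → σ ⊕ τ → ℤ) × (Fin (E + 1) → σ ⊕ τ → ℤ) → κ → ℤ :=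
    fun p j => ⌊θ j * (GamF he g p j : ℤ)⌋
  let W : Finset (κ → ℤ) := Fintype.piFinset fun _ => Finset.Icc (-((M + 1 : ℕ) : ℤ)) (M + 1 : ℕ)
  have hmaps : ∀ p ∈ Ω, fl p ∈ W := by
    intro p hp
    refine Fintype.mem_piFinset.2 fun j => Finset.mem_Icc.2 ?_
    have h := abs_le.1 (hM p hp j)
    constructor
    · refine Int.le_floor.2 ?_
      push_cast; linarith [h.1]
    · refine (Int.floor_le_floor h.2).trans ?_
      simp
  rw [← Finset.sum_fiberwise_of_maps_to hmaps]
  have hcell : ∀ R ∈ W, ∑ p ∈ Ω with fl p = R, ∏ j, wt (θ j * (GamF he g p j : ℤ)) ≤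
      (GamZeros k he g (2 * P)).card * ∏ j, (2 : ℝ) / (1 + |(R j : ℝ)|) := by
    intro R _
    have hc : (Ω.filter fun p => fl p = R).card ≤ (GamZeros k he g (2 * P)).card := by
      have := card_cell_le (he := he) hX hT h0 θ hθ P R
      simpa [Ω, fl, funext_iff] using this
    have hp : 0 ≤ ∏ j, (2 : ℝ) / (1 + |(R j : ℝ)|) := Finset.prod_nonneg fun j _ => by positivity
    calc _ ≤ ∑ p ∈ Ω with fl p = R, ∏ j, (2 : ℝ) / (1 + |(R j : ℝ)|) := by
          refine Finset.sum_le_sum fun p hp => Finset.prod_le_prod (fun j _ => (wt_pos _).le) ?_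
          intro j _
          rw [← (Finset.mem_filter.1 hp).2]
          exact wt_le_floor _
      _ ≤ _ := by
          rw [Finset.sum_const, nsmul_eq_mul]
          exact mul_le_mul_of_nonneg_right (by exact_mod_cast hc) hp
  refine (Finset.sum_le_sum hcell).trans ?_
  rw [← Finset.mul_sum]
  refine mul_le_mul_of_nonneg_left ?_ (Nat.cast_nonneg _)
  have := Finset.prod_univ_sum (fun _ : κ => Finset.Icc (-((M + 1 : ℕ) : ℤ)) (M + 1 : ℕ))
    (fun _ R => (2 : ℝ) / (1 + |(R : ℝ)|))
  rw [← this, Finset.prod_const, Finset.card_univ]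
  refine pow_le_pow_left₀ (Finset.sum_nonneg fun R _ => by positivity) ?_ _
  have h := sum_weights_le (M + 1)
  push_cast at h ⊢
  rw [show (M : ℝ) + 2 = M + 1 + 1 by ring]
  exact h

end weights

section vanDerCorput

/-- The integer points of the box `[0, P]^ι`. -/
def qbox (ι : Type*) [Fintype ι] (P : ℕ) : Finset (ι → ℤ) :=
  Fintype.piFinset fun _ => Finset.Icc (0 : ℤ) P

theorem mem_qbox {ι : Type*} [Fintype ι] {P : ℕ} {v : ι → ℤ} :
    v ∈ qbox ι P ↔ ∀ i, 0 ≤ v i ∧ v i ≤ P := by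
  simp [qbox]

theorem card_qbox (ι : Type*) [Fintype ι] (P : ℕ) :
    (qbox ι P).card = (P + 1) ^ Fintype.card ι := by
  simp only [qbox, Fintype.card_piFinset, Int.card_Icc, Finset.prod_const, Finset.card_univ]
  congr 1

theorem sum_qbox_sub_le {ι : Type*} [Fintype ι] (P : ℕ) (a : (ι → ℤ) → ℝ) (ha : ∀ δ, 0 ≤ a δ) :
    ∑ h ∈ qbox ι P, ∑ h' ∈ qbox ι P, a (h - h') ≤ (P + 1) ^ Fintype.card ι * ∑ δ ∈ zbox ι P, a δ := by
  rw [Finset.sum_comm]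
  have : ∀ h' ∈ qbox ι P, ∑ h ∈ qbox ι P, a (h - h') ≤ ∑ δ ∈ zbox ι P, a δ := by
    intro h' hh'
    rw [← Finset.sum_image (g := fun h => h - h') (f := a) (fun x _ y _ h => sub_left_injective h)]
    refine Finset.sum_le_sum_of_subset_of_nonneg (fun δ hδ => ?_) fun _ _ _ => ha _
    obtain ⟨h, hh, rfl⟩ := Finset.mem_image.1 hδ
    refine mem_zbox.2 fun i => ?_
    have h1 := mem_qbox.1 hh i
    have h2 := mem_qbox.1 hh' i
    rw [Pi.sub_apply, abs_le]
    constructor <;> linarith [h1.1, h1.2, h2.1, h2.2]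
  refine (Finset.sum_le_sum this).trans ?_
  rw [Finset.sum_const, card_qbox, nsmul_eq_mul]
  push_cast
  rfl

/-- The square of the integral of a bounded function over a set of finite measure. -/
theorem sq_setIntegral_norm_le {X : Type*} [MeasurableSpace X] {μ : Measure X} {S : X → ℂ} {K : Set X} (hS : IntegrableOn (fun x => ‖S x‖) K μ)
    (hS2 : IntegrableOn (fun x => ‖S x‖ ^ 2) K μ) (hK : μ K ≠ ⊤) {V : ℝ} (hV : 0 < V)
    (hKV : μ.real K ≤ V) :
    (∫ x in K, ‖S x‖ ∂μ) ^ 2 ≤ V * ∫ x in K, ‖S x‖ ^ 2 ∂μ := by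
  set A := ∫ x in K, ‖S x‖ ∂μ
  have hc : IntegrableOn (fun _ : X => (A / V) ^ 2) K μ := integrableOn_const hK
  have h1 : 0 ≤ ∫ x in K, (‖S x‖ ^ 2 - 2 * (A / V) * ‖S x‖ + (A / V) ^ 2) ∂μ :=
    integral_nonneg fun x => by
      have : ‖S x‖ ^ 2 - 2 * (A / V) * ‖S x‖ + (A / V) ^ 2 = (‖S x‖ - A / V) ^ 2 := by ring
      rw [this]; positivity
  have hs : IntegrableOn (fun x => ‖S x‖ ^ 2 - 2 * (A / V) * ‖S x‖) K μ :=
    hS2.sub (hS.const_mul _)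
  rw [integral_add hs hc, integral_sub hS2 (hS.const_mul _), integral_const_mul, setIntegral_const, smul_eq_mul] at h1
  have h2 : μ.real K * (A / V) ^ 2 ≤ V * (A / V) ^ 2 := by gcongr
  have h3 : V * (A / V) ^ 2 = A ^ 2 / V := by field_simp
  have h4 : 2 * (A / V) * A = 2 * (A ^ 2 / V) := by ring
  have h5 : A ^ 2 / V ≤ ∫ x in K, ‖S x‖ ^ 2 ∂μ := by
    have : 2 * (A / V) * (∫ x in K, ‖S x‖ ∂μ) = 2 * (A ^ 2 / V) := h4
    rw [this] at h1
    linarith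
  rw [div_le_iff₀ hV] at h5
  linarith

variable {X : Type*} [AddCommGroup X] [MeasurableSpace X] [MeasurableAdd X] {μ : Measure X}
  [μ.IsAddLeftInvariant]

theorem norm_integral_sq_le {ι : Type*} [Fintype ι] {f : X → ℂ} (hf : Measurable f)
    (hf1 : ∀ x, ‖f x‖ ≤ 1) {K K₂ : Set X}
    (hfK : ∀ x, x ∉ K → f x = 0) (hfin : μ K₂ ≠ ⊤) {V : ℝ} (hV : 0 < V) (hKV : μ.real K₂ ≤ V)
    (P : ℕ) (τ : (ι → ℤ) →+ X) (hτ : ∀ h, (∀ i, |h i| ≤ (P : ℤ)) → ∀ x, x + τ h ∈ K → x ∈ K₂) :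
    ‖∫ x, f x ∂μ‖ ^ 2 ≤ V * 2 ^ Fintype.card ι *
      Finset.expect (zbox ι P) fun δ => ‖∫ x, f (x + τ δ) * starRingEnd ℂ (f x) ∂μ‖ := by
  set Ω := qbox ι P with hΩ
  have hq : ∀ h ∈ Ω, ∀ i, |h i| ≤ (P : ℤ) := fun h hh i => by
    rw [abs_le]
    have := mem_qbox.1 hh i
    constructor <;> linarith [this.1, this.2]
  have hshm : ∀ h, Measurable fun x => f (x + τ h) := fun h => hf.comp (measurable_add_const _)
  have hsupp : ∀ h ∈ Ω, ∀ x, x ∉ K₂ → f (x + τ h) = 0 := fun h hh x hx =>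
    hfK _ fun hx' => hx (hτ h (hq h hh) x hx')
  have hint : ∀ {u : X → ℂ} {B : ℝ}, Measurable u → (∀ x, ‖u x‖ ≤ B) → (∀ x, x ∉ K₂ → u x = 0) →
      Integrable u μ := by
    intro u B hu hB h0
    have h1 : IntegrableOn u K₂ μ :=
      Measure.integrableOn_of_bounded (M := B) hfin hu.aestronglyMeasurable (ae_of_all _ hB)
    exact (integrableOn_iff_integrable_of_support_subset fun x hx => by
      by_contra h; exact hx (h0 x h)).1 h1
  set S : X → ℂ := fun x => ∑ h ∈ Ω, f (x + τ h) with hSdef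
  have hSm : Measurable S := Finset.measurable_sum _ fun h _ => hshm h
  have hS0 : ∀ x, x ∉ K₂ → S x = 0 := fun x hx => Finset.sum_eq_zero fun h hh => hsupp h hh x hx
  have hSB : ∀ x, ‖S x‖ ≤ Ω.card := fun x => by
    refine (norm_sum_le _ _).trans ((Finset.sum_le_sum fun h _ => hf1 _).trans ?_)
    simp
  have hSint := hint hSm hSB hS0
  have hcardpos : (0 : ℝ) < Ω.card := by
    rw [hΩ, card_qbox]; positivity
  have hS1 : ∫ x, S x ∂μ = Ω.card * ∫ x, f x ∂μ := by
    rw [hSdef, integral_finsetSum _ fun h hh => hint (hshm h) (fun x => hf1 _) (hsupp h hh)]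
    simp only [integral_add_right_eq_self f]
    rw [Finset.sum_const, nsmul_eq_mul]
  have hSS : ∫ x, S x * starRingEnd ℂ (S x) ∂μ =
      ∑ h ∈ Ω, ∑ h' ∈ Ω, ∫ x, f (x + τ (h - h')) * starRingEnd ℂ (f x) ∂μ := by
    have h1 : ∀ h ∈ Ω, ∀ h' ∈ Ω, Integrable (fun x => f (x + τ h) * starRingEnd ℂ (f (x + τ h'))) μ := by
      intro h hh h' _
      refine hint (B := 1) ((hshm h).mul (Complex.continuous_conj.measurable.comp (hshm h'))) (fun x => ?_) fun x hx => ?_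
      · rw [norm_mul, RCLike.norm_conj]
        exact mul_le_one₀ (hf1 _) (norm_nonneg _) (hf1 _)
      · rw [hsupp h hh x hx, zero_mul]
    simp only [hSdef, map_sum, Finset.sum_mul_sum]
    rw [integral_finsetSum _ fun h hh => integrable_finsetSum _ fun h' hh' => h1 h hh h' hh']
    refine Finset.sum_congr rfl fun h hh => ?_
    rw [integral_finsetSum _ fun h' hh' => h1 h hh h' hh']
    refine Finset.sum_congr rfl fun h' _ => ?_
    rw [← integral_add_right_eq_self (fun x => f (x + τ (h - h')) * starRingEnd ℂ (f x)) (τ h')]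
    refine integral_congr_ae (ae_of_all _ fun x => ?_)
    simp only [map_sub, show x + τ h' + (τ h - τ h') = x + τ h by abel]
  have hS2 : ((∫ x in K₂, ‖S x‖ ^ 2 ∂μ : ℝ) : ℂ) = ∫ x, S x * starRingEnd ℂ (S x) ∂μ := by
    rw [setIntegral_eq_integral_of_forall_compl_eq_zero fun x hx => by simp [hS0 x hx]]
    rw [← integral_complex_ofReal]
    refine integral_congr_ae (ae_of_all _ fun x => ?_)
    simp only [Complex.mul_conj, Complex.normSq_eq_norm_sq]
  have hcs := sq_setIntegral_norm_le (μ := μ) (S := S) hSint.norm.integrableOn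
    (Measure.integrableOn_of_bounded (M := (Ω.card : ℝ) ^ 2) hfin
      (hSm.norm.pow_const 2).aestronglyMeasurable (ae_of_all _ fun x => by
        rw [norm_pow, norm_norm]; exact pow_le_pow_left₀ (norm_nonneg _) (hSB x) 2)) hfin hV hKV
  rw [setIntegral_eq_integral_of_forall_compl_eq_zero fun x hx => by simp [hS0 x hx]] at hcs
  have h1 : ‖∫ x, S x ∂μ‖ ^ 2 ≤ (∫ x, ‖S x‖ ∂μ) ^ 2 :=
    pow_le_pow_left₀ (norm_nonneg _) (norm_integral_le_integral_norm _) 2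
  have h2 : ∫ x in K₂, ‖S x‖ ^ 2 ∂μ ≤ (P + 1 : ℝ) ^ Fintype.card ι *
      ∑ δ ∈ zbox ι P, ‖∫ x, f (x + τ δ) * starRingEnd ℂ (f x) ∂μ‖ := by
    refine le_trans ?_ (sum_qbox_sub_le P (fun δ => ‖∫ x, f (x + τ δ) * starRingEnd ℂ (f x) ∂μ‖)
      fun _ => norm_nonneg _)
    have h3 : 0 ≤ ∫ x in K₂, ‖S x‖ ^ 2 ∂μ := integral_nonneg fun x => by positivity
    rw [← Complex.norm_of_nonneg h3, hS2, hSS]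
    refine (norm_sum_le _ _).trans (Finset.sum_le_sum fun h _ => ?_)
    exact norm_sum_le _ _
  rw [hS1, norm_mul, mul_pow] at h1
  have hc : (Ω.card : ℝ) = (P + 1 : ℝ) ^ Fintype.card ι := by rw [hΩ, card_qbox]; push_cast; rfl
  have hz : ((zbox ι P).card : ℝ) ≤ 2 ^ Fintype.card ι * (P + 1 : ℝ) ^ Fintype.card ι := by
    rw [card_zbox, ← mul_pow]
    push_cast
    exact pow_le_pow_left₀ (by positivity) (by linarith) _
  have hz0 : (0 : ℝ) < (zbox ι P).card := by rw [card_zbox]; positivity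
  rw [Finset.expect_eq_sum_div_card]
  set T := ∑ δ ∈ zbox ι P, ‖∫ x, f (x + τ δ) * starRingEnd ℂ (f x) ∂μ‖ with hTT
  have hTT0 : 0 ≤ T := Finset.sum_nonneg fun _ _ => norm_nonneg _
  rw [Complex.norm_natCast, hc] at h1
  set q := (P + 1 : ℝ) ^ Fintype.card ι
  have hq0 : 0 < q := by positivity
  have h4 : q ^ 2 * ‖∫ x, f x ∂μ‖ ^ 2 ≤ V * (q * T) :=
    h1.trans (hcs.trans (mul_le_mul_of_nonneg_left h2 hV.le))
  rw [← mul_div_assoc, le_div_iff₀ hz0]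
  have h5 : q * ‖∫ x, f x ∂μ‖ ^ 2 ≤ V * T := by
    refine le_of_mul_le_mul_left ?_ hq0
    linarith
  nlinarith [sq_nonneg ‖∫ x, f x ∂μ‖, pow_pos (two_pos : (0 : ℝ) < 2) (Fintype.card ι),
    mul_le_mul_of_nonneg_left hz (sq_nonneg ‖∫ x, f x ∂μ‖),
    mul_le_mul_of_nonneg_left h5 (pow_pos (two_pos : (0 : ℝ) < 2) (Fintype.card ι)).le]

end vanDerCorput

section iteratedVanDerCorput

/-- The iterated multiplicative difference of a complex valued function. -/
def mdiff {X : Type*} [Add X] : (e : ℕ) → (X → ℂ) → (Fin e → X) → X → ℂ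
  | 0, f, _ => f
  | e + 1, f, h => mdiff e (fun x => f (x + h 0) * starRingEnd ℂ (f x)) (Fin.tail h)

theorem expect_pow_le {α : Type*} {s : Finset α} (hs : s.Nonempty) {a : α → ℝ}
    (ha : ∀ i ∈ s, 0 ≤ a i) (p : ℕ) :
    (Finset.expect s a) ^ p ≤ Finset.expect s fun i => a i ^ p := by
  have hc : (0 : ℝ) < s.card := by exact_mod_cast hs.card_pos
  have := Real.pow_arith_mean_le_arith_mean_pow s (fun _ => (s.card : ℝ)⁻¹) a
    (fun _ _ => by positivity) (by simp [hc.ne']) ha p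
  rw [← Finset.mul_sum, ← Finset.mul_sum] at this
  rw [Finset.expect_eq_sum_div_card, Finset.expect_eq_sum_div_card, div_eq_inv_mul, div_eq_inv_mul]
  exact this

theorem zbox_nonempty (ι : Type*) [Fintype ι] (P : ℕ) : (zbox ι P).Nonempty :=
  ⟨0, mem_zbox.2 fun i => by simp⟩

theorem zboxes_nonempty (κ ι : Type*) [Fintype κ] [Fintype ι] (P : ℕ) : (zboxes κ ι P).Nonempty :=
  ⟨0, mem_zboxes.2 fun j i => by simp⟩

theorem expect_zboxes_succ {ι : Type*} [Fintype ι] (P e : ℕ) (F : (Fin (e + 1) → ι → ℤ) → ℝ) :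
    Finset.expect (zboxes (Fin (e + 1)) ι P) F = Finset.expect (zbox ι P) fun δ =>
      Finset.expect (zboxes (Fin e) ι P) fun h => F (Fin.cons δ h) := by
  rw [← Finset.expect_product' (zbox ι P) (zboxes (Fin e) ι P) fun δ h => F (Fin.cons δ h)]
  refine Finset.expect_nbij' (fun h => (h 0, Fin.tail h)) (fun p => Fin.cons p.1 p.2) ?_ ?_ ?_ ?_ ?_
  · intro h hh
    rw [mem_zboxes] at hh
    exact Finset.mem_product.2 ⟨mem_zbox.2 fun i => hh 0 i, mem_zboxes.2 fun j i => hh j.succ i⟩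
  · rintro ⟨δ, h⟩ hh
    obtain ⟨h1, h2⟩ := Finset.mem_product.1 hh
    rw [mem_zbox] at h1
    rw [mem_zboxes] at h2
    exact mem_zboxes.2 fun j i => Fin.cases (h1 i) (fun j => h2 j i) j
  · intro h _; simp
  · intro h _; simp
  · intro h _; simp

variable {X : Type*} [AddCommGroup X] [MeasurableSpace X] [MeasurableAdd X] {μ : Measure X}
  [μ.IsAddLeftInvariant]

theorem norm_integral_pow_le {ι : Type*} [Fintype ι] {K K₂ : Set X}
    (hfin : μ K₂ ≠ ⊤) {V : ℝ} (hV : 1 ≤ V) (hKV : μ.real K₂ ≤ V)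
    (P : ℕ) (τ : (ι → ℤ) →+ X) (hτ : ∀ h, (∀ i, |h i| ≤ (P : ℤ)) → ∀ x, x + τ h ∈ K → x ∈ K₂)
    (e : ℕ) {f : X → ℂ} (hf : Measurable f) (hf1 : ∀ x, ‖f x‖ ≤ 1) (hfK : ∀ x, x ∉ K → f x = 0) :
    ‖∫ x, f x ∂μ‖ ^ 2 ^ e ≤ (V * 2 ^ Fintype.card ι) ^ 2 ^ e *
      Finset.expect (zboxes (Fin e) ι P) fun h => ‖∫ x, mdiff e f (fun i => τ (h i)) x ∂μ‖ := by
  set C := V * 2 ^ Fintype.card ι with hC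
  have hC1 : 1 ≤ C := one_le_mul_of_one_le_of_one_le hV (one_le_pow₀ one_le_two)
  induction e generalizing f with
  | zero =>
    have : ∀ h : Fin 0 → ι → ℤ, ‖∫ x, mdiff 0 f (fun i => τ (h i)) x ∂μ‖ = ‖∫ x, f x ∂μ‖ :=
      fun _ => rfl
    simp only [this, pow_zero, pow_one]
    rw [Finset.expect_const (zboxes_nonempty _ _ _)]
    nlinarith [norm_nonneg (∫ x, f x ∂μ)]
  | succ e ih =>
    have h1 := norm_integral_sq_le hf hf1 hfK hfin (by linarith) hKV P τ hτ
    rw [← hC] at h1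
    set D : (ι → ℤ) → X → ℂ := fun δ x => f (x + τ δ) * starRingEnd ℂ (f x) with hD
    have hDm : ∀ δ, Measurable (D δ) := fun δ =>
      (hf.comp (measurable_add_const _)).mul (Complex.continuous_conj.measurable.comp hf)
    have hD1 : ∀ δ x, ‖D δ x‖ ≤ 1 := fun δ x => by
      rw [norm_mul, RCLike.norm_conj]
      exact mul_le_one₀ (hf1 _) (norm_nonneg _) (hf1 _)
    have hDK : ∀ δ x, x ∉ K → D δ x = 0 := fun δ x hx => by simp [hD, hfK x hx]
    calc ‖∫ x, f x ∂μ‖ ^ 2 ^ (e + 1) = (‖∫ x, f x ∂μ‖ ^ 2) ^ 2 ^ e := by rw [← pow_mul, pow_succ']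
      _ ≤ (C * Finset.expect (zbox ι P) fun δ => ‖∫ x, D δ x ∂μ‖) ^ 2 ^ e :=
          pow_le_pow_left₀ (by positivity) h1 _
      _ ≤ C ^ 2 ^ e * Finset.expect (zbox ι P) fun δ => ‖∫ x, D δ x ∂μ‖ ^ 2 ^ e := by
          rw [mul_pow]
          exact mul_le_mul_of_nonneg_left (expect_pow_le (zbox_nonempty _ _)
            (fun _ _ => norm_nonneg _) _) (by positivity)
      _ ≤ C ^ 2 ^ e * Finset.expect (zbox ι P) fun δ => C ^ 2 ^ e *
          Finset.expect (zboxes (Fin e) ι P) fun h =>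
            ‖∫ x, mdiff e (D δ) (fun i => τ (h i)) x ∂μ‖ := by
          refine mul_le_mul_of_nonneg_left (Finset.expect_le_expect fun δ _ => ?_) (by positivity)
          exact ih (hDm δ) (hD1 δ) (hDK δ)
      _ = _ := by
          rw [expect_zboxes_succ, ← Finset.mul_expect, ← mul_assoc, ← pow_add, ← two_mul, ← pow_succ']
          rfl

end iteratedVanDerCorput

section liftedCount

/-- The degrees in `(x, a)` of the lifted partial derivatives. -/
def degLift (n m r E : ℕ) : IdxT n m r → ℕ := Sum.elim (fun _ => E) (fun _ => E + 1)

theorem degLift_le (E : ℕ) (j : IdxT n m r) : degLift n m r E j ≤ E + 1 := by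
  rcases j with j | j <;> simp [degLift]

theorem map_liftDeriv (F : MvPolynomial (Idx n m r) ℤ) (j : IdxT n m r) :
    map (Int.castRingHom ℂ) (liftDeriv F j) = aeval (R := ℂ) (liftPt X) (pderivC F (.inr j)) := by
  have h1 : map (Int.castRingHom ℂ) (liftDeriv F j) = evalZ (liftDeriv F j) X := by
    conv_lhs => rw [← evalZ_X (liftDeriv F j)]
    rw [map_evalZ (map (Int.castRingHom ℂ))]
    simp only [map_X]
  have h2 : aeval (R := ℂ) (liftPt (X : IdxL n m r → MvPolynomial (IdxL n m r) ℂ))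
      (pderivC F (.inr j)) = evalZ (pderiv (.inr j) F) (liftPt X) := by
    rw [pderivC, aeval_def, eval₂_map, evalZ]
    congr 1
  rw [h1, h2, evalZ_liftDeriv]

theorem Bihomogeneous.liftDeriv_eq_zero {F : MvPolynomial (Idx n m r) ℤ}
    (hF : Bihomogeneous F 1 1) {D : ℕ} (hD : dimV2 F = ((D : ℕ∞) : WithBot ℕ∞))
    (j : Fin (m - r)) : liftDeriv F (.inl j) = 0 := by
  have hl : IsWeightedHomogeneous (Sum.elim 1 (Sum.elim 1 0)) (pderiv (.inr (.inl j)) F) 0 :=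
    hF.isWeightedHomogeneous_left.pderiv rfl
  have hr : IsWeightedHomogeneous (Sum.elim 0 (Sum.elim 1 1)) (pderiv (.inr (.inl j)) F) 0 :=
    hF.isWeightedHomogeneous_right.pderiv rfl
  have hw := hl.add_weight hr
  have hc : pderiv (.inr (.inl j)) F = C (coeff 0 (pderiv (.inr (.inl j)) F)) := by
    ext s
    rw [coeff_C]
    split_ifs with hs
    · rw [← hs]
    · by_contra hne
      have h := hw hne
      apply hs
      symm
      rw [Finsupp.weight_apply, Finsupp.sum, add_zero, Finset.sum_eq_zero_iff] at h
      ext i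
      by_contra hi
      have h2 := h i (Finsupp.mem_support_iff.2 hi)
      rcases i with i | i | i <;> simp at h2 <;> exact hi h2
  rw [liftDeriv]
  rw [hc]
  generalize coeff 0 (pderiv (.inr (.inl j)) F) = c at *
  by_cases h0 : c = 0
  · simp [h0]
  exfalso
  have hmem : (C (c : ℂ) : MvPolynomial (Idx n m r) ℂ) ∈ idealV2 F := by
    rw [idealV2_eq]
    refine Ideal.subset_span ⟨.inl j, ?_⟩
    simp only [pderivC, hc, map_C]
    simp
  have htop : idealV2 F = ⊤ := by
    refine Ideal.eq_top_of_isUnit_mem _ hmem ?_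
    exact (IsUnit.mk0 (c : ℂ) (by exact_mod_cast h0)).map C
  rw [dimV2, htop] at hD
  have : Subsingleton (MvPolynomial (Idx n m r) ℂ ⧸ (⊤ : Ideal (MvPolynomial (Idx n m r) ℂ))) :=
    Ideal.Quotient.subsingleton_iff.2 rfl
  rw [ringKrullDim_eq_bot_of_subsingleton] at hD
  exact absurd hD (by simp)

theorem sum_wt_liftDeriv_le {F : MvPolynomial (Idx n m r) ℤ} {E k : ℕ}
    (hF : Bihomogeneous F (E + 1) (k + 1)) {D : ℕ} (hD : dimV2 F = ((D : ℕ∞) : WithBot ℕ∞)) :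
    ∃ C : ℝ, 0 ≤ C ∧ ∀ (θ : IdxT n m r → ℝ), (∀ j, 1 ≤ |θ j|) → ∀ P M : ℕ, 1 ≤ P →
      (∀ p ∈ zboxes (Fin k) (IdxL n m r) P ×ˢ zboxes (Fin (E + 1)) (IdxL n m r) P,
        ∀ j, |θ j * (GamF (degLift_le E) (liftDeriv F) p j : ℤ)| ≤ M) →
      ∑ p ∈ zboxes (Fin k) (IdxL n m r) P ×ˢ zboxes (Fin (E + 1)) (IdxL n m r) P,
        ∏ j, wt (θ j * (GamF (degLift_le E) (liftDeriv F) p j : ℤ)) ≤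
      C * (P : ℝ) ^ (D + (m - r) + Fintype.card (IdxL n m r) * (k + E)) *
        (4 * (1 + Real.log (M + 2))) ^ Fintype.card (IdxT n m r) := by
  obtain ⟨Cf, hCf⟩ := finrank_map_lift_le (fun j : IdxT n m r => pderivC F (.inr j)) D
    (by rw [← idealV2_eq]; exact hD)
  have hX : ∀ j, IsWeightedHomogeneous (Sum.elim 1 0) (liftDeriv F j) (degLift n m r E j) :=
    hF.liftDeriv_left
  have hT : ∀ j, IsWeightedHomogeneous (Sum.elim 0 1) (liftDeriv F j) k := hF.liftDeriv_right
  obtain ⟨C, hC⟩ := card_GamF_zeros_le (degLift_le E) hX hT (Dh := D + (m - r)) (Cf := Cf) (by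
    have hfun : (fun j => map (Int.castRingHom ℂ) (liftDeriv F j)) = fun j : IdxT n m r =>
      aeval (R := ℂ) (liftPt X) (pderivC F (.inr j)) := funext (map_liftDeriv F)
    rw [hfun]
    exact hCf)
  refine ⟨C * 2 ^ (D + (m - r)) * 10 ^ (Fintype.card (IdxL n m r) * (k + E)), by positivity,
    fun θ hθ P M hP hM => ?_⟩
  refine (sum_wt_GamF_le hX hT ?_ hθ hM).trans ?_
  · rintro rfl (j | j) h
    · change E = 0 at h
      subst h
      exact hF.liftDeriv_eq_zero hD j
    · exact absurd h (by simp [degLift])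
  · refine mul_le_mul_of_nonneg_right ?_ (pow_nonneg (mul_nonneg (by norm_num)
      (add_nonneg zero_le_one (Real.log_nonneg (by linarith [(Nat.cast_nonneg M : (0:ℝ) ≤ M)])))) _)
    have h := card_GamZeros_le hC (P := 2 * P) (by omega)
    have h2 : ((GamZeros k (degLift_le E) (liftDeriv F) (2 * P)).card : ℝ) ≤
        C * (2 * P) ^ (D + (m - r)) * (5 * (2 * P)) ^ (Fintype.card (IdxL n m r) * (k + E)) := by
      exact_mod_cast h
    refine h2.trans (le_of_eq ?_)
    rw [pow_add, show (5 * (2 * (P : ℝ))) = 10 * P by ring, mul_pow, mul_pow]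
    ring

end liftedCount

section phase

theorem eexp_zero : eexp 0 = 1 := by simp [eexp]

theorem eexp_add (a b : ℝ) : eexp (a + b) = eexp a * eexp b := by
  rw [eexp, eexp, eexp, ← Complex.exp_add]
  push_cast
  ring_nf

theorem eexp_eq (t : ℝ) : eexp t = Complex.exp ((2 * Real.pi * t : ℝ) * Complex.I) := by
  rw [eexp]
  push_cast
  ring_nf

theorem norm_eexp (t : ℝ) : ‖eexp t‖ = 1 := by
  rw [eexp_eq, Complex.norm_exp_ofReal_mul_I]

theorem conj_eexp (t : ℝ) : starRingEnd ℂ (eexp t) = eexp (-t) := by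
  rw [eexp, eexp, ← Complex.exp_conj]
  simp [Complex.conj_ofNat]

theorem continuous_eexp : Continuous eexp := by
  unfold eexp
  fun_prop

theorem eexp_sum {κ : Type*} (s : Finset κ) (f : κ → ℝ) :
    eexp (∑ j ∈ s, f j) = ∏ j ∈ s, eexp (f j) := by
  induction s using Finset.induction_on with
  | empty => simp [eexp_zero]
  | insert a s ha ih => rw [Finset.sum_insert ha, Finset.prod_insert ha, eexp_add, ih]

theorem norm_integral_eexp_le (s : ℝ) {a b : ℝ} (hab : b ≤ a + 2) :
    ‖∫ t in Set.Icc a b, eexp (s * t)‖ ≤ 3 * wt s := by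
  rcases lt_or_ge b a with h | h
  · rw [Set.Icc_eq_empty (not_le.2 h)]
    simpa using (wt_pos s).le
  rw [integral_Icc_eq_integral_Ioc, ← intervalIntegral.integral_of_le h]
  rcases le_or_gt |s| (1 / 2) with hs | hs
  · have h1 := intervalIntegral.norm_integral_le_of_norm_le_const (a := a) (b := b) (C := 1)
      (f := fun t => eexp (s * t)) fun t _ => (norm_eexp _).le
    rw [one_mul, abs_of_nonneg (by linarith)] at h1
    refine h1.trans ?_
    rw [wt, mul_one_div, le_div_iff₀ (by positivity)]
    nlinarith [abs_nonneg s]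
  · have hs0 : s ≠ 0 := by rintro rfl; norm_num at hs
    have hc : (2 * Real.pi * Complex.I * s : ℂ) ≠ 0 := by
      simp [Real.pi_ne_zero, hs0]
    have he : (fun t : ℝ => eexp (s * t)) = fun t : ℝ =>
        Complex.exp ((2 * Real.pi * Complex.I * s : ℂ) * t) := by
      ext t
      rw [eexp]
      push_cast
      ring_nf
    rw [he, integral_exp_mul_complex hc, norm_div]
    have hn : ‖(2 * Real.pi * Complex.I * s : ℂ)‖ = 2 * Real.pi * |s| := by
      simp [abs_of_pos Real.pi_pos]
    have h2 : ∀ t : ℝ, ‖Complex.exp ((2 * Real.pi * Complex.I * s : ℂ) * t)‖ = 1 := fun t => by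
      have := congrFun he t
      rw [← this, norm_eexp]
    rw [hn]
    calc _ ≤ (1 + 1 : ℝ) / (2 * Real.pi * |s|) := by
          gcongr
          refine (norm_sub_le _ _).trans (le_of_eq ?_)
          rw [h2, h2]
      _ ≤ 3 * wt s := by
          rw [wt, mul_one_div, div_le_div_iff₀ (by positivity) (by positivity)]
          nlinarith [Real.pi_gt_three, abs_nonneg s]

theorem norm_integral_Icc_eexp_le {κ : Type*} [Fintype κ] (c : ℝ) (s : κ → ℝ) {a b : κ → ℝ}
    (hab : ∀ j, b j ≤ a j + 2) :
    ‖∫ t in Set.Icc a b, eexp (c + ∑ j, s j * t j)‖ ≤ ∏ j, (3 * wt (s j)) := by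
  have h : ∀ t : κ → ℝ, (Set.Icc a b).indicator (fun t => eexp (c + ∑ j, s j * t j)) t =
      eexp c * ∏ j, (Set.Icc (a j) (b j)).indicator (fun t => eexp (s j * t)) (t j) := by
    intro t
    by_cases ht : t ∈ Set.Icc a b
    · rw [Set.indicator_of_mem ht, eexp_add, eexp_sum]
      congr 1
      refine Finset.prod_congr rfl fun j _ => ?_
      rw [Set.indicator_of_mem (show t j ∈ Set.Icc (a j) (b j) from ⟨ht.1 j, ht.2 j⟩)]
    · rw [Set.indicator_of_notMem ht]
      obtain ⟨j, hj⟩ : ∃ j, t j ∉ Set.Icc (a j) (b j) := by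
        by_contra! hcon
        exact ht ⟨fun j => (hcon j).1, fun j => (hcon j).2⟩
      rw [Finset.prod_eq_zero (Finset.mem_univ j) (Set.indicator_of_notMem hj _), mul_zero]
  rw [← integral_indicator measurableSet_Icc]
  simp_rw [h]
  rw [integral_const_mul, norm_mul, norm_eexp, one_mul]
  rw [integral_fintype_prod_volume_eq_prod
    (f := fun j => (Set.Icc (a j) (b j)).indicator fun t => eexp (s j * t)), norm_prod]
  refine Finset.prod_le_prod (fun _ _ => norm_nonneg _) fun j _ => ?_
  rw [integral_indicator measurableSet_Icc]
  exact norm_integral_eexp_le (s j) (hab j)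

theorem mdiff_indicator_eexp {κ : Type*} (k : ℕ) (ψ : (κ → ℝ) → ℝ) (h : Fin k → κ → ℝ)
    (a b : κ → ℝ) : ∃ a' b' : κ → ℝ, a ≤ a' ∧ b' ≤ b ∧
      mdiff k ((Set.Icc a b).indicator fun t => eexp (ψ t)) h =
        (Set.Icc a' b').indicator fun t => eexp (pol k ψ h t) := by
  induction k generalizing ψ a b with
  | zero => exact ⟨a, b, le_rfl, le_rfl, rfl⟩
  | succ k ih =>
    obtain ⟨a', b', ha, hb, h'⟩ := ih (fun t => ψ (t + h 0) - ψ t) (Fin.tail h)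
      ((a - h 0) ⊔ a) ((b - h 0) ⊓ b)
    refine ⟨a', b', le_sup_right.trans ha, hb.trans inf_le_right, ?_⟩
    rw [mdiff, pol, ← h', ← Set.Icc_inter_Icc]
    congr 1
    ext t
    have hiff : t + h 0 ∈ Set.Icc a b ↔ t ∈ Set.Icc (a - h 0) (b - h 0) := by
      rw [Set.mem_Icc, Set.mem_Icc, sub_le_iff_le_add, le_sub_iff_add_le]
    by_cases h1 : t ∈ Set.Icc (a - h 0) (b - h 0)
    · by_cases h2 : t ∈ Set.Icc a b
      · rw [Set.indicator_of_mem (hiff.2 h1), Set.indicator_of_mem h2,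
          Set.indicator_of_mem (Set.mem_inter h1 h2), conj_eexp, ← eexp_add, sub_eq_add_neg]
      · have h3 : t ∉ Set.Icc (a - h 0) (b - h 0) ∩ Set.Icc a b := fun h => h2 h.2
        rw [Set.indicator_of_notMem h2, Set.indicator_of_notMem h3, map_zero, mul_zero]
    · have h3 : t ∉ Set.Icc (a - h 0) (b - h 0) ∩ Set.Icc a b := fun h => h1 h.1
      rw [Set.indicator_of_notMem (mt hiff.1 h1), Set.indicator_of_notMem h3, zero_mul]

theorem mdiff_comp {X Y : Type*} [Add X] [Add Y] (f : X → ℂ) (φ L : Y → X)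
    (hφ : ∀ x h, φ (x + h) = φ x + L h) (k : ℕ) (h : Fin k → Y) (x : Y) :
    mdiff k (fun x => f (φ x)) h x = mdiff k f (fun i => L (h i)) (φ x) := by
  induction k generalizing f with
  | zero => rfl
  | succ k ih =>
    simp only [mdiff, hφ]
    exact ih (fun x => f (x + L (h 0)) * starRingEnd ℂ (f x)) (Fin.tail h)

theorem hasDerivAt_evalZ {σ : Type*} [DecidableEq σ] (p : MvPolynomial σ ℤ) (v : σ → ℝ) (i : σ) :
    HasDerivAt (fun u : ℝ => evalZ p (v + u • Pi.single i 1)) (evalZ (pderiv i p) v) 0 := by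
  induction p using MvPolynomial.induction_on with
  | C a =>
    have h1 : ∀ w : σ → ℝ, evalZ (C a) w = a := fun w => eval₂_C _ _ _
    have h2 : evalZ (pderiv i (C a)) v = 0 := by rw [pderiv_C]; exact eval₂_zero _ _
    simp only [h1, h2]
    exact hasDerivAt_const (0 : ℝ) (a : ℝ)
  | add p q hp hq =>
    have h1 : ∀ (p q : MvPolynomial σ ℤ) (w : σ → ℝ), evalZ (p + q) w = evalZ p w + evalZ q w :=
      fun p q w => eval₂_add _ _
    simp only [map_add, h1]
    exact hp.add hq
  | mul_X p j hp =>
    have hX : HasDerivAt (fun u : ℝ => (v + u • Pi.single i 1 : σ → ℝ) j)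
        ((Pi.single i 1 : σ → ℝ) j) 0 := by
      simpa using ((hasDerivAt_id (0 : ℝ)).mul_const ((Pi.single i 1 : σ → ℝ) j)).const_add (v j)
    have h := hp.mul hX
    have e1 : ∀ w : σ → ℝ, evalZ (p * X j) w = evalZ p w * w j := fun w => by simp [evalZ]
    have e2 : evalZ (pderiv i (p * X j)) v =
        evalZ (pderiv i p) v * v j + evalZ p v * (Pi.single i 1 : σ → ℝ) j := by
      rw [pderiv_mul, pderiv_X]
      by_cases hij : i = j
      · subst hij; simp [evalZ]
      · simp [evalZ, Ne.symm hij]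
    simp only [e1, e2]
    have h3 : v = v + (0 : ℝ) • Pi.single i 1 := by simp
    rw [← h3] at h
    exact h

theorem hasDerivAt_pol {A : Type*} [AddCommGroup A] [Module ℝ A] {f f' : A → ℝ} {w : A}
    (hf : ∀ t, HasDerivAt (fun u : ℝ => f (t + u • w)) (f' t) 0) (k : ℕ) (h : Fin k → A) (t : A) :
    HasDerivAt (fun u : ℝ => pol k f h (t + u • w)) (pol k f' h t) 0 := by
  induction k generalizing f f' with
  | zero => exact hf t
  | succ k ih =>
    refine ih (f := fun x => f (x + h 0) - f x) (f' := fun x => f' (x + h 0) - f' x) (fun t => ?_) _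
    have := (hf (t + h 0)).sub (hf t)
    refine this.congr_of_eventuallyEq (Filter.Eventually.of_forall fun u => ?_)
    simp only [Pi.sub_apply, add_right_comm]

theorem affine_of_degLT {τ : Type*} [Fintype τ] [DecidableEq τ] {A : (τ → ℝ) → ℝ}
    (hA : DegLT ⊤ 2 A) (hc : Continuous A) {s : τ → ℝ}
    (hs : ∀ j, HasDerivAt (fun u : ℝ => A (0 + u • Pi.single j 1)) (s j) 0) (t : τ → ℝ) :
    A t = A 0 + ∑ j, s j * t j := by
  let B : (τ → ℝ) →+ ℝ :=
    { toFun := fun t => A t - A 0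
      map_zero' := sub_self _
      map_add' := fun u v => by
        have := hA v trivial u trivial 0
        simp only [zero_add] at this
        linarith }
  let L := B.toRealLinearMap (hc.sub continuous_const)
  have hL : ∀ t, A t = A 0 + L t := fun t => by
    change A t = A 0 + (A t - A 0)
    ring
  have hsj : ∀ j, s j = L (Pi.single j 1) := fun j => by
    refine (hs j).unique ?_
    refine HasDerivAt.congr_of_eventuallyEq (f := fun u : ℝ => A 0 + u * L (Pi.single j 1)) ?_
      (Filter.Eventually.of_forall fun u => ?_)
    · simpa using ((hasDerivAt_id (0 : ℝ)).mul_const (L (Pi.single j 1))).const_add (A 0)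
    · beta_reduce
      rw [hL (0 + u • Pi.single j 1), zero_add, map_smul, smul_eq_mul]
  rw [hL t]
  congr 1
  have ht : t = ∑ j, t j • (Pi.single j 1 : τ → ℝ) := by
    ext i; simp [Finset.sum_apply, Pi.single_apply]
  conv_lhs => rw [ht, map_sum]
  refine Finset.sum_congr rfl fun j _ => ?_
  rw [map_smul, hsj, smul_eq_mul, mul_comm]

end phase

section fibreStep

/-- The real points `(x, a)`. -/
abbrev PtX (m r : ℕ) := (Fin (r + 1) → ℝ) × (Fin (m - r) → ℝ)

/-- The point `(x, a, 0, 0)`. -/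
def basePt (n : ℕ) (q : PtX m r) : IdxL n m r → ℝ := Sum.elim (Sum.elim q.1 q.2) 0

/-- The increment of `(y, z)` in which the coordinates of `y` are scaled by `a`. -/
def scaleT (a : Fin (m - r) → ℝ) (v : IdxT n m r → ℝ) : IdxT n m r → ℝ :=
  Sum.elim (fun l => a l * v (.inl l)) fun c => v (.inr c)

/-- The slope in direction `j` of the differenced phase. -/
def slope (F : MvPolynomial (Idx n m r) ℤ) (k : ℕ) (h : Fin k → IdxL n m r → ℝ) (j : IdxT n m r)
    (q : PtX m r) : ℝ :=
  pol k (evalZ (liftDeriv F j)) (fun i => projT (h i)) (basePt n q)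

theorem continuous_pol {A : Type*} [AddCommGroup A] [TopologicalSpace A] [ContinuousAdd A]
    {f : A → ℝ} (hf : Continuous f) (k : ℕ) (h : Fin k → A) : Continuous (pol k f h) := by
  induction k generalizing f with
  | zero => exact hf
  | succ k ih => exact ih ((hf.comp (continuous_add_const _)).sub hf) _

theorem continuous_basePt : Continuous (basePt n : PtX m r → IdxL n m r → ℝ) := by
  refine continuous_pi ?_
  rintro ((i | i) | i) <;> simp only [basePt, Sum.elim_inl, Sum.elim_inr] <;> fun_prop

theorem continuous_slope (F : MvPolynomial (Idx n m r) ℤ) (k : ℕ) (h : Fin k → IdxL n m r → ℝ)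
    (j : IdxT n m r) : Continuous (slope F k h j) :=
  (continuous_pol (continuous_evalZ _) _ _).comp continuous_basePt

theorem scaleT_add (a : Fin (m - r) → ℝ) (u v : IdxT n m r → ℝ) :
    scaleT a (u + v) = scaleT a u + scaleT a v := by
  ext (i | i) <;> simp [scaleT, mul_add]

theorem pol_pderiv_eq_slope (F : MvPolynomial (Idx n m r) ℤ) (k : ℕ)
    (h : Fin k → IdxL n m r → ℝ) (j : IdxT n m r) (x : Fin (r + 1) → ℝ) (a : Fin (m - r) → ℝ) :
    pol k (fun t : IdxT n m r → ℝ => evalZ (pderiv (.inr j) F) (Sum.elim x t))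
      (fun i => scaleT a fun l => h i (.inr l)) 0 = slope F k h j (x, a) := by
  have h1 := pol_comp (fun t : IdxT n m r → ℝ => evalZ (pderiv (.inr j) F) (Sum.elim x t))
    (scaleT a) (scaleT a) (scaleT_add a) k (fun i l => h i (.inr l)) 0
  have h0 : scaleT a (0 : IdxT n m r → ℝ) = 0 := by ext (i | i) <;> simp [scaleT]
  rw [h0] at h1
  rw [← h1]
  have h2 := pol_comp (evalZ (liftDeriv F j) : (IdxL n m r → ℝ) → ℝ)
    (fun t : IdxT n m r → ℝ => Sum.elim (Sum.elim x a) t) (fun t => Sum.elim 0 t)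
    (fun t t' => by ext (i | i) <;> simp) k (fun i l => h i (.inr l)) 0
  rw [slope]
  refine Eq.trans ?_ h2
  congr 1
  ext t
  rw [evalZ_liftDeriv]
  congr 1

theorem norm_integral_mdiff_fibre_le {F : MvPolynomial (Idx n m r) ℤ} {d k : ℕ}
    (hF : Bihomogeneous F d (k + 1)) (β : ℝ) (x : Fin (r + 1) → ℝ) (a : Fin (m - r) → ℝ)
    (h : Fin k → IdxL n m r → ℝ) {A B : IdxT n m r → ℝ} (hAB : ∀ j, B j ≤ A j + 2) :
    ‖∫ t, mdiff k ((Set.Icc A B).indicator fun t => eexp (β * evalZ F (Sum.elim x t)))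
      (fun i => scaleT a fun l => h i (.inr l)) t‖ ≤ ∏ j, (3 * wt (β * slope F k h j (x, a))) := by
  set h' : Fin k → IdxT n m r → ℝ := fun i => scaleT a fun l => h i (.inr l) with hh'
  set ψ : (IdxT n m r → ℝ) → ℝ := fun t => β * evalZ F (Sum.elim x t) with hψ
  obtain ⟨A', B', hA, hB, heq⟩ := mdiff_indicator_eexp k ψ h' A B
  rw [heq, integral_indicator measurableSet_Icc]
  have hw : IsWeightedHomogeneous (Sum.elim 0 1 : Idx n m r → ℕ) F (k + 1) := by
    convert hF.isWeightedHomogeneous_right using 2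
    ext (i | i) <;> rfl
  have hdeg : DegLT (⊤ : AddSubgroup (IdxT n m r → ℝ)) (k + 2) ψ :=
    ((degLT_evalZ_T (R := ℝ) hw).comp (fun t : IdxT n m r → ℝ => Sum.elim x t)
      (fun t => Sum.elim 0 t) (fun t t' => by ext (i | i) <;> simp) fun _ _ _ => rfl).map
      (AddMonoidHom.mulLeft β)
  have hcont : Continuous ψ := by
    refine continuous_const.mul ((continuous_evalZ F).comp (continuous_pi ?_))
    rintro (i | i) <;> simp only [Sum.elim_inl, Sum.elim_inr] <;> fun_prop
  have hderiv : ∀ (j : IdxT n m r) t, HasDerivAt (fun u : ℝ => ψ (t + u • Pi.single j 1))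
      (β * evalZ (pderiv (.inr j) F) (Sum.elim x t)) 0 := by
    intro j t
    have := (hasDerivAt_evalZ F (Sum.elim x t) (.inr j)).const_mul β
    refine this.congr_of_eventuallyEq (Filter.Eventually.of_forall fun u => ?_)
    simp only [hψ]
    congr 2
    ext (i | i)
    · simp
    · by_cases hij : i = j
      · subst hij; simp
      · simp [hij]
  have hs : ∀ j, pol k (fun t : IdxT n m r → ℝ => β * evalZ (pderiv (.inr j) F) (Sum.elim x t))
      h' 0 = β * slope F k h j (x, a) := by
    intro j
    rw [← pol_pderiv_eq_slope]
    exact map_pol (AddMonoidHom.mulLeft β) _ k h' 0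
  have haff : ∀ t, pol k ψ h' t = pol k ψ h' 0 + ∑ j, (β * slope F k h j (x, a)) * t j := by
    refine affine_of_degLT (DegLT.pol hdeg fun _ => trivial) (continuous_pol hcont _ _) fun j => ?_
    rw [← hs]
    exact hasDerivAt_pol (hderiv j) k h' 0
  have hphase : (fun t => eexp (pol k ψ h' t)) = fun t =>
      eexp (pol k ψ h' 0 + ∑ j, (β * slope F k h j (x, a)) * t j) :=
    funext fun t => congrArg eexp (haff t)
  rw [hphase]
  exact norm_integral_Icc_eexp_le _ _ fun j =>
    (hB j).trans ((hAB j).trans (add_le_add_left (hA j) _))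

theorem mdiff_zero {X : Type*} [Add X] (k : ℕ) (h : Fin k → X) (x : X) :
    mdiff k (fun _ => 0) h x = 0 := by
  induction k with
  | zero => rfl
  | succ k ih => simpa [mdiff] using ih (Fin.tail h)

/-- The integrand of the singular integral as a function of `(x, (y, z))`. -/
def integrand (F : MvPolynomial (Idx n m r) ℤ) (β : ℝ)
    (p : (Fin (r + 1) → ℝ) × (IdxT n m r → ℝ)) : ℂ :=
  if ‖p.1‖ ≤ 1 ∧ (∀ l, |p.2 (.inl l)| ≤ ‖p.1‖) ∧ ∀ c, |p.2 (.inr c)| ≤ 1 then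
    eexp (β * evalZ F (Sum.elim p.1 p.2)) else 0

theorem integrand_eq_indicator (F : MvPolynomial (Idx n m r) ℤ) (β : ℝ) {x : Fin (r + 1) → ℝ}
    (hx : ‖x‖ ≤ 1) : (fun t => integrand F β (x, t)) =
      (Set.Icc (Sum.elim (fun _ => -‖x‖) (fun _ => -1) : IdxT n m r → ℝ)
        (Sum.elim (fun _ => ‖x‖) fun _ => 1)).indicator
          fun t => eexp (β * evalZ F (Sum.elim x t)) := by
  ext t
  rw [integrand, Set.indicator_apply]
  refine if_congr ?_ rfl rfl
  simp only [hx, true_and, Set.mem_Icc, Pi.le_def, abs_le, forall_and, Sum.forall, Sum.elim_inl,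
    Sum.elim_inr]
  tauto

theorem Ibeta_eq_integral (F : MvPolynomial (Idx n m r) ℤ) (β : ℝ) :
    Ibeta F β = ∫ p, integrand F β p := by
  let φ := (MeasurableEquiv.refl (Fin (r + 1) → ℝ)).prodCongr
    (MeasurableEquiv.sumPiEquivProdPi (fun _ : Fin (m - r) ⊕ Fin (n - m + 1) => ℝ)).symm
  have hmp : MeasurePreserving φ volume volume :=
    (MeasurePreserving.id (volume : Measure (Fin (r + 1) → ℝ))).prod
      (volume_measurePreserving_sumPiEquivProdPi_symm
        (fun _ : Fin (m - r) ⊕ Fin (n - m + 1) => ℝ))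
  refine Eq.trans ?_ (hmp.integral_comp' (integrand F β))
  rw [Ibeta]
  refine integral_congr_ae (Filter.Eventually.of_forall fun p => ?_)
  have hφ : φ p = (p.1, Sum.elim p.2.1 p.2.2) := rfl
  simp only [hφ, integrand, Sum.elim_inl, Sum.elim_inr]
  refine if_congr ?_ ?_ rfl
  · rw [pi_norm_le_iff_of_nonneg (x := p.2.1) (norm_nonneg p.1),
      pi_norm_le_iff_of_nonneg (x := p.2.2) zero_le_one]
    rfl
  · rw [evalF, aeval_eq_evalZ]

end fibreStep

section vectorStep

/-- The rescaled integer point `h / P`. -/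
def rescale (ι : Type*) (P : ℕ) (h : ι → ℤ) : ι → ℝ := fun l => (P : ℝ)⁻¹ * h l

theorem rescale_add (ι : Type*) (P : ℕ) (u v : ι → ℤ) :
    rescale ι P (u + v) = rescale ι P u + rescale ι P v := by
  ext i; simp [rescale, mul_add]

theorem abs_rescale_le {ι : Type*} {P : ℕ} {h : ι → ℤ} (hh : ∀ i, |h i| ≤ (P : ℤ)) (i : ι) :
    |rescale ι P h i| ≤ 1 := by
  rw [rescale, abs_mul, abs_inv, Nat.abs_cast]
  have h1 : |(h i : ℝ)| ≤ P := by exact_mod_cast hh i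
  rcases P.eq_zero_or_pos with rfl | hP
  · simp
  · rw [inv_mul_le_iff₀ (by exact_mod_cast hP)]
    simpa using h1

/-- The product of the weights of the slopes. -/
def slopeWt (F : MvPolynomial (Idx n m r) ℤ) (β : ℝ) {k : ℕ} (h : Fin k → IdxL n m r → ℝ)
    (q : PtX m r) : ℝ :=
  ∏ j, wt (β * slope F k h j q)

theorem continuous_wt : Continuous wt := by
  unfold wt
  exact continuous_const.div (by fun_prop) fun t => by positivity

theorem continuous_slopeWt (F : MvPolynomial (Idx n m r) ℤ) (β : ℝ) {k : ℕ}
    (h : Fin k → IdxL n m r → ℝ) : Continuous (slopeWt F β h) :=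
  continuous_finsetProd _ fun j _ =>
    continuous_wt.comp (continuous_const.mul (continuous_slope F k h j))

theorem slopeWt_nonneg (F : MvPolynomial (Idx n m r) ℤ) (β : ℝ) {k : ℕ}
    (h : Fin k → IdxL n m r → ℝ) (q : PtX m r) : 0 ≤ slopeWt F β h q :=
  Finset.prod_nonneg fun _ _ => (wt_pos _).le

theorem slopeWt_le_one (F : MvPolynomial (Idx n m r) ℤ) (β : ℝ) {k : ℕ}
    (h : Fin k → IdxL n m r → ℝ) (q : PtX m r) : slopeWt F β h q ≤ 1 :=
  Finset.prod_le_one (fun _ _ => (wt_pos _).le) fun _ _ => wt_le_one _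

theorem measurable_integrand (F : MvPolynomial (Idx n m r) ℤ) (β : ℝ) :
    Measurable (integrand F β) := by
  have hc : Continuous fun p : (Fin (r + 1) → ℝ) × (IdxT n m r → ℝ) =>
      (Sum.elim p.1 p.2 : Idx n m r → ℝ) := by
    refine continuous_pi ?_
    rintro (i | i) <;> simp only [Sum.elim_inl, Sum.elim_inr] <;> fun_prop
  refine Measurable.ite ?_ ?_ measurable_const
  · have hb (l : IdxT n m r) : Continuous fun p : (Fin (r + 1) → ℝ) × (IdxT n m r → ℝ) =>
        |p.2 l| := by fun_prop
    have hx : Continuous fun p : (Fin (r + 1) → ℝ) × (IdxT n m r → ℝ) => ‖p.1‖ := by fun_prop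
    convert ((isClosed_le hx (continuous_const (y := (1 : ℝ)))).inter
      ((isClosed_iInter fun l : Fin (m - r) => isClosed_le (hb (.inl l)) hx).inter
      (isClosed_iInter fun l : Fin (n - m + 1) => isClosed_le (hb (.inr l))
        (continuous_const (y := (1 : ℝ)))))).measurableSet using 1
    ext p
    simp only [Set.mem_inter_iff, Set.mem_iInter, Set.mem_ofPred_eq]
  · exact (continuous_eexp.comp (continuous_const.mul
      ((continuous_evalZ F).comp hc))).measurable

theorem norm_integrand_le (F : MvPolynomial (Idx n m r) ℤ) (β : ℝ)
    (p : (Fin (r + 1) → ℝ) × (IdxT n m r → ℝ)) : ‖integrand F β p‖ ≤ 1 := by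
  rw [integrand]
  split_ifs
  · exact (norm_eexp _).le
  · simp

theorem integrand_eq_zero (F : MvPolynomial (Idx n m r) ℤ) (β : ℝ)
    {p : (Fin (r + 1) → ℝ) × (IdxT n m r → ℝ)} (hp : p ∉ Metric.closedBall 0 1) :
    integrand F β p = 0 := by
  rw [integrand, if_neg]
  rintro ⟨h1, h2, h3⟩
  apply hp
  rw [mem_closedBall_zero_iff, Prod.norm_def, max_le_iff]
  refine ⟨h1, (pi_norm_le_iff_of_nonneg zero_le_one).2 ?_⟩
  rintro (l | c)
  · exact (h2 l).trans h1
  · exact h3 c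

theorem norm_integral_mdiff_integrand_le {F : MvPolynomial (Idx n m r) ℤ} {d k : ℕ}
    (hF : Bihomogeneous F d (k + 1)) (β : ℝ) (a : Fin (m - r) → ℝ) (h : Fin k → IdxL n m r → ℝ) :
    ‖∫ p, mdiff k (integrand F β) (fun i => ((0 : Fin (r + 1) → ℝ), scaleT a fun l => h i (.inr l))) p‖ ≤
      3 ^ Fintype.card (IdxT n m r) *
        ∫ x in Metric.closedBall (0 : Fin (r + 1) → ℝ) 1, slopeWt F β h (x, a) := by
  set D := mdiff k (integrand F β)
    (fun i => ((0 : Fin (r + 1) → ℝ), scaleT a fun l => h i (.inr l))) with hD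
  have hnn : 0 ≤ ∫ x in Metric.closedBall (0 : Fin (r + 1) → ℝ) 1, slopeWt F β h (x, a) :=
    integral_nonneg fun x => slopeWt_nonneg _ _ _ _
  by_cases hint : Integrable D
  swap
  · rw [integral_undef hint, norm_zero]; positivity
  have hcont : Continuous fun x : Fin (r + 1) → ℝ => slopeWt F β h (x, a) :=
    (continuous_slopeWt F β h).comp (by fun_prop)
  rw [Measure.volume_eq_prod] at hint ⊢
  rw [integral_prod _ hint, ← integral_const_mul,
    ← integral_indicator Metric.isClosed_closedBall.measurableSet]
  refine norm_integral_le_of_norm_le ((continuous_const.mul hcont).continuousOn.integrableOn_compact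
    (isCompact_closedBall _ _) |>.integrable_indicator Metric.isClosed_closedBall.measurableSet)
    (Filter.Eventually.of_forall fun x => ?_)
  have hcomp : ∀ t, D (x, t) = mdiff k (fun t => integrand F β (x, t))
      (fun i => scaleT a fun l => h i (.inr l)) t := fun t =>
    (mdiff_comp (integrand F β) (fun t => (x, t)) (fun t => (0, t))
      (fun t t' => by simp) k _ t).symm
  simp_rw [hcomp]
  by_cases hx : x ∈ Metric.closedBall (0 : Fin (r + 1) → ℝ) 1
  · rw [Set.indicator_of_mem hx, integrand_eq_indicator F β (mem_closedBall_zero_iff.1 hx)]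
    refine (norm_integral_mdiff_fibre_le hF β x a h ?_).trans (le_of_eq ?_)
    · have := mem_closedBall_zero_iff.1 hx
      rintro (j | j)
      · simp only [Sum.elim_inl]; linarith
      · simp only [Sum.elim_inr]; norm_num
    · rw [Finset.prod_mul_distrib, Finset.prod_const, slopeWt]; rfl
  · rw [Set.indicator_of_notMem hx]
    have h0 : (fun t => integrand F β (x, t)) = fun _ => 0 := by
      ext t
      refine integrand_eq_zero F β fun hp => hx ?_
      rw [mem_closedBall_zero_iff] at hp ⊢
      exact (norm_fst_le (x, t)).trans hp
    simp only [h0, mdiff_zero, integral_zero, norm_zero, le_refl]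

/-- The domain of the averaged variables `(x, a)`. -/
def domX (m r : ℕ) : Set (PtX m r) := Metric.closedBall 0 1 ×ˢ Set.Icc 1 2

theorem exists_norm_Ibeta_pow_le {F : MvPolynomial (Idx n m r) ℤ} {d k : ℕ}
    (hF : Bihomogeneous F d (k + 1)) :
    ∃ C : ℝ, 0 ≤ C ∧ ∀ (β : ℝ) (P : ℕ), ‖Ibeta F β‖ ^ 2 ^ k ≤
      C * Finset.expect (zboxes (Fin k) (IdxL n m r) P) fun h =>
        ∫ q in domX m r, slopeWt F β (fun i => rescale _ P (h i)) q := by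
  set V : ℝ := max 1 ((volume : Measure ((Fin (r + 1) → ℝ) × (IdxT n m r → ℝ))).real
    (Metric.closedBall 0 3)) with hV
  set C₀ := (V * 2 ^ Fintype.card (IdxL n m r)) ^ 2 ^ k with hC₀
  have hC₀' : 0 ≤ C₀ := by have := le_max_left 1 ((volume : Measure ((Fin (r + 1) → ℝ) ×
    (IdxT n m r → ℝ))).real (Metric.closedBall 0 3)); positivity
  refine ⟨C₀ * 3 ^ Fintype.card (IdxT n m r), by positivity, fun β P => ?_⟩
  set W : (Fin k → IdxL n m r → ℤ) → PtX m r → ℝ :=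
    fun h => slopeWt F β (fun i => rescale _ P (h i)) with hW
  have hfix : ∀ a ∈ Set.Icc (1 : Fin (m - r) → ℝ) 2, ‖Ibeta F β‖ ^ 2 ^ k ≤
      C₀ * Finset.expect (zboxes (Fin k) (IdxL n m r) P) fun h =>
        3 ^ Fintype.card (IdxT n m r) *
          ∫ x in Metric.closedBall (0 : Fin (r + 1) → ℝ) 1, W h (x, a) := by
    intro a ha
    let τ : (IdxL n m r → ℤ) →+ (Fin (r + 1) → ℝ) × (IdxT n m r → ℝ) :=
      AddMonoidHom.mk' (fun h => (0, scaleT a fun l => rescale _ P h (.inr l))) fun u v => by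
        rw [rescale_add]
        refine Prod.ext (by simp) ?_
        exact scaleT_add a (fun l => rescale _ P u (.inr l)) fun l => rescale _ P v (.inr l)
    have hτ : ∀ h : IdxL n m r → ℤ, (∀ i, |h i| ≤ (P : ℤ)) → ‖τ h‖ ≤ 2 := by
      intro h hh
      change ‖((0 : Fin (r + 1) → ℝ), scaleT a fun l => rescale _ P h (.inr l))‖ ≤ 2
      rw [Prod.norm_def, norm_zero]
      refine max_le (by norm_num) ((pi_norm_le_iff_of_nonneg (by norm_num)).2 ?_)
      rintro (l | c)
      · have h1 := abs_rescale_le hh (.inr (.inl l))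
        have h2 : (1 : ℝ) ≤ a l := ha.1 l
        have h3 : a l ≤ 2 := ha.2 l
        simp only [scaleT, Sum.elim_inl, norm_mul, Real.norm_eq_abs]
        rw [abs_of_nonneg (by linarith : (0 : ℝ) ≤ a l)]
        nlinarith [abs_nonneg (rescale _ P h (.inr (.inl l)))]
      · have h1 := abs_rescale_le hh (.inr (.inr c))
        simp only [scaleT, Sum.elim_inr, Real.norm_eq_abs]
        linarith
    have : (volume : Measure ((Fin (r + 1) → ℝ) × (IdxT n m r → ℝ))).IsAddLeftInvariant := by
      rw [Measure.volume_eq_prod]; infer_instance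
    have hvdc := norm_integral_pow_le (μ := (volume : Measure ((Fin (r + 1) → ℝ) ×
      (IdxT n m r → ℝ)))) (K := Metric.closedBall 0 1) (K₂ := Metric.closedBall 0 3)
      (isCompact_closedBall _ _).measure_ne_top (le_max_left _ _) (le_max_right _ _) P τ (by
        intro h hh x hx
        rw [mem_closedBall_zero_iff] at hx ⊢
        have := norm_sub_le (x + τ h) (τ h)
        rw [add_sub_cancel_right] at this
        linarith [hτ h hh]) k (measurable_integrand F β) (norm_integrand_le F β)
        (fun x hx => integrand_eq_zero F β hx)
    rw [← Ibeta_eq_integral] at hvdc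
    refine hvdc.trans (mul_le_mul_of_nonneg_left (Finset.expect_le_expect fun h _ => ?_) hC₀')
    exact norm_integral_mdiff_integrand_le hF β a fun i => rescale _ P (h i)
  have hvol : (volume : Measure (Fin (m - r) → ℝ)).real (Set.Icc 1 2) = 1 := by
    rw [measureReal_def, Real.volume_Icc_pi_toReal (by intro i; norm_num)]
    norm_num
  have hWc : ∀ h, Continuous (W h) := fun h => continuous_slopeWt _ _ _
  have hWi : ∀ h, IntegrableOn (W h) (domX m r) := fun h =>
    (hWc h).continuousOn.integrableOn_compact ((isCompact_closedBall _ _).prod isCompact_Icc)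
  have hfub : ∀ h, ∫ q in domX m r, W h q =
      ∫ a in Set.Icc 1 2, ∫ x in Metric.closedBall (0 : Fin (r + 1) → ℝ) 1, W h (x, a) := by
    intro h
    have := hWi h
    rw [domX, Measure.volume_eq_prod, IntegrableOn, ← Measure.prod_restrict] at this
    rw [domX, Measure.volume_eq_prod, ← Measure.prod_restrict, integral_prod_symm _ this]
  have hIi : ∀ h, IntegrableOn (fun a => ∫ x in Metric.closedBall (0 : Fin (r + 1) → ℝ) 1,
      W h (x, a)) (Set.Icc 1 2) := by
    intro h
    have := hWi h
    rw [domX, Measure.volume_eq_prod, IntegrableOn, ← Measure.prod_restrict] at this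
    exact this.integral_prod_right
  calc ‖Ibeta F β‖ ^ 2 ^ k = ∫ _a in Set.Icc (1 : Fin (m - r) → ℝ) 2, ‖Ibeta F β‖ ^ 2 ^ k := by
        rw [setIntegral_const, hvol, one_smul]
    _ ≤ ∫ a in Set.Icc (1 : Fin (m - r) → ℝ) 2, C₀ *
        Finset.expect (zboxes (Fin k) (IdxL n m r) P) fun h =>
        3 ^ Fintype.card (IdxT n m r) *
          ∫ x in Metric.closedBall (0 : Fin (r + 1) → ℝ) 1, W h (x, a) := by
        refine setIntegral_mono_on ?_ ?_ measurableSet_Icc hfix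
        · exact continuousOn_const.integrableOn_compact isCompact_Icc
        · refine Integrable.const_mul ?_ _
          simp only [Finset.expect_eq_sum_div_card]
          exact (integrable_finsetSum _ fun h _ => (hIi h).const_mul _).div_const _
    _ = _ := by
        rw [integral_const_mul]
        simp only [Finset.expect_eq_sum_div_card]
        rw [integral_div, integral_finsetSum _ fun h _ => (hIi h).const_mul _]
        simp only [integral_const_mul]
        rw [← Finset.mul_sum, ← Finset.sum_congr rfl fun h _ => hfub h]
        ring

end vectorStep

section gridStep

theorem wt_mul_wt_le_sub (s t : ℝ) : wt s * wt t ≤ wt (s - t) := by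
  rw [wt, wt, wt, div_mul_div_comm, one_mul]
  refine one_div_le_one_div_of_le (by positivity) ?_
  have := abs_sub s t
  nlinarith [abs_nonneg s, abs_nonneg t, mul_nonneg (abs_nonneg s) (abs_nonneg t)]

theorem wt_mul_wt_le_right (s t : ℝ) : wt s * wt t ≤ wt t :=
  mul_le_of_le_one_left (wt_pos t).le (wt_le_one s)

theorem mdiff_eq_zero_of_notMem {X : Type*} [AddCommGroup X] {B : Set X} (e : ℕ) {f : X → ℂ}
    (hf : ∀ x, x ∉ B → f x = 0) (h : Fin e → X) {x : X} (hx : x ∉ B) : mdiff e f h x = 0 := by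
  induction e generalizing f with
  | zero => exact hf x hx
  | succ e ih => exact ih (fun y hy => by simp [hf y hy]) _

theorem pol_of_eq_zero {A B : Type*} [AddCommGroup A] [AddCommGroup B] {e : ℕ} (he : e = 0)
    (f : A → B) (h : Fin e → A) (x : A) : pol e f h x = f x := by
  subst he; rfl

theorem norm_mdiff_le_prod_wt {X κ : Type*} [AddCommGroup X] [Fintype κ] {E : ℕ} {e : κ → ℕ}
    (he : ∀ j, e j ≤ E) {G : κ → X → ℝ} {f : X → ℂ} (hf : ∀ x, ‖f x‖ ≤ ∏ j, wt (G j x))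
    (h : Fin E → X) (x : X) :
    ‖mdiff E f h x‖ ≤ ∏ j, wt (pol (e j) (G j) (fun i => h (Fin.castLE (he j) i)) x) := by
  induction E generalizing e G f with
  | zero =>
    refine (hf x).trans (le_of_eq (Finset.prod_congr rfl fun j _ => ?_))
    rw [pol_of_eq_zero (Nat.le_zero.1 (he j))]
  | succ E ih =>
    let G' : κ → X → ℝ := fun j x => if e j = 0 then G j x else G j (x + h 0) - G j x
    have hG : ∀ j, pol (e j) (G j) (fun i => h (Fin.castLE (he j) i)) x =
        pol (e j - 1) (G' j) (fun i => Fin.tail h (Fin.castLE (by have := he j; omega) i)) x := by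
      intro j
      simp only [G']
      have hj := he j
      generalize_proofs h1 h2
      revert h1 h2
      generalize e j = e' at *
      intro h1 h2
      rcases e' with _ | e'
      · rfl
      · simp only [Nat.succ_ne_zero, if_false]
        rfl
    simp only [hG]
    refine ih (e := fun j => e j - 1) (fun j => by have := he j; omega) (fun x => ?_) _
    rw [norm_mul, RCLike.norm_conj]
    refine (mul_le_mul (hf _) (hf _) (norm_nonneg _)
      (Finset.prod_nonneg fun _ _ => (wt_pos _).le)).trans ?_
    rw [← Finset.prod_mul_distrib]
    refine Finset.prod_le_prod (fun _ _ => mul_nonneg (wt_pos _).le (wt_pos _).le) fun j _ => ?_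
    simp only [G']
    split_ifs
    · exact wt_mul_wt_le_right _ _
    · exact wt_mul_wt_le_sub _ _

/-- The point of `PtX` obtained by rescaling the first block of an integer point. -/
def gridX (n m r P : ℕ) : (IdxL n m r → ℤ) →+ PtX m r :=
  AddMonoidHom.mk' (fun H => (fun i => rescale _ P H (.inl (.inl i)),
    fun l => rescale _ P H (.inl (.inr l)))) fun u v => by
      rw [rescale_add]; rfl

theorem norm_gridX_le {P : ℕ} {H : IdxL n m r → ℤ} (hH : ∀ i, |H i| ≤ (P : ℤ)) :
    ‖gridX n m r P H‖ ≤ 1 := by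
  change ‖((fun i => rescale _ P H (.inl (.inl i)), fun l => rescale _ P H (.inl (.inr l))) :
    PtX m r)‖ ≤ 1
  rw [Prod.norm_def]
  exact max_le ((pi_norm_le_iff_of_nonneg zero_le_one).2 fun i => abs_rescale_le hH _)
    ((pi_norm_le_iff_of_nonneg zero_le_one).2 fun i => abs_rescale_le hH _)

theorem basePt_add (u v : PtX m r) : basePt n (u + v) = basePt n u + basePt n v := by
  ext ((i | i) | i) <;> simp [basePt]

theorem pol_slope {F : MvPolynomial (Idx n m r) ℤ} {j : IdxT n m r} {e : ℕ}
    (hg : IsWeightedHomogeneous (Sum.elim 1 0) (liftDeriv F j) e) (β : ℝ) {k : ℕ}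
    (h : Fin k → IdxL n m r → ℝ) (P : ℕ) (H : Fin e → IdxL n m r → ℤ) (q : PtX m r) :
    pol e (fun q => β * slope F k h j q) (fun i => gridX n m r P (H i)) q =
      β * Gam k e (liftDeriv F j) h fun i => rescale _ P (H i) := by
  have h1 := map_pol (AddMonoidHom.mulLeft β) (slope F k h j) e (fun i => gridX n m r P (H i)) q
  simp only [AddMonoidHom.coe_mulLeft] at h1
  rw [h1, Gam]
  congr 1
  have h2 := pol_comp (pol k (evalZ (liftDeriv F j)) fun i => projT (h i)) (basePt n) (basePt n)
    basePt_add e (fun i => gridX n m r P (H i)) q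
  refine h2.trans ?_
  have h3 : ∀ i, basePt n (gridX n m r P (H i)) = projX (rescale _ P (H i)) := by
    intro i
    ext ((l | l) | l) <;> rfl
  simp only [h3]
  rw [← zero_add (basePt n q)]
  exact pol_add_right ((degLT_evalZ_X hg).pol_of_comm _) (fun i => projX_mem _)
    (fun i => rfl) 0

theorem Gam_rescale {σ τ : Type*} {k e : ℕ} {g : MvPolynomial (σ ⊕ τ) ℤ}
    (hX : IsWeightedHomogeneous (Sum.elim 1 0) g e) (hT : IsWeightedHomogeneous (Sum.elim 0 1) g k)
    (P : ℕ) (h : Fin k → σ ⊕ τ → ℤ) (H : Fin e → σ ⊕ τ → ℤ) :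
    Gam k e g (fun i => rescale _ P (h i)) (fun i => rescale _ P (H i)) =
      (P : ℝ)⁻¹ ^ (e + k) * (Gam k e g h H : ℤ) := by
  have hg : g.IsHomogeneous (e + k) := by
    have := hX.add_weight hT
    have hw : (Sum.elim 1 0 : σ ⊕ τ → ℕ) + (Sum.elim 0 1 : σ ⊕ τ → ℕ) = 1 := by
      ext (i | i) <;> rfl
    rwa [hw] at this
  have h1 := Gam_smul hg (P : ℝ)⁻¹ (fun i l => (Int.castRingHom ℝ) (h i l))
    (fun i l => (Int.castRingHom ℝ) (H i l))
  rw [Gam_map] at h1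
  exact h1

theorem exists_setIntegral_slopeWt_pow_le {F : MvPolynomial (Idx n m r) ℤ} {E k : ℕ}
    (hF : Bihomogeneous F (E + 1) (k + 1)) :
    ∃ C : ℝ, 0 ≤ C ∧ ∀ (β : ℝ) (P : ℕ) (h : Fin k → IdxL n m r → ℤ),
      (∫ q in domX m r, slopeWt F β (fun i => rescale _ P (h i)) q) ^ 2 ^ (E + 1) ≤
      C * Finset.expect (zboxes (Fin (E + 1)) (IdxL n m r) P) fun H =>
        ∏ j, wt (β * (P : ℝ)⁻¹ ^ (degLift n m r E j + k) *
          (GamF (degLift_le E) (liftDeriv F) (h, H) j : ℤ)) := by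
  have hinv : (volume : Measure (PtX m r)).IsAddLeftInvariant := by
    rw [Measure.volume_eq_prod]; infer_instance
  set V : ℝ := max 1 ((volume : Measure (PtX m r)).real (Metric.closedBall 0 3)) with hV
  have hdc : IsCompact (domX m r) := (isCompact_closedBall _ _).prod isCompact_Icc
  have hdm : MeasurableSet (domX m r) := hdc.isClosed.measurableSet
  set v : ℝ := (volume : Measure (PtX m r)).real (domX m r) with hv
  have hv0 : 0 ≤ v := measureReal_nonneg
  set C₀ := (V * 2 ^ Fintype.card (IdxL n m r)) ^ 2 ^ (E + 1) with hC₀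
  have hC₀' : 0 ≤ C₀ := by
    have := le_max_left 1 ((volume : Measure (PtX m r)).real (Metric.closedBall 0 3))
    positivity
  refine ⟨C₀ * v, by positivity, fun β P h => ?_⟩
  set W : PtX m r → ℝ := slopeWt F β (fun i => rescale _ P (h i)) with hW
  have hWc : Continuous W := continuous_slopeWt _ _ _
  let f : PtX m r → ℂ := (domX m r).indicator fun q => (W q : ℂ)
  have hfm : Measurable f :=
    (Complex.continuous_ofReal.comp hWc).measurable.indicator hdm
  have hfW : ∀ q, ‖f q‖ ≤ W q := by
    intro q
    simp only [f, Set.indicator_apply]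
    split_ifs
    · rw [Complex.norm_real, Real.norm_of_nonneg (slopeWt_nonneg _ _ _ _)]
    · rw [norm_zero]; exact slopeWt_nonneg _ _ _ _
  have hf0 : ∀ q, q ∉ domX m r → f q = 0 := fun q hq => Set.indicator_of_notMem hq _
  have hfi : ‖∫ q, f q‖ = ∫ q in domX m r, W q := by
    rw [integral_indicator hdm]
    refine (congrArg norm integral_complex_ofReal).trans ?_
    rw [Complex.norm_real,
      Real.norm_of_nonneg (integral_nonneg fun q => slopeWt_nonneg _ _ _ _)]
  have hvdc := norm_integral_pow_le (μ := (volume : Measure (PtX m r))) (K := domX m r)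
    (K₂ := Metric.closedBall 0 3) (isCompact_closedBall _ _).measure_ne_top (le_max_left _ _)
    (le_max_right _ _) P (gridX n m r P) (by
      intro H hH x hx
      have h1 := norm_gridX_le hH
      have h2 : ‖x + gridX n m r P H‖ ≤ 2 := by
        rw [Prod.norm_def]
        refine max_le ((mem_closedBall_zero_iff.1 hx.1).trans (by norm_num))
          ((pi_norm_le_iff_of_nonneg (by norm_num)).2 fun i => ?_)
        have h3 : 1 ≤ (x + gridX n m r P H).2 i := hx.2.1 i
        have h4 : (x + gridX n m r P H).2 i ≤ 2 := hx.2.2 i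
        rw [Real.norm_eq_abs, abs_of_nonneg (by linarith)]
        exact h4
      rw [mem_closedBall_zero_iff]
      have := norm_sub_le (x + gridX n m r P H) (gridX n m r P H)
      rw [add_sub_cancel_right] at this
      linarith) (E + 1) hfm (fun q => (hfW q).trans (slopeWt_le_one _ _ _ _)) hf0
  rw [hfi] at hvdc
  refine hvdc.trans ?_
  rw [mul_assoc]
  refine mul_le_mul_of_nonneg_left ?_ hC₀'
  rw [Finset.mul_expect]
  refine Finset.expect_le_expect fun H _ => ?_
  set w := ∏ j, wt (β * (P : ℝ)⁻¹ ^ (degLift n m r E j + k) *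
          (GamF (degLift_le E) (liftDeriv F) (h, H) j : ℤ)) with hw
  have hb : ∀ q, ‖mdiff (E + 1) f (fun i => gridX n m r P (H i)) q‖ ≤ w := by
    intro q
    refine (norm_mdiff_le_prod_wt (degLift_le (n := n) (m := m) (r := r) E) (f := f)
      (G := fun j q => β * slope F k (fun i => rescale _ P (h i)) j q) hfW _ q).trans
      (le_of_eq ?_)
    refine Finset.prod_congr rfl fun j _ => ?_
    have hj : IsWeightedHomogeneous (Sum.elim 1 0) (liftDeriv F j) (degLift n m r E j) :=
      hF.liftDeriv_left j
    rw [mul_assoc, GamF, ← Gam_rescale hj (hF.liftDeriv_right j)]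
    exact congrArg wt (pol_slope hj β _ P _ q)
  have hw0 : 0 ≤ w := Finset.prod_nonneg fun _ _ => (wt_pos _).le
  have hsupp : ∀ q, q ∉ domX m r → mdiff (E + 1) f (fun i => gridX n m r P (H i)) q = 0 :=
    fun q hq => mdiff_eq_zero_of_notMem _ hf0 _ hq
  rw [← setIntegral_eq_integral_of_forall_compl_eq_zero hsupp, mul_comm]
  exact norm_setIntegral_le_of_norm_le_const hdc.measure_lt_top fun q _ => hb q

theorem exists_norm_Ibeta_pow_le_expect {F : MvPolynomial (Idx n m r) ℤ} {E k : ℕ}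
    (hF : Bihomogeneous F (E + 1) (k + 1)) :
    ∃ C : ℝ, 0 ≤ C ∧ ∀ (β : ℝ) (P : ℕ), ‖Ibeta F β‖ ^ 2 ^ (k + E + 1) ≤
      C * Finset.expect (zboxes (Fin k) (IdxL n m r) P ×ˢ zboxes (Fin (E + 1)) (IdxL n m r) P)
        fun p => ∏ j, wt (β * (P : ℝ)⁻¹ ^ (degLift n m r E j + k) *
          (GamF (degLift_le E) (liftDeriv F) p j : ℤ)) := by
  obtain ⟨C₁, hC₁, h1⟩ := exists_norm_Ibeta_pow_le hF
  obtain ⟨C₂, hC₂, h2⟩ := exists_setIntegral_slopeWt_pow_le hF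
  refine ⟨C₁ ^ 2 ^ (E + 1) * C₂, by positivity, fun β P => ?_⟩
  rw [add_assoc, pow_add 2, pow_mul]
  refine (pow_le_pow_left₀ (by positivity) (h1 β P) _).trans ?_
  rw [mul_pow, mul_assoc]
  refine mul_le_mul_of_nonneg_left ?_ (by positivity)
  refine (expect_pow_le (zboxes_nonempty _ _ _) (fun h _ => integral_nonneg fun q =>
    slopeWt_nonneg _ _ _ _) _).trans ?_
  rw [Finset.expect_product, Finset.mul_expect]
  exact Finset.expect_le_expect fun h _ => h2 β P h

end gridStep

section decay

theorem log_pow_le (K : ℕ) {x : ℝ} (hx : 1 ≤ x) :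
    (4 * (1 + Real.log x)) ^ K ≤ (4 ^ K * K.factorial * Real.exp 1) * x := by
  have h0 := Real.log_nonneg hx
  have h1 := Real.pow_div_factorial_le_exp (1 + Real.log x) (by linarith) K
  rw [Real.exp_add, Real.exp_log (by linarith), div_le_iff₀ (by positivity)] at h1
  rw [mul_pow]
  nlinarith [pow_pos (by norm_num : (0 : ℝ) < 4) K]

theorem card_IdxL (hrm : r ≤ m) (hmn : m ≤ n) :
    Fintype.card (IdxL n m r) = n + 2 + (m - r) := by
  simp only [IdxL, IdxX, IdxT, Fintype.card_sum, Fintype.card_fin]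
  omega

theorem exists_abs_mul_GamF_le (F : MvPolynomial (Idx n m r) ℤ) {E k : ℕ}
    (hF : Bihomogeneous F (E + 1) (k + 1)) :
    ∃ M : ℝ, 0 ≤ M ∧ ∀ (P : ℕ), ∀ p ∈ zboxes (Fin k) (IdxL n m r) P ×ˢ
      zboxes (Fin (E + 1)) (IdxL n m r) P, ∀ j,
        |(P : ℝ)⁻¹ ^ (degLift n m r E j + k) *
          (GamF (degLift_le E) (liftDeriv F) p j : ℤ)| ≤ M := by
  choose M hM0 hM using fun j : IdxT n m r =>
    exists_abs_Gam_le k (degLift n m r E j) (liftDeriv F j)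
  refine ⟨∑ j, M j, Finset.sum_nonneg fun j _ => hM0 j, fun P p hp j => ?_⟩
  have hj : IsWeightedHomogeneous (Sum.elim 1 0) (liftDeriv F j) (degLift n m r E j) :=
    hF.liftDeriv_left j
  rw [GamF, ← Gam_rescale hj (hF.liftDeriv_right j)]
  rw [Finset.mem_product, mem_zboxes, mem_zboxes] at hp
  refine (hM j _ _ (fun i => ?_) fun i => ?_).trans
    (Finset.single_le_sum (fun j _ => hM0 j) (Finset.mem_univ j))
  · exact (pi_norm_le_iff_of_nonneg zero_le_one).2 fun l => abs_rescale_le (hp.1 i) l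
  · exact (pi_norm_le_iff_of_nonneg zero_le_one).2 fun l => abs_rescale_le (hp.2 _) l

theorem exists_norm_Ibeta_pow_mul_le {F : MvPolynomial (Idx n m r) ℤ} {E k D c : ℕ}
    (hF : Bihomogeneous F (E + 1) (k + 1)) (hD : dimV2 F = ((D : ℕ∞) : WithBot ℕ∞))
    (hc : D + (m - r) + c = Fintype.card (IdxL n m r)) :
    ∃ C : ℝ, 0 ≤ C ∧ ∀ (β : ℝ) (P : ℕ), 1 ≤ P → (P : ℝ) ^ (k + E + 1) ≤ β →
      ‖Ibeta F β‖ ^ 2 ^ (k + E + 1) * (P : ℝ) ^ c ≤ C * β := by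
  obtain ⟨C₁, hC₁, h1⟩ := exists_norm_Ibeta_pow_le_expect hF
  obtain ⟨C₂, hC₂, h2⟩ := sum_wt_liftDeriv_le hF hD
  obtain ⟨M₀, hM₀, hM⟩ := exists_abs_mul_GamF_le F hF
  set K := Fintype.card (IdxT n m r)
  set N := Fintype.card (IdxL n m r)
  refine ⟨C₁ * (C₂ * ((4 ^ K * K.factorial * Real.exp 1) * (M₀ + 3))), by positivity,
    fun β P hP hβ => ?_⟩
  have hP1 : (1 : ℝ) ≤ P := by exact_mod_cast hP
  have hP0 : (0 : ℝ) < P := by linarith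
  have hβ1 : 1 ≤ β := (one_le_pow₀ hP1).trans hβ
  set θ : IdxT n m r → ℝ := fun j => β * (P : ℝ)⁻¹ ^ (degLift n m r E j + k) with hθ
  have hθ1 : ∀ j, 1 ≤ |θ j| := by
    intro j
    refine le_trans ?_ (le_abs_self _)
    simp only [hθ]
    rw [inv_pow, ← div_eq_mul_inv, one_le_div (by positivity)]
    refine le_trans (pow_le_pow_right₀ hP1 ?_) hβ
    have := degLift_le (n := n) (m := m) (r := r) E j
    omega
  have hsum := h2 θ hθ1 P ⌈β * M₀⌉₊ hP (by
    intro p hp j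
    refine le_trans ?_ (Nat.le_ceil _)
    simp only [hθ]
    rw [mul_assoc, abs_mul, abs_of_pos (by linarith : 0 < β)]
    exact mul_le_mul_of_nonneg_left (hM P p hp j) (by linarith))
  have hlog : (4 * (1 + Real.log ((⌈β * M₀⌉₊ : ℝ) + 2))) ^ K ≤
      (4 ^ K * K.factorial * Real.exp 1) * ((M₀ + 3) * β) := by
    refine (log_pow_le K (by linarith [(⌈β * M₀⌉₊).cast_nonneg (α := ℝ)])).trans ?_
    refine mul_le_mul_of_nonneg_left ?_ (by positivity)
    have := Nat.ceil_lt_add_one (a := β * M₀) (by positivity)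
    linarith
  have hcard : (P : ℝ) ^ (D + (m - r) + N * (k + E)) * (P : ℝ) ^ c ≤
      ((zboxes (Fin k) (IdxL n m r) P ×ˢ zboxes (Fin (E + 1)) (IdxL n m r) P).card : ℝ) := by
    rw [Finset.card_product, card_zboxes, card_zboxes, Fintype.card_fin, Fintype.card_fin,
      ← pow_mul, ← pow_mul, ← pow_add, ← pow_add]
    push_cast
    have : D + (m - r) + N * (k + E) + c = N * k + N * (E + 1) := by rw [← hc]; ring
    rw [this]
    exact pow_le_pow_left₀ hP0.le (by linarith) _
  set Q := zboxes (Fin k) (IdxL n m r) P ×ˢ zboxes (Fin (E + 1)) (IdxL n m r) P with hQ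
  set S := ∑ p ∈ Q, ∏ j, wt (θ j * (GamF (degLift_le E) (liftDeriv F) p j : ℤ)) with hS
  have hI : ‖Ibeta F β‖ ^ 2 ^ (k + E + 1) ≤ C₁ * (S / Q.card) := by
    have := h1 β P
    rw [Finset.expect_eq_sum_div_card] at this
    exact this
  have hQ0 : (0 : ℝ) < Q.card := lt_of_lt_of_le (by positivity) hcard
  set A := (P : ℝ) ^ (D + (m - r) + N * (k + E)) with hA
  set L := (4 * (1 + Real.log ((⌈β * M₀⌉₊ : ℝ) + 2))) ^ K with hL
  have hA0 : 0 < A := by positivity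
  have hL0 : 0 ≤ L := by
    have := Real.log_nonneg (x := (⌈β * M₀⌉₊ : ℝ) + 2)
      (by linarith [(⌈β * M₀⌉₊).cast_nonneg (α := ℝ)])
    positivity
  have hSP : S / Q.card * (P : ℝ) ^ c ≤ C₂ * L := by
    rw [div_mul_eq_mul_div, div_le_iff₀ hQ0]
    calc S * (P : ℝ) ^ c ≤ C₂ * A * L * (P : ℝ) ^ c :=
          mul_le_mul_of_nonneg_right hsum (by positivity)
      _ = C₂ * L * (A * (P : ℝ) ^ c) := by ring
      _ ≤ _ := mul_le_mul_of_nonneg_left hcard (by positivity)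
  calc ‖Ibeta F β‖ ^ 2 ^ (k + E + 1) * (P : ℝ) ^ c ≤ C₁ * (S / Q.card) * (P : ℝ) ^ c :=
        mul_le_mul_of_nonneg_right hI (by positivity)
    _ = C₁ * (S / Q.card * (P : ℝ) ^ c) := by ring
    _ ≤ C₁ * (C₂ * ((4 ^ K * K.factorial * Real.exp 1) * ((M₀ + 3) * β))) :=
        mul_le_mul_of_nonneg_left (hSP.trans (mul_le_mul_of_nonneg_left hlog hC₂)) hC₁
    _ = _ := by ring

theorem exists_norm_Ibeta_mul_sq_le {F : MvPolynomial (Idx n m r) ℤ} {E k D c : ℕ}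
    (hF : Bihomogeneous F (E + 1) (k + 1)) (hD : dimV2 F = ((D : ℕ∞) : WithBot ℕ∞))
    (hc : D + (m - r) + c = Fintype.card (IdxL n m r))
    (hc' : 7 * (k + E + 1) * 2 ^ (k + E) ≤ c) :
    ∃ C : ℝ, 0 ≤ C ∧ ∀ β : ℝ, 1 ≤ β → ‖Ibeta F β‖ * β ^ 2 ≤ C := by
  obtain ⟨C, hC, h⟩ := exists_norm_Ibeta_pow_mul_le hF hD hc
  refine ⟨max 1 (2 ^ c * C), by positivity, fun β hβ => ?_⟩
  set T := k + E + 1 with hT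
  set y := β ^ ((T : ℝ)⁻¹) with hy
  have hyT : y ^ T = β := Real.rpow_inv_natCast_pow (by linarith) (by omega)
  have hy1 : 1 ≤ y := Real.one_le_rpow hβ (by positivity)
  have hP : 1 ≤ ⌊y⌋₊ := Nat.one_le_floor_iff _ |>.2 hy1
  have hPy : (⌊y⌋₊ : ℝ) ≤ y := Nat.floor_le (by linarith)
  have hyP : y / 2 ≤ (⌊y⌋₊ : ℝ) := by
    have h1 := Nat.lt_floor_add_one y
    have h2 : (1 : ℝ) ≤ ⌊y⌋₊ := by exact_mod_cast hP
    linarith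
  have h1 := h β ⌊y⌋₊ hP ((pow_le_pow_left₀ (by positivity) hPy _).trans hyT.le)
  have h2 : ‖Ibeta F β‖ ^ 2 ^ T * y ^ c ≤ 2 ^ c * C * y ^ T := by
    have h3 : (y / 2) ^ c ≤ (⌊y⌋₊ : ℝ) ^ c := pow_le_pow_left₀ (by positivity) hyP _
    rw [div_pow, div_le_iff₀ (by positivity)] at h3
    calc ‖Ibeta F β‖ ^ 2 ^ T * y ^ c ≤ ‖Ibeta F β‖ ^ 2 ^ T * ((⌊y⌋₊ : ℝ) ^ c * 2 ^ c) :=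
          mul_le_mul_of_nonneg_left h3 (by positivity)
      _ = 2 ^ c * (‖Ibeta F β‖ ^ 2 ^ T * (⌊y⌋₊ : ℝ) ^ c) := by ring
      _ ≤ 2 ^ c * (C * β) := mul_le_mul_of_nonneg_left h1 (by positivity)
      _ = _ := by rw [hyT]; ring
  have h3 : (‖Ibeta F β‖ * β ^ 2) ^ 2 ^ T ≤ 2 ^ c * C := by
    rw [mul_pow, show β ^ 2 = y ^ (T * 2) by rw [pow_mul, hyT], ← pow_mul]
    have hexp : T + T * 2 * 2 ^ T ≤ c := by
      refine le_trans ?_ hc'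
      rw [hT, pow_succ]
      have : 1 ≤ 2 ^ (k + E) := Nat.one_le_two_pow
      nlinarith
    have h4 : y ^ T * y ^ (T * 2 * 2 ^ T) ≤ y ^ c := by
      rw [← pow_add]; exact pow_le_pow_right₀ hy1 hexp
    have h5 : 0 < y ^ T := by positivity
    refine le_of_mul_le_mul_right ?_ h5
    calc _ = ‖Ibeta F β‖ ^ 2 ^ T * (y ^ T * y ^ (T * 2 * 2 ^ T)) := by ring
      _ ≤ ‖Ibeta F β‖ ^ 2 ^ T * y ^ c := mul_le_mul_of_nonneg_left h4 (by positivity)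
      _ ≤ _ := h2
  by_contra! hcon
  have h6 : 1 ≤ ‖Ibeta F β‖ * β ^ 2 := (le_max_left _ _).trans hcon.le
  have h7 := le_self_pow₀ h6 (pow_ne_zero T two_ne_zero : (2 : ℕ) ^ T ≠ 0)
  linarith [le_max_right 1 (2 ^ c * C)]

theorem Ibeta_neg (F : MvPolynomial (Idx n m r) ℤ) (β : ℝ) :
    Ibeta F (-β) = starRingEnd ℂ (Ibeta F β) := by
  rw [Ibeta_eq_integral, Ibeta_eq_integral, ← integral_conj]
  congr 1
  ext1 p
  rw [integrand, integrand]
  split_ifs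
  · rw [conj_eexp, neg_mul]
  · simp

theorem integrable_indicator_closedBall : Integrable ((Metric.closedBall (0 :
    (Fin (r + 1) → ℝ) × (IdxT n m r → ℝ)) 1).indicator fun _ => (1 : ℝ)) :=
  (continuousOn_const.integrableOn_compact (isCompact_closedBall _ _)).integrable_indicator
    Metric.isClosed_closedBall.measurableSet

theorem norm_integrand_le_indicator (F : MvPolynomial (Idx n m r) ℤ) (β : ℝ)
    (p : (Fin (r + 1) → ℝ) × (IdxT n m r → ℝ)) :
    ‖integrand F β p‖ ≤ (Metric.closedBall 0 1).indicator (fun _ => (1 : ℝ)) p := by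
  by_cases hp : p ∈ Metric.closedBall 0 1
  · rw [Set.indicator_of_mem hp]; exact norm_integrand_le F β p
  · rw [Set.indicator_of_notMem hp, integrand_eq_zero F β hp, norm_zero]

theorem continuous_Ibeta (F : MvPolynomial (Idx n m r) ℤ) : Continuous fun β => Ibeta F β := by
  simp only [Ibeta_eq_integral]
  refine continuous_of_dominated (fun β => (measurable_integrand F β).aestronglyMeasurable)
    (fun β => Filter.Eventually.of_forall (norm_integrand_le_indicator F β))
    integrable_indicator_closedBall (Filter.Eventually.of_forall fun p => ?_)
  simp only [integrand]
  split_ifs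
  · exact continuous_eexp.comp (by fun_prop)
  · exact continuous_const

theorem norm_Ibeta_mul_sq_le {F : MvPolynomial (Idx n m r) ℤ} {C : ℝ}
    (h : ∀ β : ℝ, 1 ≤ β → ‖Ibeta F β‖ * β ^ 2 ≤ C) {β : ℝ} (hβ : 1 ≤ |β|) :
    ‖Ibeta F β‖ * β ^ 2 ≤ C := by
  rcases abs_cases β with ⟨h1, h2⟩ | ⟨h1, h2⟩
  · exact h β (by linarith)
  · have := h (-β) (by linarith)
    rwa [Ibeta_neg, RCLike.norm_conj, neg_sq] at this

theorem integrable_Ibeta {F : MvPolynomial (Idx n m r) ℤ} {C : ℝ}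
    (h : ∀ β : ℝ, 1 ≤ β → ‖Ibeta F β‖ * β ^ 2 ≤ C) : Integrable fun β => Ibeta F β := by
  obtain ⟨B, hB⟩ := (isCompact_Icc (a := (-1 : ℝ)) (b := 1)).exists_bound_of_continuousOn
    (continuous_Ibeta F).continuousOn
  refine (integrable_inv_one_add_sq.const_mul (2 * max B C)).mono'
    (continuous_Ibeta F).aestronglyMeasurable (Filter.Eventually.of_forall fun β => ?_)
  rw [← div_eq_mul_inv, le_div_iff₀ (by positivity), mul_add, mul_one]
  rcases le_total |β| 1 with h1 | h1
  · have h2 := hB β (abs_le.1 h1)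
    have h3 : β ^ 2 ≤ 1 := by rw [← sq_abs]; exact pow_le_one₀ (abs_nonneg _) h1
    nlinarith [norm_nonneg (Ibeta F β), le_max_left B C]
  · have h2 := norm_Ibeta_mul_sq_le h h1
    have h3 : 1 ≤ β ^ 2 := by rw [← sq_abs]; exact one_le_pow₀ h1
    nlinarith [norm_nonneg (Ibeta F β), le_max_right B C]

theorem norm_setIntegral_Ioi_le {f : ℝ → ℂ} {C φ : ℝ} (hφ : 0 < φ)
    (h : ∀ β : ℝ, φ < β → ‖f β‖ * β ^ 2 ≤ C) : ‖∫ β in Set.Ioi φ, f β‖ ≤ C / φ := by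
  have hi : IntegrableOn (fun t : ℝ => C * t ^ (-2 : ℝ)) (Set.Ioi φ) :=
    (integrableOn_Ioi_rpow_of_lt (by norm_num) hφ).const_mul C
  have hv : ∫ t in Set.Ioi φ, C * t ^ (-2 : ℝ) = C / φ := by
    rw [integral_const_mul, integral_Ioi_rpow_of_lt (by norm_num) hφ]
    norm_num [Real.rpow_neg_one]
    rfl
  rw [← hv]
  refine norm_integral_le_of_norm_le hi ((ae_restrict_iff' measurableSet_Ioi).2
    (Filter.Eventually.of_forall fun t ht => ?_))
  have ht0 : 0 < t := hφ.trans ht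
  rw [Real.rpow_neg ht0.le, ← div_eq_mul_inv, le_div_iff₀ (by positivity)]
  simpa using h t ht

theorem norm_Jint_sub_Jphi_le {F : MvPolynomial (Idx n m r) ℤ} {C : ℝ}
    (h : ∀ β : ℝ, 1 ≤ β → ‖Ibeta F β‖ * β ^ 2 ≤ C) {φ : ℝ} (hφ : 1 ≤ φ) :
    ‖Jint F - Jphi F φ‖ ≤ 2 * C / φ := by
  have hint := integrable_Ibeta h
  have h1 : Jint F - Jphi F φ = (∫ β in Set.Iio (-φ), Ibeta F β) + ∫ β in Set.Ioi φ, Ibeta F β := by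
    rw [Jint, Jphi, ← integral_add_compl (measurableSet_Icc (a := -φ) (b := φ)) hint,
      add_sub_cancel_left, ← setIntegral_union _ measurableSet_Ioi hint.integrableOn
        hint.integrableOn]
    · congr 2
      ext β
      simp only [Set.mem_compl_iff, Set.mem_Icc, Set.mem_union, Set.mem_Iio, Set.mem_Ioi,
        not_and_or, not_le]
    · refine Set.disjoint_left.2 fun β h1 h2 => ?_
      simp only [Set.mem_Iio, Set.mem_Ioi] at h1 h2
      linarith
  have h2 : ∫ β in Set.Iio (-φ), Ibeta F β = ∫ β in Set.Ioi φ, Ibeta F (-β) := by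
    rw [← integral_Iic_eq_integral_Iio, integral_comp_neg_Ioi φ fun β => Ibeta F β]
  rw [h1, h2]
  refine (norm_add_le _ _).trans ?_
  have h3 := norm_setIntegral_Ioi_le (f := fun β => Ibeta F β) (C := C) (by linarith : 0 < φ)
    fun β hβ => h β (by linarith)
  have h4 := norm_setIntegral_Ioi_le (f := fun β => Ibeta F (-β)) (C := C) (by linarith : 0 < φ)
    fun β hβ => by
      rw [Ibeta_neg, RCLike.norm_conj]
      exact h β (by linarith)
  rw [two_mul, add_div]
  exact add_le_add h4 h3

end decay

/-!
Statement 6: if `K := (n + 2 - max(dim V₁*, dim V₂*)) / 2^{d₁+d₂-2} > 7(d₁+d₂-1)` then the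
singular integral `J = ∫_ℝ I(β) dβ` is absolutely convergent, and for all sufficiently
large `φ` one has `|J - J(φ)| ≪ φ⁻¹`, the implied constant depending only on
`F, n, m, r`.
-/
theorem statement6
    (n m r d₁ d₂ : ℕ) (hr1 : 1 ≤ r) (hrm : r ≤ m) (hmn : m ≤ n)
    (hd₁ : 1 ≤ d₁) (hd₂ : 1 ≤ d₂) (hdm : d₁ < m + 1) (hdn : d₂ < n - r + 1)
    (F : MvPolynomial (Idx n m r) ℤ) (hF : Bihomogeneous F d₁ d₂)
    (D₁ D₂ : ℕ) (hD₁ : dimV1 F = ((D₁ : ℕ∞) : WithBot ℕ∞))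
    (hD₂ : dimV2 F = ((D₂ : ℕ∞) : WithBot ℕ∞))
    (hK : 7 * ((d₁ : ℝ) + d₂ - 1) <
      ((n : ℝ) + 2 - (max D₁ D₂ : ℕ)) / 2 ^ (d₁ + d₂ - 2)) :
    MeasureTheory.Integrable (fun β : ℝ => Ibeta F β) ∧
      ∃ Cc : ℝ, 0 < Cc ∧ ∃ φ₀ : ℝ, ∀ φ : ℝ, φ₀ ≤ φ →
        ‖Jint F - Jphi F φ‖ ≤ Cc / φ := by
  obtain ⟨E, rfl⟩ : ∃ E, d₁ = E + 1 := ⟨d₁ - 1, by omega⟩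
  obtain ⟨k, rfl⟩ : ∃ k, d₂ = k + 1 := ⟨d₂ - 1, by omega⟩
  have hexp : E + 1 + (k + 1) - 2 = k + E := by omega
  rw [hexp, lt_div_iff₀ (by positivity)] at hK
  have hmax : (D₂ : ℝ) ≤ (max D₁ D₂ : ℕ) := by exact_mod_cast le_max_right D₁ D₂
  have hlt : 7 * (k + E + 1) * 2 ^ (k + E) + D₂ < n + 2 := by
    have : (7 * (k + E + 1) * 2 ^ (k + E) + D₂ : ℝ) < n + 2 := by
      rw [Nat.cast_add, Nat.cast_add, Nat.cast_one] at hK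
      have h1 : (7 : ℝ) * (E + 1 + (k + 1) - 1) * 2 ^ (k + E) =
          7 * (k + E + 1) * 2 ^ (k + E) := by ring
      linarith
    exact_mod_cast this
  obtain ⟨c, hc⟩ : ∃ c, D₂ + (m - r) + c = Fintype.card (IdxL n m r) :=
    ⟨Fintype.card (IdxL n m r) - (D₂ + (m - r)), by rw [card_IdxL hrm hmn]; omega⟩
  have hc' : 7 * (k + E + 1) * 2 ^ (k + E) ≤ c := by
    rw [card_IdxL hrm hmn] at hc
    omega
  obtain ⟨C, hC, h⟩ := exists_norm_Ibeta_mul_sq_le hF hD₂ hc hc'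
  refine ⟨integrable_Ibeta h, 2 * C + 1, by positivity, 1, fun φ hφ => ?_⟩
  refine (norm_Jint_sub_Jphi_le h hφ).trans ?_
  gcongr
  linarith

end PaperTM
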